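/- For every positive integer q, the group homology of Γ = PSL_2(O_{-13}) with trivial ℤ/2-coefficients satisfies: dim_{F_2} H_1(Γ; ℤ/2) = 5, dim_{F_2} H_2(Γ; ℤ/2) = 6, and dim_{F_2} H_q(Γ; ℤ/2) = 2q − 1 for all q ≥ 3, where each H_q(Γ; ℤ/2) is a vector space over the field F_2 with two elements. -/

import Mathlib

/-!
Group homology via the inhomogeneous bar complex (trivial coefficients).
-/

namespace BarHomology

/-- The `n`-th term of the inhomogeneous bar complex of `G` with trivial coefficients in `A`. -/
abbrev chains (G : Type) (A : Type) [AddCommGroup A] (n : ℕ) : Type := (Fin n → G) →₀ A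

/-- The differential of the inhomogeneous bar complex with trivial coefficients:
`d (g₁, …, g_{n+1}) = (g₂, …, g_{n+1}) + ∑_{j=1}^{n} (-1)^j (g₁, …, g_j g_{j+1}, …, g_{n+1})
  + (-1)^{n+1} (g₁, …, g_n)`. -/
noncomputable def d (k : Type) [CommRing k] (G : Type) [Group G] (A : Type) [AddCommGroup A]
    [Module k A] (n : ℕ) : chains G A (n + 1) →ₗ[k] chains G A n :=
  Finsupp.lsum k fun g =>
    (Finsupp.lsingle (fun i => g i.succ) : A →ₗ[k] chains G A n)
      + ∑ j : Fin (n + 1),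
          ((-1 : k) ^ ((j : ℕ) + 1)) • (Finsupp.lsingle (Fin.contractNth j (· * ·) g))

/-- The cycles: everything in degree `0`, the kernel of the differential in positive degrees. -/
noncomputable def cycles (k : Type) [CommRing k] (G : Type) [Group G] (A : Type) [AddCommGroup A]
    [Module k A] : (n : ℕ) → Submodule k (chains G A n)
  | 0 => ⊤
  | (n + 1) => LinearMap.ker (d k G A n)

/-- The boundaries, viewed as a submodule of the cycles. -/
noncomputable def boundariesIn (k : Type) [CommRing k] (G : Type) [Group G] (A : Type)
    [AddCommGroup A] [Module k A] (n : ℕ) : Submodule k (cycles k G A n) :=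
  (LinearMap.range (d k G A n)).comap (cycles k G A n).subtype

/-- Group homology of `G` in degree `n` with trivial coefficients in the `k`-module `A`,
defined as cycles modulo boundaries in the inhomogeneous bar complex. -/
abbrev GroupHomology (k : Type) [CommRing k] (G : Type) [Group G] (A : Type) [AddCommGroup A]
    [Module k A] (n : ℕ) : Type :=
  ↥(cycles k G A n) ⧸ boundariesIn k G A n

section Maps

variable {k : Type} [CommRing k] {G G' : Type} [Group G] [Group G'] {A : Type} [AddCommGroup A]
  [Module k A]

/-- The chain map induced by a group homomorphism. -/
noncomputable def chainsMap (k : Type) [CommRing k] (A : Type) [AddCommGroup A] [Module k A]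
    (φ : G →* G') (n : ℕ) : chains G A n →ₗ[k] chains G' A n :=
  Finsupp.lmapDomain A k (fun f => φ ∘ f)

lemma comp_contractNth (φ : G →* G') {n : ℕ} (j : Fin (n + 1)) (g : Fin (n + 1) → G) :
    φ ∘ Fin.contractNth j (· * ·) g = Fin.contractNth j (· * ·) (φ ∘ g) := by
  funext i
  rcases lt_trichotomy (i : ℕ) (j : ℕ) with h | h | h
  · simp [Function.comp_apply, Fin.contractNth_apply_of_lt _ _ _ _ h]
  · simp [Function.comp_apply, Fin.contractNth_apply_of_eq _ _ _ _ h, map_mul]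
  · simp [Function.comp_apply, Fin.contractNth_apply_of_gt _ _ _ _ h]

lemma chainsMap_comm (φ : G →* G') (n : ℕ) :
    (d k G' A n).comp (chainsMap k A φ (n + 1))
      = (chainsMap k A φ n).comp (d k G A n) := by
  apply Finsupp.lhom_ext
  intro g a
  simp only [LinearMap.comp_apply, chainsMap, Finsupp.lmapDomain_apply, Finsupp.mapDomain_single,
    d, Finsupp.lsum_single, LinearMap.add_apply, LinearMap.sum_apply, LinearMap.smul_apply,
    Finsupp.lsingle_apply, map_add, map_sum, map_smul]
  congr 1
  refine Finset.sum_congr rfl fun j _ => ?_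
  rw [comp_contractNth]

lemma chainsMap_mem_cycles (φ : G →* G') {n : ℕ} {x : chains G A n}
    (hx : x ∈ cycles k G A n) : chainsMap k A φ n x ∈ cycles k G' A n := by
  cases n with
  | zero => trivial
  | succ n =>
    simp only [cycles, LinearMap.mem_ker] at hx ⊢
    have := LinearMap.congr_fun (chainsMap_comm (k := k) (A := A) φ n) x
    simp only [LinearMap.comp_apply] at this
    rw [this, hx, map_zero]

/-- The map induced by a group homomorphism on cycles. -/
noncomputable def cyclesMap (k : Type) [CommRing k] (A : Type) [AddCommGroup A] [Module k A]
    (φ : G →* G') (n : ℕ) : ↥(cycles k G A n) →ₗ[k] ↥(cycles k G' A n) :=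
  (chainsMap k A φ n).restrict fun _ hx => chainsMap_mem_cycles φ hx

/-- The map induced by a group homomorphism on group homology with trivial coefficients. -/
noncomputable def inducedMap (k : Type) [CommRing k] (A : Type) [AddCommGroup A] [Module k A]
    (φ : G →* G') (n : ℕ) :
    GroupHomology k G A n →ₗ[k] GroupHomology k G' A n :=
  Submodule.mapQ (boundariesIn k G A n) (boundariesIn k G' A n) (cyclesMap k A φ n) (by
    rintro ⟨x, hx⟩ hb
    simp only [boundariesIn, Submodule.mem_comap, Submodule.subtype_apply,
      LinearMap.mem_range] at hb ⊢
    obtain ⟨w, hw⟩ := hb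
    refine ⟨chainsMap k A φ (n + 1) w, ?_⟩
    have := LinearMap.congr_fun (chainsMap_comm (k := k) (A := A) φ n) w
    simp only [LinearMap.comp_apply] at this
    rw [this, hw]
    rfl)

end Maps

end BarHomology

open BarHomology

/-- The projective special linear group `PSL₂(R)`, i.e. `SL₂(R)` modulo its center. -/
abbrev PSL2 (R : Type) [CommRing R] : Type :=
  Matrix.ProjectiveSpecialLinearGroup (Fin 2) R

open CategoryTheory

namespace BianchiHomology

section Theory
variable {k G : Type} [CommRing k] [Group G]

/-- The map induced on group homology by a morphism of representations. -/
noncomputable def Hmap {A B : Rep.{0} k G} (f : A ⟶ B) (n : ℕ) :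
    groupHomology A n →ₗ[k] groupHomology B n :=
  (groupHomology.map (MonoidHom.id G) f n).hom

lemma Hmap_id (A : Rep.{0} k G) (n : ℕ) : Hmap (𝟙 A) n = LinearMap.id := by
  have h : groupHomology.map (MonoidHom.id G) (𝟙 A) n = 𝟙 _ := groupHomology.map_id n
  rw [Hmap, h]; rfl

lemma Hmap_comp {A B C : Rep.{0} k G} (f : A ⟶ B) (g : B ⟶ C) (n : ℕ) :
    Hmap (f ≫ g) n = Hmap g n ∘ₗ Hmap f n := by
  rw [Hmap, groupHomology.map_id_comp]; rfl

lemma Hmap_add {A B : Rep.{0} k G} (f g : A ⟶ B) (n : ℕ) :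
    Hmap (f + g) n = Hmap f n + Hmap g n := by
  have h : groupHomology.chainsMap (MonoidHom.id G) (f + g) =
     groupHomology.chainsMap (MonoidHom.id G) f + groupHomology.chainsMap (MonoidHom.id G) g := by
    refine HomologicalComplex.hom_ext _ _ fun i => ?_
    refine ModuleCat.hom_ext ?_
    refine Finsupp.lhom_ext fun x a => ?_
    have e := fun φ : A ⟶ B => groupHomology.chainsMap_f_single (MonoidHom.id G) φ i x a
    refine (e (f + g)).trans ?_
    refine Eq.trans ?_ (congrArg₂ (· + ·) (e f) (e g)).symm
    exact Finsupp.single_add _ _ _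
  refine LinearMap.ext fun x => ?_
  rw [Hmap, groupHomology.map, h, HomologicalComplex.homologyMap_add]
  rfl

variable {S : ShortComplex (Rep.{0} k G)} (hS : S.ShortExact)

/-- The connecting homomorphism. -/
noncomputable def conn (n : ℕ) : groupHomology S.X₃ (n + 1) →ₗ[k] groupHomology S.X₁ n :=
  (groupHomology.δ hS (n + 1) n rfl).hom

lemma exact_two {S : ShortComplex (Rep.{0} k G)} (hS : S.ShortExact) (n : ℕ) :
    Function.Exact (Hmap S.f n) (Hmap S.g n) :=
  (ShortComplex.ShortExact.moduleCat_exact_iff_function_exact _).1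
    (groupHomology.mapShortComplex₂_exact hS n)

lemma exact_one (n : ℕ) : Function.Exact (conn hS n) (Hmap S.f n) :=
  (ShortComplex.ShortExact.moduleCat_exact_iff_function_exact _).1
    (groupHomology.mapShortComplex₁_exact hS (i := n + 1) (j := n) rfl)

lemma exact_three (n : ℕ) : Function.Exact (Hmap S.g (n + 1)) (conn hS n) :=
  (ShortComplex.ShortExact.moduleCat_exact_iff_function_exact _).1
    (groupHomology.mapShortComplex₃_exact hS (i := n + 1) (j := n) rfl)

lemma conn_naturality {S' : ShortComplex (Rep.{0} k G)} (hS' : S'.ShortExact) (φ : S ⟶ S')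
    (n : ℕ) (x : groupHomology S.X₃ (n + 1)) :
    conn hS' n (Hmap φ.τ₃ (n + 1) x) = Hmap φ.τ₁ n (conn hS n x) := by
  have := HomologicalComplex.HomologySequence.δ_naturality
    ((groupHomology.chainsFunctor k G).mapShortComplex.map φ)
    (groupHomology.map_chainsFunctor_shortExact hS)
    (groupHomology.map_chainsFunctor_shortExact hS') (n + 1) n rfl
  have h2 := congrArg (fun f => f.hom x) this
  exact h2.symm

lemma Hmap_zero_surjective {A B : Rep.{0} k G} (f : A ⟶ B) (hf : Function.Surjective f.hom) :
    Function.Surjective (Hmap f 0) := by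
  have : Epi f := (Rep.epi_iff_surjective f).2 hf
  exact (ModuleCat.epi_iff_surjective _).1 (groupHomology.epi_map_0_of_epi f)

lemma contractNth_succ_cons {n : ℕ} (a : G) (g : Fin (n + 1) → G) (j : Fin (n + 1)) :
    Fin.contractNth j.succ (· * ·) (Fin.cons a g : Fin (n + 2) → G) =
      Fin.cons a (Fin.contractNth j (· * ·) g) := by
  funext i
  refine Fin.cases ?_ (fun i => ?_) i
  · rw [Fin.contractNth_apply_of_lt _ _ _ _ (by simp)]; simp
  · rcases lt_trichotomy (i : ℕ) (j : ℕ) with h | h | h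
    · rw [Fin.contractNth_apply_of_lt _ _ _ _ (by simpa using h), Fin.cons_succ,
        Fin.contractNth_apply_of_lt _ _ _ _ h, ← Fin.succ_castSucc, Fin.cons_succ]
    · rw [Fin.contractNth_apply_of_eq _ _ _ _ (by simpa using h), Fin.cons_succ, Fin.cons_succ,
        Fin.contractNth_apply_of_eq _ _ _ _ h, ← Fin.succ_castSucc, Fin.cons_succ]
    · rw [Fin.contractNth_apply_of_gt _ _ _ _ (by simpa using h), Fin.cons_succ, Fin.cons_succ,
        Fin.contractNth_apply_of_gt _ _ _ _ h]

lemma contractNth_zero_cons {n : ℕ} (a : G) (g : Fin (n + 1) → G) :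
    Fin.contractNth 0 (· * ·) (Fin.cons a g : Fin (n + 2) → G) =
      Fin.cons (a * g 0) (fun i => g i.succ) := by
  funext i
  refine Fin.cases ?_ (fun i => ?_) i
  · rw [Fin.contractNth_apply_of_eq _ _ _ _ (by simp)]; simp
  · rw [Fin.contractNth_apply_of_gt _ _ _ _ (by simp)]; simp

/-- The permutation representation on `X →₀ k`. -/
noncomputable def permRepresentation (k G X : Type) [CommRing k] [Group G] [MulAction G X] :
    Representation k G (X →₀ k) where
  toFun g := Finsupp.lmapDomain k k (g • ·)
  map_one' := by ext; simp
  map_mul' g h := by ext; simp [mul_smul]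

lemma permRepresentation_single {X : Type} [MulAction G X] (g : G) (x : X) (r : k) :
    permRepresentation k G X g (Finsupp.single x r) = Finsupp.single (g • x) r := by
  simp [permRepresentation]

/-- The permutation representation as an object of `Rep k G`. -/
noncomputable abbrev permRep (k G X : Type) [CommRing k] [Group G] [MulAction G X] :
    Rep.{0} k G := Rep.of (permRepresentation k G X)

/-- The differential of the bar complex as a linear map. -/
noncomputable def barD {V : Type} [AddCommGroup V] [Module k V] (ρ : Representation k G V)
    (n : ℕ) : ((Fin (n + 1) → G) →₀ V) →ₗ[k] ((Fin n → G) →₀ V) :=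
  (groupHomology.inhomogeneousChains.d (Rep.of ρ) n).hom

lemma barD_single {V : Type} [AddCommGroup V] [Module k V] (ρ : Representation k G V)
    (n : ℕ) (g : Fin (n + 1) → G) (a : V) :
    barD ρ n (Finsupp.single g a) = Finsupp.single (fun i => g i.succ) (ρ (g 0)⁻¹ a) +
      Finset.univ.sum fun j : Fin (n + 1) =>
        (-1 : k) ^ ((j : ℕ) + 1) • Finsupp.single (Fin.contractNth j (· * ·) g) a :=
  groupHomology.inhomogeneousChains.d_single (A := Rep.of ρ) n g a

lemma subsingleton_homology_of_exact {V : Type} [AddCommGroup V] [Module k V]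
    (ρ : Representation k G V) (n : ℕ) (h : ∀ z, barD ρ n z = 0 → ∃ w, barD ρ (n + 1) w = z) :
    Subsingleton (groupHomology (Rep.of ρ) (n + 1)) := by
  have h : (groupHomology.inhomogeneousChains (Rep.of ρ)).ExactAt (n + 1) := by
    rw [HomologicalComplex.exactAt_iff' _ (n + 2) (n + 1) n (by simp) (by simp),
      ShortComplex.moduleCat_exact_iff]
    intro z hz
    obtain ⟨w, hw⟩ := h z (by
      rw [barD, ← groupHomology.inhomogeneousChains.d_def]; exact hz)
    refine ⟨w, ?_⟩
    rw [barD, ← groupHomology.inhomogeneousChains.d_def] at hw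
    exact hw
  rw [HomologicalComplex.exactAt_iff_isZero_homology] at h
  exact ModuleCat.subsingleton_of_isZero h

/-- The contracting homotopy of the bar complex with coefficients in the regular
representation. -/
noncomputable def regularHomotopy (k G : Type) [CommRing k] [Group G] (n : ℕ) :
    ((Fin n → G) →₀ (G →₀ k)) →ₗ[k] ((Fin (n + 1) → G) →₀ (G →₀ k)) :=
  Finsupp.lsum k fun g => Finsupp.lsum k fun x =>
    (Finsupp.lsingle (Fin.cons x⁻¹ g)) ∘ₗ (Finsupp.lsingle (1 : G))

lemma regularHomotopy_single (n : ℕ) (g : Fin n → G) (x : G) (r : k) :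
    regularHomotopy k G n (Finsupp.single g (Finsupp.single x r)) =
      Finsupp.single (Fin.cons x⁻¹ g) (Finsupp.single 1 r) := by
  rw [regularHomotopy, Finsupp.lsum_single, Finsupp.lsum_single]
  rfl

lemma regularHomotopy_comm (n : ℕ) (z : (Fin (n + 1) → G) →₀ (G →₀ k)) :
    barD (permRepresentation k G G) (n + 1) (regularHomotopy k G (n + 1) z) +
      regularHomotopy k G n (barD (permRepresentation k G G) n z) = z := by
  have key : barD (permRepresentation k G G) (n + 1) ∘ₗ regularHomotopy k G (n + 1) +
      regularHomotopy k G n ∘ₗ barD (permRepresentation k G G) n = LinearMap.id := by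
    refine Finsupp.lhom_ext fun g a => ?_
    induction a using Finsupp.induction_linear with
    | zero => simp
    | add a b ha hb => rw [Finsupp.single_add, map_add, map_add, ha, hb]
    | single x r =>
      rw [LinearMap.add_apply, LinearMap.comp_apply, LinearMap.comp_apply,
        regularHomotopy_single, barD_single, barD_single, Fin.sum_univ_succ, map_add, map_sum]
      have e : ∀ j : Fin (n + 1), regularHomotopy k G n (((-1 : k) ^ ((j : ℕ) + 1)) •
          Finsupp.single (Fin.contractNth j (· * ·) g) (Finsupp.single x r)) =
          ((-1 : k) ^ ((j : ℕ) + 1)) • Finsupp.single (Fin.cons x⁻¹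
            (Fin.contractNth j (· * ·) g)) (Finsupp.single 1 r) := by
        intro j
        rw [map_smul, regularHomotopy_single]
      rw [Finset.sum_congr rfl fun j _ => e j]
      have e2 : ∀ j : Fin (n + 1), (((-1 : k) ^ ((j.succ : ℕ) + 1)) •
          Finsupp.single (Fin.contractNth j.succ (· * ·) (Fin.cons x⁻¹ g : Fin (n + 2) → G))
            (Finsupp.single (1 : G) r)) +
          (((-1 : k) ^ ((j : ℕ) + 1)) • Finsupp.single (Fin.cons x⁻¹
            (Fin.contractNth j (· * ·) g)) (Finsupp.single 1 r)) = 0 := by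
        intro j
        rw [contractNth_succ_cons, Fin.val_succ, ← add_smul, pow_succ _ ((j : ℕ) + 1), mul_neg_one,
          neg_add_cancel, zero_smul]
      have e3 := Finset.sum_eq_zero fun j (_ : j ∈ Finset.univ) => e2 j
      rw [Finset.sum_add_distrib] at e3
      have e4 : (((-1 : k) ^ (((0 : Fin (n + 2)) : ℕ) + 1)) •
          Finsupp.single (Fin.contractNth 0 (· * ·) (Fin.cons x⁻¹ g : Fin (n + 2) → G))
            (Finsupp.single (1 : G) r)) +
          regularHomotopy k G n (Finsupp.single (fun i => g i.succ)
            (permRepresentation k G G (g 0)⁻¹ (Finsupp.single x r))) = 0 := by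
        rw [permRepresentation_single, regularHomotopy_single, contractNth_zero_cons, smul_eq_mul,
          mul_inv_rev, inv_inv, Fin.val_zero, zero_add, pow_one]
        have aux : ∀ {M : Type} [AddCommGroup M] [Module k M] (m : M), (-1 : k) • m + m = 0 := by
          intro M _ _ m
          rw [neg_one_smul, neg_add_cancel]
        exact aux (M := (Fin (n + 1) → G) →₀ (G →₀ k)) _
      have aux : ∀ {M : Type} [AddCommGroup M] {P Q R T U W : M}, P = W → Q + T = 0 → R + U = 0 →
          P + (Q + R) + (T + U) = W := by
        intro M _ P Q R T U W h1 h2 h3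
        rw [add_assoc, add_add_add_comm, h2, h3, add_zero, add_zero, h1]
      refine aux ?_ e4 e3
      rw [permRepresentation_single]
      simp
  exact LinearMap.congr_fun key z

lemma subsingleton_regular (n : ℕ) :
    Subsingleton (groupHomology (permRep k G G) (n + 1)) := by
  refine subsingleton_homology_of_exact _ n fun z hz => ⟨regularHomotopy k G (n + 1) z, ?_⟩
  simpa [hz] using regularHomotopy_comm (k := k) n z

lemma finrank_ker_quotient_congr {A B C : Type} [AddCommGroup A] [AddCommGroup B]
    [AddCommGroup C] [Module k A] [Module k B] [Module k C] {f f' : A →ₗ[k] B} {g g' : B →ₗ[k] C}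
    (hf : f = f') (hg : g = g') (h : ∀ x, f x ∈ LinearMap.ker g) :
    Module.finrank k (LinearMap.ker g ⧸ LinearMap.range (f.codRestrict (LinearMap.ker g) h)) =
      Module.finrank k (LinearMap.ker g' ⧸ (LinearMap.range f').comap
        (LinearMap.ker g').subtype) := by
  subst hf hg
  have e : LinearMap.range (f.codRestrict (LinearMap.ker g) h) =
      (LinearMap.range f).comap (LinearMap.ker g).subtype := by
    ext x
    simp [Subtype.ext_iff]
  rw [e]

/-- Group homology with trivial coefficients in terms of the bar complex. -/
lemma finrank_homology_trivial (q : ℕ) :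
    Module.finrank k (BarHomology.GroupHomology k G k (q + 1)) =
      Module.finrank k (groupHomology (Rep.of (Representation.trivial k G k)) (q + 1)) := by
  have hd : ∀ n, BarHomology.d k G k n = barD (Representation.trivial k G k) n := by
    intro n
    refine Finsupp.lhom_ext fun g a => ?_
    rw [barD_single, BarHomology.d, Finsupp.lsum_single]
    simp
  have e1 := ((groupHomology.inhomogeneousChains (Rep.of
      (Representation.trivial k G k))).homologyIsoSc' (q + 2) (q + 1) q (by simp) (by simp)) ≪≫
      ShortComplex.moduleCatHomologyIso _
  refine Eq.trans ?_ e1.toLinearEquiv.finrank_eq.symm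
  refine (finrank_ker_quotient_congr ?_ ?_ _).symm
  · rw [hd, barD, ← groupHomology.inhomogeneousChains.d_def]; rfl
  · rw [hd, barD, ← groupHomology.inhomogeneousChains.d_def]; rfl

end Theory

end BianchiHomology

namespace BianchiHomology

section Toolkit
variable {k G : Type} [CommRing k] [Group G]

/-- A short complex of representations that is exact on underlying modules is short exact. -/
lemma shortExact_mk {A B C : Rep.{0} k G} (f : A ⟶ B) (g : B ⟶ C) (w : f ≫ g = 0)
    (hf : Function.Injective f.hom) (hfg : Function.Exact f.hom g.hom)
    (hg : Function.Surjective g.hom) : (ShortComplex.mk f g w).ShortExact := by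
  have h1 : Mono f := (Rep.mono_iff_injective f).2 hf
  have h2 : Epi g := (Rep.epi_iff_surjective g).2 hg
  refine { exact := ?_, mono_f := h1, epi_g := h2 }
  rw [← ShortComplex.exact_map_iff_of_faithful _ (forget₂ (Rep k G) (ModuleCat k))]
  rw [ShortComplex.ShortExact.moduleCat_exact_iff_function_exact]
  exact hfg

/-- A morphism of representations from an equivariant linear map. -/
def mkHom {V W : Type} [AddCommGroup V] [Module k V] [AddCommGroup W] [Module k W]
    {ρ : Representation k G V} {σ : Representation k G W} (f : V →ₗ[k] W)
    (h : ∀ g v, f (ρ g v) = σ g (f v)) : Rep.of ρ ⟶ Rep.of σ :=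
  Rep.ofHom ⟨f, fun g => LinearMap.ext (h g)⟩

@[simp] lemma mkHom_apply {V W : Type} [AddCommGroup V] [Module k V] [AddCommGroup W] [Module k W]
    {ρ : Representation k G V} {σ : Representation k G W} (f : V →ₗ[k] W)
    (h : ∀ g v, f (ρ g v) = σ g (f v)) (v : V) : (mkHom f h).hom v = f v := rfl

lemma hom_equivariant {A B : Rep.{0} k G} (f : A ⟶ B) (g : G) (a : A) :
    f.hom (A.ρ g a) = B.ρ g (f.hom a) := Rep.hom_comm_apply f g a

lemma rep_hom_ext {A B : Rep.{0} k G} {f g : A ⟶ B} (h : ∀ a, f.hom a = g.hom a) : f = g := by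
  ext a; exact h a

lemma permRep_hom_ext {X : Type} [MulAction G X] {B : Rep.{0} k G} {f g : permRep k G X ⟶ B}
    (h : ∀ x, f.hom (Finsupp.single x 1) = g.hom (Finsupp.single x 1)) : f = g := by
  refine rep_hom_ext fun a => ?_
  have : f.hom.toLinearMap = g.hom.toLinearMap := by
    refine Finsupp.lhom_ext' fun x => LinearMap.ext_ring ?_
    exact h x
  exact LinearMap.congr_fun this a

/-- The morphism out of a permutation representation determined by an equivariant map. -/
noncomputable def permHom {X : Type} [MulAction G X] (B : Rep.{0} k G) (v : X → B)
    (h : ∀ g x, v (g • x) = B.ρ g (v x)) : permRep k G X ⟶ B :=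
  mkHom (σ := B.ρ) (Finsupp.linearCombination k v) fun g a => by
    induction a using Finsupp.induction_linear with
    | zero => simp
    | add a b ha hb => simp only [map_add, ha, hb]
    | single x r => rw [permRepresentation_single]; simp [h]

@[simp] lemma permHom_single {X : Type} [MulAction G X] (B : Rep.{0} k G) (v : X → B)
    (h : ∀ g x, v (g • x) = B.ρ g (v x)) (x : X) (r : k) :
    (permHom B v h).hom (Finsupp.single x r) = r • v x := by
  rw [permHom, mkHom_apply]; simp

/-- The class in degree zero homology of an element of a representation. -/
noncomputable def h0mk (A : Rep.{0} k G) : A →ₗ[k] groupHomology A 0 := (groupHomology.H0π A).hom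

lemma h0mk_map {A B : Rep.{0} k G} (f : A ⟶ B) (a : A) :
    Hmap f 0 (h0mk A a) = h0mk B (f.hom a) := by
  have := groupHomology.H0π_comp_map (MonoidHom.id G) (A := A) (B := B) f
  exact congrArg (fun f => f.hom a) this

lemma h0mk_surjective (A : Rep.{0} k G) : Function.Surjective (h0mk A) :=
  (ModuleCat.epi_iff_surjective _).1 inferInstance

lemma h0mk_eq_zero {A : Rep.{0} k G} {a : A} (h : h0mk A a = 0) :
    Representation.Coinvariants.mk A.ρ a = 0 := by
  have := groupHomology.H0π_comp_H0Iso_hom A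
  have h2 := congrArg (fun f => f.hom a) this
  refine h2.symm.trans ?_
  have h3 : (groupHomology.H0Iso A).hom.hom (h0mk A a) = 0 := by rw [h, map_zero]
  exact h3

lemma h0mk_smul {A : Rep.{0} k G} (g : G) (a : A) : h0mk A (A.ρ g a) = h0mk A a := by
  have := groupHomology.H0π_comp_H0Iso_hom A
  have h2 := fun a => congrArg (fun f => f.hom a) this
  have h3 : Function.Injective (groupHomology.H0Iso A).hom.hom :=
    (groupHomology.H0Iso A).toLinearEquiv.injective
  apply h3
  refine (h2 _).trans (Eq.trans ?_ (h2 _).symm)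
  exact Representation.Coinvariants.mk_self_apply _ _ _

/-- An invariant linear map descends to degree zero homology. -/
lemma exists_h0lift (A : Rep.{0} k G) {W : Type} [AddCommGroup W] [Module k W] (φ : A →ₗ[k] W)
    (h : ∀ g a, φ (A.ρ g a) = φ a) : ∃ ψ : groupHomology A 0 →ₗ[k] W, ∀ a, ψ (h0mk A a) = φ a := by
  refine ⟨(Representation.Coinvariants.lift A.ρ φ (fun g => LinearMap.ext (h g))) ∘ₗ
    (groupHomology.H0Iso A).hom.hom, fun a => ?_⟩
  have := groupHomology.H0π_comp_H0Iso_hom A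
  have h2 := congrArg (fun f => f.hom a) this
  refine (congrArg (Representation.Coinvariants.lift A.ρ φ (fun g => LinearMap.ext (h g)))
    h2).trans ?_
  exact Representation.Coinvariants.lift_mk A.ρ φ _ a

/-- The additive version of `Hmap`. -/
noncomputable def HmapHom (A B : Rep.{0} k G) (n : ℕ) :
    (A ⟶ B) →+ (groupHomology A n →ₗ[k] groupHomology B n) :=
  AddMonoidHom.mk' (fun f => Hmap f n) fun f g => Hmap_add f g n

lemma Hmap_zero {A B : Rep.{0} k G} (n : ℕ) : Hmap (0 : A ⟶ B) n = 0 := (HmapHom A B n).map_zero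

lemma Hmap_sum {ι : Type} (s : Finset ι) {A B : Rep.{0} k G} (f : ι → (A ⟶ B)) (n : ℕ) :
    Hmap (∑ i ∈ s, f i) n = ∑ i ∈ s, Hmap (f i) n := map_sum (HmapHom A B n) f s

lemma Hmap_comp_apply {A B C : Rep.{0} k G} (f : A ⟶ B) (g : B ⟶ C) (n : ℕ) (x) :
    Hmap (f ≫ g) n x = Hmap g n (Hmap f n x) := by rw [Hmap_comp]; rfl

lemma Hmap_id_apply {A : Rep.{0} k G} (n : ℕ) (x) : Hmap (𝟙 A) n x = x := by rw [Hmap_id]; rfl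

/-- Isomorphic representations have isomorphic homology. -/
noncomputable def Hequiv {A B : Rep.{0} k G} (f : A ⟶ B) (g : B ⟶ A) (h1 : f ≫ g = 𝟙 A)
    (h2 : g ≫ f = 𝟙 B) (n : ℕ) : groupHomology A n ≃ₗ[k] groupHomology B n :=
  LinearEquiv.ofLinearMap (Hmap f n) (Hmap g n) (by rw [← Hmap_comp, h2, Hmap_id])
    (by rw [← Hmap_comp, h1, Hmap_id])

end Toolkit

end BianchiHomology

namespace BianchiHomology

section Caps
variable {G : Type} [Group G]

/-- The twist of a representation by a character with values in `ZMod 2`. -/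
def twist (χ : G →* Multiplicative (ZMod 2)) {V : Type} [AddCommGroup V] [Module (ZMod 2) V]
    (ρ : Representation (ZMod 2) G V) : Representation (ZMod 2) G (ZMod 2 → V) where
  toFun g := (ρ g).compLeft (ZMod 2) ∘ₗ LinearMap.funLeft (ZMod 2) V (fun t => t - (χ g).toAdd)
  map_one' := by ext; simp [LinearMap.funLeft]
  map_mul' g h := by
    refine LinearMap.ext fun f => funext fun t => ?_
    simp [LinearMap.funLeft, sub_sub]

variable (χ : G →* Multiplicative (ZMod 2))

/-- The twist as an object of the category of representations. -/
abbrev Tw (A : Rep.{0} (ZMod 2) G) : Rep.{0} (ZMod 2) G := Rep.of (twist χ A.ρ)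

/-- The diagonal inclusion of a representation in its twist. -/
def twConst (A : Rep.{0} (ZMod 2) G) : A ⟶ Tw χ A :=
  mkHom (ρ := A.ρ) (LinearMap.pi fun _ => LinearMap.id) fun _ _ => rfl

lemma sum_shift {V : Type} [AddCommGroup V] (f : ZMod 2 → V) (s : ZMod 2) :
    f (0 - s) + f (1 - s) = f 0 + f 1 := by
  have : s = 0 ∨ s = 1 := by revert s; decide
  rcases this with rfl | rfl
  · simp
  · rw [add_comm]; rfl

/-- Summation of the two values of a function on `ZMod 2`. -/
def sumMap (V : Type) [AddCommGroup V] [Module (ZMod 2) V] : (ZMod 2 → V) →ₗ[ZMod 2] V where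
  toFun f := f 0 + f 1
  map_add' _ _ := add_add_add_comm _ _ _ _
  map_smul' r f := (smul_add r (f 0) (f 1)).symm

/-- The summation map from a twist to the representation. -/
def twSum (A : Rep.{0} (ZMod 2) G) : Tw χ A ⟶ A :=
  mkHom (σ := A.ρ) (sumMap A) fun g f => by
    change A.ρ g (f (0 - (χ g).toAdd)) + A.ρ g (f (1 - (χ g).toAdd)) = A.ρ g (f 0 + f 1)
    rw [← map_add, sum_shift f]

lemma twConst_apply (A : Rep.{0} (ZMod 2) G) (a : A) : (twConst χ A).hom a = fun _ => a := rfl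

lemma twSum_apply (A : Rep.{0} (ZMod 2) G) (f : Tw χ A) : (twSum χ A).hom f = f 0 + f 1 := rfl

lemma add_self_zmod {V : Type} [AddCommGroup V] [Module (ZMod 2) V] (v : V) : v + v = 0 := by
  have := add_smul (1 : ZMod 2) 1 v
  rw [one_smul, show (1 + 1 : ZMod 2) = 0 from rfl, zero_smul] at this
  exact this.symm

lemma twConst_twSum (A : Rep.{0} (ZMod 2) G) : twConst χ A ≫ twSum χ A = 0 :=
  rep_hom_ext fun a => add_self_zmod a

lemma tw_shortExact (A : Rep.{0} (ZMod 2) G) :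
    (ShortComplex.mk _ _ (twConst_twSum χ A)).ShortExact := by
  refine shortExact_mk _ _ _ (fun a b h => congrFun h 0) (fun f => ⟨fun h => ?_, ?_⟩) fun a => ?_
  · refine ⟨f 0, ?_⟩
    rw [twSum_apply] at h
    rw [twConst_apply]
    funext t
    have : t = 0 ∨ t = 1 := by revert t; decide
    rcases this with rfl | rfl
    · rfl
    · have h2 := add_self_zmod (f 0)
      exact add_left_cancel (h2.trans h.symm)
  · rintro ⟨a, rfl⟩
    exact add_self_zmod a
  · refine ⟨fun t => if t = 0 then a else 0, ?_⟩
    rw [twSum_apply]; simp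

/-- Cap product with a character. -/
noncomputable def cap (A : Rep.{0} (ZMod 2) G) (n : ℕ) :
    groupHomology A (n + 1) →ₗ[ZMod 2] groupHomology A n :=
  conn (tw_shortExact χ A) n

/-- Functoriality of the twist. -/
def twMap {A B : Rep.{0} (ZMod 2) G} (f : A ⟶ B) : Tw χ A ⟶ Tw χ B :=
  mkHom (f.hom.toLinearMap.compLeft (ZMod 2)) fun g a => funext fun t => by
    exact hom_equivariant f g _

lemma cap_naturality {A B : Rep.{0} (ZMod 2) G} (f : A ⟶ B) (n : ℕ)
    (x : groupHomology A (n + 1)) : cap χ B n (Hmap f (n + 1) x) = Hmap f n (cap χ A n x) := by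
  refine conn_naturality (tw_shortExact χ A) (tw_shortExact χ B)
    { τ₁ := f, τ₂ := twMap χ f, τ₃ := f, comm₁₂ := ?_, comm₂₃ := ?_ } n x
  · exact rep_hom_ext fun a => rfl
  · refine rep_hom_ext fun a => ?_
    exact (map_add f.hom _ _).symm

/-- The morphism out of a coset representation given by an invariant vector. -/
noncomputable def cosetHom (K : Subgroup G) {k : Type} [CommRing k] (B : Rep.{0} k G) (v : B)
    (h : ∀ g ∈ K, B.ρ g v = v) : permRep k G (G ⧸ K) ⟶ B :=
  permHom B (Quotient.lift (fun g => B.ρ g v) fun a b hab => by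
      have h1 := h _ (QuotientGroup.leftRel_apply.1 hab)
      have h2 := congrArg (B.ρ a) h1
      rw [← Module.End.mul_apply, ← map_mul, mul_inv_cancel_left] at h2
      exact h2.symm) fun g x => by
    induction x using QuotientGroup.induction_on with
    | H x => exact congrFun (congrArg DFunLike.coe (map_mul B.ρ g x)) v

lemma cosetHom_single (K : Subgroup G) {k : Type} [CommRing k] (B : Rep.{0} k G) (v : B)
    (h : ∀ g ∈ K, B.ρ g v = v) (x : G) :
    (cosetHom K B v h).hom (Finsupp.single (x : G ⧸ K) 1) = B.ρ x v := by
  rw [cosetHom, permHom_single, one_smul]; rfl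

lemma coset_hom_ext (K : Subgroup G) {k : Type} [CommRing k] {B : Rep.{0} k G}
    {f g : permRep k G (G ⧸ K) ⟶ B}
    (h : f.hom (Finsupp.single ((1 : G) : G ⧸ K) 1) = g.hom (Finsupp.single ((1 : G) : G ⧸ K) 1)) :
    f = g := by
  refine permRep_hom_ext fun x => ?_
  induction x using QuotientGroup.induction_on with
  | H x =>
    have e : (Finsupp.single (x : G ⧸ K) (1 : k)) =
        permRepresentation k G (G ⧸ K) x (Finsupp.single ((1 : G) : G ⧸ K) 1) := by
      rw [permRepresentation_single]; congr 1
      change (x : G ⧸ K) = ((x * 1 : G) : G ⧸ K)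
      rw [mul_one]
    rw [e]
    exact (hom_equivariant f x _).trans ((congrArg (B.ρ x) h).trans (hom_equivariant g x _).symm)

/-- The cap product with a character trivial on the stabiliser vanishes. -/
lemma cap_eq_zero (K : Subgroup G) (hK : ∀ g ∈ K, χ g = 1) (n : ℕ)
    (x : groupHomology (permRep (ZMod 2) G (G ⧸ K)) (n + 1)) : cap χ _ n x = 0 := by
  let A := permRep (ZMod 2) G (G ⧸ K)
  let v : Tw χ A := fun t => if t = 0 then Finsupp.single ((1 : G) : G ⧸ K) 1 else 0
  have hv : ∀ g ∈ K, (Tw χ A).ρ g v = v := by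
    intro g hg
    refine funext fun t => ?_
    have : (Tw χ A).ρ g v t = A.ρ g (v (t - (χ g).toAdd)) := rfl
    rw [this, hK g hg]
    simp only [v, toAdd_one, sub_zero]
    split_ifs
    · refine (permRepresentation_single _ _ _).trans ?_
      congr 1
      change ((g * 1 : G) : G ⧸ K) = ((1 : G) : G ⧸ K)
      rw [mul_one]
      exact QuotientGroup.eq.2 (by simpa using hg)
    · exact map_zero _
  have e : cosetHom K (Tw χ A) v hv ≫ twSum χ A = 𝟙 A := by
    refine coset_hom_ext K ?_
    have h1 := cosetHom_single K (Tw χ A) v hv 1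
    change (twSum χ A).hom ((cosetHom K (Tw χ A) v hv).hom _) = _
    rw [h1, map_one, Module.End.one_apply, twSum_apply]
    simp only [v, if_true, one_ne_zero, if_false, add_zero]
    rfl
  refine (exact_three (tw_shortExact χ A) n x).2 ⟨Hmap (cosetHom K (Tw χ A) v hv) (n + 1) x, ?_⟩
  change Hmap (twSum χ A) (n + 1) _ = _
  rw [← Hmap_comp_apply, e, Hmap_id_apply]

end Caps

end BianchiHomology

namespace BianchiHomology

section Cosets
variable {G : Type} [Group G]

lemma Hmap_bijective {k : Type} [CommRing k] {A B : Rep.{0} k G} (f : A ⟶ B)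
    (hf : Function.Bijective f.hom) (n : ℕ) : Function.Bijective (Hmap f n) := by
  let e : A ≃ₗ[k] B := LinearEquiv.ofBijective f.hom.toLinearMap hf
  have he : ∀ a, e a = f.hom a := fun _ => rfl
  let g : B ⟶ A := mkHom (ρ := B.ρ) (σ := A.ρ) e.symm.toLinearMap fun g b => by
    apply e.injective
    change e (e.symm _) = e _
    rw [e.apply_symm_apply, he, hom_equivariant, ← he]
    change _ = B.ρ g (e (e.symm b))
    rw [e.apply_symm_apply]
  refine (Hequiv f g (rep_hom_ext fun a => ?_) (rep_hom_ext fun a => ?_) n).bijective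
  · exact e.symm_apply_apply a
  · exact e.apply_symm_apply a

/-- The morphism of permutation representations induced by an equivariant map. -/
noncomputable def permMap (k : Type) [CommRing k] {X Y : Type} [MulAction G X] [MulAction G Y]
    (f : X → Y) (h : ∀ (g : G) x, f (g • x) = g • f x) : permRep k G X ⟶ permRep k G Y :=
  permHom _ (fun x => Finsupp.single (f x) 1) fun g x => by
    rw [h]; exact (permRepresentation_single _ _ _).symm

lemma permMap_single (k : Type) [CommRing k] {X Y : Type} [MulAction G X] [MulAction G Y]
    (f : X → Y) (h : ∀ (g : G) x, f (g • x) = g • f x) (x : X) (r : k) :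
    (permMap k f h).hom (Finsupp.single x r) = Finsupp.single (f x) r := by
  rw [permMap, permHom_single, Finsupp.smul_single, smul_eq_mul, mul_one]

/-- Augmentation in degree zero of a transitive permutation representation. -/
lemma exists_h0aug (k : Type) [CommRing k] (X : Type) [MulAction G X] [MulAction.IsPretransitive G X]
    [Nonempty X] : ∃ ε : groupHomology (permRep k G X) 0 ≃ₗ[k] k,
      ∀ x r, ε (h0mk (permRep k G X) (Finsupp.single x r)) = r := by
  obtain ⟨ψ, hψ⟩ := exists_h0lift (permRep k G X) (Finsupp.linearCombination k fun _ : X => (1 : k))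
    (fun g a => by
      change Finsupp.linearCombination k _ (permRepresentation k G X g a) = _
      induction a using Finsupp.induction_linear with
      | zero => simp
      | add a b ha hb => simp only [map_add, ha, hb]
      | single x r => rw [permRepresentation_single]; simp)
  have hs : ∀ x r, ψ (h0mk (permRep k G X) (Finsupp.single x r)) = r := by
    intro x r; rw [hψ]; simp
  obtain ⟨x₀⟩ := ‹Nonempty X›
  have key : ∀ a : X →₀ k, h0mk (permRep k G X) a = h0mk (permRep k G X)
      (Finsupp.single x₀ (ψ (h0mk (permRep k G X) a))) := by
    intro a
    induction a using Finsupp.induction_linear with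
    | zero => erw [map_zero, map_zero, Finsupp.single_zero, map_zero]
    | add a b ha hb =>
      have e := map_add (h0mk (permRep k G X)) a b
      refine e.trans ?_
      rw [e, map_add, Finsupp.single_add]
      exact (congrArg₂ (· + ·) ha hb).trans (map_add (h0mk (permRep k G X)) _ _).symm
    | single x r =>
      rw [hs]
      obtain ⟨g, hg⟩ := MulAction.exists_smul_eq G x x₀
      rw [← hg, ← permRepresentation_single]
      exact (h0mk_smul (A := permRep k G X) g _).symm
  refine ⟨LinearEquiv.ofBijective ψ ⟨?_, fun r => ⟨_, hs x₀ r⟩⟩, hs⟩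
  rw [injective_iff_map_eq_zero]
  intro y hy
  obtain ⟨a, rfl⟩ := h0mk_surjective _ y
  rw [key, hy, Finsupp.single_zero, map_zero]

lemma Hmap_permMap_zero_bijective (k : Type) [CommRing k] {X Y : Type} [MulAction G X]
    [MulAction G Y] [MulAction.IsPretransitive G X] [MulAction.IsPretransitive G Y] [Nonempty X]
    (f : X → Y) (h : ∀ (g : G) x, f (g • x) = g • f x) :
    Function.Bijective (Hmap (permMap k f h) 0) := by
  have : Nonempty Y := ‹Nonempty X›.map f
  obtain ⟨ε, hε⟩ := exists_h0aug (G := G) k X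
  obtain ⟨ε', hε'⟩ := exists_h0aug (G := G) k Y
  obtain ⟨x₀⟩ := ‹Nonempty X›
  have e : ∀ y, ε' (Hmap (permMap k f h) 0 y) = ε y := by
    intro y
    obtain ⟨r, rfl⟩ : ∃ r, h0mk (permRep k G X) (Finsupp.single x₀ r) = y :=
      ⟨ε y, ε.injective (hε _ _)⟩
    rw [h0mk_map, permMap_single, hε, hε']
  have e2 : (Hmap (permMap k f h) 0 : _ → _) = ε'.symm ∘ ε := by
    funext y
    rw [Function.comp_apply, ← e, ε'.symm_apply_apply]
  rw [e2]
  exact ε'.symm.bijective.comp ε.bijective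

variable (χ : G →* Multiplicative (ZMod 2))

/-- A double cover of a `G`-set classified by a character gives a Gysin sequence. -/
lemma exists_gysin {X X' : Type} [MulAction G X] [MulAction G X'] (π : X' → X)
    (hπ : ∀ (g : G) x, π (g • x) = g • π x) (c : X' → ZMod 2)
    (hc : ∀ (g : G) x, c (g • x) = (χ g).toAdd + c x)
    (hb : Function.Bijective fun x => (c x, π x)) (n : ℕ) :
    ∃ tr : groupHomology (permRep (ZMod 2) G X) n →ₗ[ZMod 2]
        groupHomology (permRep (ZMod 2) G X') n,
      Function.Exact (Hmap (permMap (ZMod 2) π hπ) (n + 1)) (cap χ (permRep (ZMod 2) G X) n) ∧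
      Function.Exact (cap χ (permRep (ZMod 2) G X) n) tr ∧
      Function.Exact tr (Hmap (permMap (ZMod 2) π hπ) n) := by
  classical
  let A := permRep (ZMod 2) G X
  let v : X' → Tw χ A := fun x => Pi.single (c x) (Finsupp.single (π x) 1)
  have hv : ∀ g x, v (g • x) = (Tw χ A).ρ g (v x) := by
    intro g x
    refine funext fun t => ?_
    have : (Tw χ A).ρ g (v x) t = permRepresentation (ZMod 2) G X g (v x (t - (χ g).toAdd)) := rfl
    rw [this]
    simp only [v, Pi.single_apply, hc, hπ, sub_eq_iff_eq_add']
    split_ifs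
    · exact (permRepresentation_single _ _ _).symm
    · exact (map_zero _).symm
  let φ : permRep (ZMod 2) G X' ⟶ Tw χ A := permHom _ v hv
  have hφs : ∀ x r, φ.hom (Finsupp.single x r) = Pi.single (c x) (Finsupp.single (π x) r) := by
    intro x r
    refine (permHom_single _ v hv x r).trans ?_
    change r • Pi.single (M := fun _ => X →₀ ZMod 2) (c x) (Finsupp.single (π x) 1) = _
    rw [← Pi.single_smul, Finsupp.smul_single, smul_eq_mul, mul_one]
  have hφ : φ ≫ twSum χ A = permMap (ZMod 2) π hπ := by
    refine permRep_hom_ext fun x => ?_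
    change (twSum χ A).hom (φ.hom _) = _
    rw [hφs, permMap_single, twSum_apply]
    have : c x = 0 ∨ c x = 1 := by generalize c x = t; revert t; decide
    rcases this with h | h
    · rw [h, Pi.single_eq_same, Pi.single_eq_of_ne (by decide)]; exact add_zero _
    · rw [h, Pi.single_eq_same, Pi.single_eq_of_ne (by decide)]; exact zero_add _
  have hφb : Function.Bijective φ.hom := by
    let e := Equiv.ofBijective _ hb
    let ψ : (ZMod 2 → (X →₀ ZMod 2)) →ₗ[ZMod 2] (X' →₀ ZMod 2) :=
      ∑ t, Finsupp.lmapDomain (ZMod 2) (ZMod 2) (fun x => e.symm (t, x)) ∘ₗ LinearMap.proj t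
    have hψ : ∀ t x r, ψ (Pi.single t (Finsupp.single x r)) =
        Finsupp.single (e.symm (t, x)) r := by
      intro t x r
      simp only [ψ, LinearMap.sum_apply, LinearMap.comp_apply, LinearMap.proj_apply]
      rw [Finset.sum_eq_single t]
      · rw [Pi.single_eq_same, Finsupp.lmapDomain_apply, Finsupp.mapDomain_single]
      · intro s _ hs
        rw [Pi.single_eq_of_ne hs, map_zero]
      · simp
    have h1 : ψ ∘ₗ φ.hom.toLinearMap = LinearMap.id := by
      refine Finsupp.lhom_ext fun x r => ?_
      refine (congrArg ψ (hφs x r)).trans ?_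
      rw [hψ]
      have : e.symm (c x, π x) = x := e.symm_apply_apply x
      rw [this]; rfl
    have h2 : φ.hom.toLinearMap ∘ₗ ψ = LinearMap.id := by
      refine LinearMap.pi_ext' fun t => Finsupp.lhom_ext fun x r => ?_
      refine (congrArg φ.hom (hψ t x r)).trans ?_
      rw [hφs]
      have : (c (e.symm (t, x)), π (e.symm (t, x))) = (t, x) := e.apply_symm_apply (t, x)
      obtain ⟨h1, h2⟩ := Prod.mk.inj this
      rw [h1, h2]; rfl
    exact ⟨fun a b h => by
      have := congrArg ψ h
      exact (LinearMap.congr_fun h1 a).symm.trans (this.trans (LinearMap.congr_fun h1 b)),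
      fun b => ⟨ψ b, LinearMap.congr_fun h2 b⟩⟩
  let E := fun m => LinearEquiv.ofBijective (Hmap φ m) (Hmap_bijective φ hφb m)
  have hE : ∀ m y, Hmap (permMap (ZMod 2) π hπ) m y = Hmap (twSum χ A) m (E m y) := by
    intro m y
    rw [← hφ, Hmap_comp_apply]; rfl
  refine ⟨(E n).symm.toLinearMap ∘ₗ Hmap (twConst χ A) n, ?_, ?_, ?_⟩
  · intro x
    refine (exact_three (tw_shortExact χ A) n x).trans ⟨?_, ?_⟩
    · rintro ⟨y, hy⟩
      exact ⟨(E _).symm y, by rw [hE, (E _).apply_symm_apply]; exact hy⟩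
    · rintro ⟨y, hy⟩
      exact ⟨E _ y, by rw [← hy, hE]⟩
  · intro x
    refine Iff.trans ?_ (exact_one (tw_shortExact χ A) n x)
    exact LinearEquiv.map_eq_zero_iff (E n).symm
  · intro x
    rw [hE]
    refine (exact_two (tw_shortExact χ A) n (E n x)).trans ⟨?_, ?_⟩
    · rintro ⟨y, hy⟩
      exact ⟨y, (E n).symm_apply_eq.2 hy⟩
    · rintro ⟨y, hy⟩
      exact ⟨y, (E n).symm_apply_eq.1 hy⟩

/-- The projection between coset spaces. -/
def cosetProj {K K' : Subgroup G} (h : K' ≤ K) : G ⧸ K' → G ⧸ K :=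
  Quotient.map' id fun _ _ hab => QuotientGroup.leftRel_apply.2 (h (QuotientGroup.leftRel_apply.1 hab))

lemma cosetProj_smul {K K' : Subgroup G} (h : K' ≤ K) (g : G) (x : G ⧸ K') :
    cosetProj h (g • x) = g • cosetProj h x := by
  induction x using QuotientGroup.induction_on with
  | H x => rfl

/-- The morphism of coset representations. -/
noncomputable abbrev cosetMap {K K' : Subgroup G} (h : K' ≤ K) :
    permRep (ZMod 2) G (G ⧸ K') ⟶ permRep (ZMod 2) G (G ⧸ K) :=
  permMap (ZMod 2) (cosetProj h) (cosetProj_smul h)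

lemma exists_gysin_coset {K K' : Subgroup G} (h : K' ≤ K) {τ : G} (hτ : τ ∈ K)
    (hχτ : χ τ = Multiplicative.ofAdd 1) (h1 : ∀ g ∈ K', χ g = 1)
    (h2 : ∀ g ∈ K, χ g = 1 → g ∈ K') (n : ℕ) :
    ∃ tr : groupHomology (permRep (ZMod 2) G (G ⧸ K)) n →ₗ[ZMod 2]
        groupHomology (permRep (ZMod 2) G (G ⧸ K')) n,
      Function.Exact (Hmap (cosetMap h) (n + 1)) (cap χ (permRep (ZMod 2) G (G ⧸ K)) n) ∧
      Function.Exact (cap χ (permRep (ZMod 2) G (G ⧸ K)) n) tr ∧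
      Function.Exact tr (Hmap (cosetMap h) n) := by
  have hker : ∀ a b : G, a⁻¹ * b ∈ K' → χ a = χ b := by
    intro a b hab
    have := h1 _ hab
    rw [map_mul, map_inv] at this
    exact (inv_mul_eq_one.1 this)
  refine exists_gysin χ (cosetProj h) (cosetProj_smul h)
    (Quotient.lift (fun g => (χ g).toAdd) fun a b hab => by
      rw [hker a b (QuotientGroup.leftRel_apply.1 hab)]) ?_ ?_ n
  · intro g x
    induction x using QuotientGroup.induction_on with
    | H x => exact congrArg Multiplicative.toAdd (map_mul χ g x)
  · constructor
    · intro x y hxy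
      induction x using QuotientGroup.induction_on with
      | H x =>
      induction y using QuotientGroup.induction_on with
      | H y =>
        obtain ⟨e1, e2⟩ := Prod.mk.inj hxy
        have e1 : χ x = χ y := e1
        have e2 : (x : G ⧸ K) = (y : G ⧸ K) := e2
        refine QuotientGroup.eq.2 (h2 _ (QuotientGroup.eq.1 e2) ?_)
        rw [map_mul, map_inv, e1, inv_mul_cancel]
    · rintro ⟨t, x⟩
      induction x using QuotientGroup.induction_on with
      | H x =>
        by_cases ht : (χ x).toAdd = t
        · exact ⟨(x : G ⧸ K'), Prod.ext ht rfl⟩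
        · refine ⟨((x * τ : G) : G ⧸ K'), Prod.ext ?_ ?_⟩
          · change (χ (x * τ)).toAdd = t
            rw [map_mul, hχτ, toAdd_mul, toAdd_ofAdd]
            revert ht
            generalize (χ x).toAdd = s
            revert s t
            decide
          · exact QuotientGroup.eq.2 (by simpa using K.inv_mem hτ)

lemma subsingleton_of_bot {K : Subgroup G} (hK : K = ⊥) (n : ℕ) :
    Subsingleton (groupHomology (permRep (ZMod 2) G (G ⧸ K)) (n + 1)) := by
  have hm : ∀ (g x : G), ((g • x : G) : G ⧸ K) = g • (x : G ⧸ K) := fun g x => rfl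
  have hb : Function.Bijective (permMap (ZMod 2) (fun g : G => (g : G ⧸ K))
      hm).hom := by
    have e : ((permMap (ZMod 2) (fun g : G => (g : G ⧸ K)) hm).hom : _ → _)
        = Finsupp.mapDomain (fun g : G => (g : G ⧸ K)) := by
      funext a
      refine LinearMap.congr_fun (f := Rep.Hom.hom (permMap (ZMod 2) _ _) |>.toLinearMap)
        (g := Finsupp.lmapDomain (ZMod 2) (ZMod 2) (fun g : G => (g : G ⧸ K))) ?_ a
      refine Finsupp.lhom_ext fun x r => ?_
      rw [Finsupp.lmapDomain_apply, Finsupp.mapDomain_single]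
      exact permMap_single _ _ _ _ _
    rw [e]
    have hq : Function.Bijective (fun g : G => (g : G ⧸ K)) := by
      refine ⟨fun a b h => ?_, Quotient.mk_surjective⟩
      have := QuotientGroup.eq.1 h
      rw [hK] at this
      exact inv_mul_eq_one.1 (Subgroup.mem_bot.1 this)
    exact ⟨Finsupp.mapDomain_injective hq.1, Finsupp.mapDomain_surjective hq.2⟩
  have := subsingleton_regular (k := ZMod 2) (G := G) n
  exact (Hmap_bijective _ hb (n + 1)).2.subsingleton

end Cosets

end BianchiHomology

namespace BianchiHomology

/-- A vector space over the field with two elements of finite dimension `d`. -/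
def HasDim (V : Type) [AddCommGroup V] [Module (ZMod 2) V] (d : ℕ) : Prop :=
  Module.Finite (ZMod 2) V ∧ Module.finrank (ZMod 2) V = d

section Dim
variable {U V W : Type} [AddCommGroup U] [Module (ZMod 2) U] [AddCommGroup V] [Module (ZMod 2) V]
  [AddCommGroup W] [Module (ZMod 2) W]

lemma HasDim.of_subsingleton [Subsingleton V] : HasDim V 0 :=
  ⟨inferInstance, Module.finrank_zero_of_subsingleton⟩

lemma HasDim.congr {d : ℕ} (h : HasDim V d) (f : V →ₗ[ZMod 2] W) (hf : Function.Bijective f) :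
    HasDim W d := by
  have := h.1
  let e := LinearEquiv.ofBijective f hf
  exact ⟨Module.Finite.equiv e, by rw [← e.finrank_eq, h.2]⟩

lemma HasDim.extension {a c : ℕ} (hU : HasDim U a) (hW : HasDim W c) (f : U →ₗ[ZMod 2] V)
    (g : V →ₗ[ZMod 2] W) (hf : Function.Injective f) (hfg : Function.Exact f g)
    (hg : Function.Surjective g) : HasDim V (a + c) := by
  have h1 := hU.1
  have h2 := hW.1
  have hk : LinearMap.ker g = LinearMap.range f := hfg.linearMap_ker_eq
  have e1 := LinearEquiv.ofInjective f hf
  have fk : Module.Finite (ZMod 2) (LinearMap.ker g) := by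
    rw [hk]; infer_instance
  have fr : Module.Finite (ZMod 2) (LinearMap.range g) := inferInstance
  have e2 := g.quotKerEquivRange
  have fq : Module.Finite (ZMod 2) (V ⧸ LinearMap.ker g) := Module.Finite.equiv e2.symm
  have fV : Module.Finite (ZMod 2) V := Module.Finite.of_submodule_quotient (LinearMap.ker g)
  refine ⟨fV, ?_⟩
  have := LinearMap.finrank_range_add_finrank_ker g
  rw [LinearMap.range_eq_top.2 hg, finrank_top, hk, ← e1.finrank_eq, hW.2, hU.2] at this
  omega

end Dim

section Stabilizers
variable {G : Type} [Group G]

/-- Homology of a coset representation with coefficients in the field with two elements. -/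
abbrev HC (K : Subgroup G) (n : ℕ) : Type := groupHomology (permRep (ZMod 2) G (G ⧸ K)) n

lemma hasDim_coset_zero (K : Subgroup G) : HasDim (HC K 0) 1 := by
  obtain ⟨ε, _⟩ := exists_h0aug (G := G) (ZMod 2) (G ⧸ K)
  exact HasDim.congr (V := ZMod 2) ⟨inferInstance, Module.finrank_self _⟩ ε.symm.toLinearMap
    ε.symm.bijective

variable {χ : G →* Multiplicative (ZMod 2)}

lemma gysin_of_injective {K K' : Subgroup G} (h : K' ≤ K) {τ : G} (hτ : τ ∈ K)
    (hχτ : χ τ = Multiplicative.ofAdd 1) (h1 : ∀ g ∈ K', χ g = 1)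
    (h2 : ∀ g ∈ K, χ g = 1 → g ∈ K') (hi : ∀ n, Function.Injective (Hmap (cosetMap h) n)) (n : ℕ) :
    Function.Exact (Hmap (cosetMap h) (n + 1)) (cap χ (permRep (ZMod 2) G (G ⧸ K)) n) ∧
      Function.Surjective (cap χ (permRep (ZMod 2) G (G ⧸ K)) n) := by
  obtain ⟨tr, e1, e2, e3⟩ := exists_gysin_coset χ h hτ hχτ h1 h2 n
  refine ⟨e1, fun x => (e2 x).1 (hi n ?_)⟩
  rw [map_zero]
  exact (e3 _).2 ⟨x, rfl⟩

lemma cap_bijective_of_involution {K : Subgroup G} {σ : G} (hK : ∀ g ∈ K, g = 1 ∨ g = σ)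
    (hσ : σ ∈ K) (hχ : χ σ = Multiplicative.ofAdd 1) (n : ℕ) :
    Function.Bijective (cap χ (permRep (ZMod 2) G (G ⧸ K)) n) := by
  have hi : ∀ n, Function.Injective (Hmap (cosetMap (bot_le : (⊥ : Subgroup G) ≤ K)) n) := by
    rintro (_ | n)
    · exact (Hmap_permMap_zero_bijective _ _ _).1
    · have := subsingleton_of_bot (G := G) (K := ⊥) rfl n
      exact Function.injective_of_subsingleton _
  obtain ⟨e1, e2⟩ := gysin_of_injective (χ := χ) (bot_le : (⊥ : Subgroup G) ≤ K) hσ hχ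
    (fun g hg => by rw [Subgroup.mem_bot.1 hg, map_one]) (fun g hg hg' => by
      rcases hK g hg with rfl | rfl
      · exact Subgroup.one_mem _
      · rw [hχ] at hg'; exact absurd hg' (by decide)) hi n
  refine ⟨?_, e2⟩
  rw [injective_iff_map_eq_zero]
  intro x hx
  obtain ⟨y, rfl⟩ := (e1 x).1 hx
  have := subsingleton_of_bot (G := G) (K := ⊥) rfl n
  rw [Subsingleton.elim y 0, map_zero]

lemma hasDim_involution {K : Subgroup G} {σ : G} (hK : ∀ g ∈ K, g = 1 ∨ g = σ)
    (hσ : σ ∈ K) (hχ : χ σ = Multiplicative.ofAdd 1) : ∀ n, HasDim (HC K n) 1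
  | 0 => hasDim_coset_zero K
  | n + 1 => by
    have hb := cap_bijective_of_involution hK hσ hχ n
    let e := LinearEquiv.ofBijective _ hb
    exact (hasDim_involution hK hσ hχ n).congr e.symm.toLinearMap e.symm.bijective

lemma cosetMap_injective_of_involution {K H : Subgroup G} {σ : G} (hK : ∀ g ∈ K, g = 1 ∨ g = σ)
    (hσ : σ ∈ K) (hχ : χ σ = Multiplicative.ofAdd 1) (h : K ≤ H) :
    ∀ n, Function.Injective (Hmap (cosetMap h) n)
  | 0 => (Hmap_permMap_zero_bijective _ _ _).1
  | n + 1 => by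
    rw [injective_iff_map_eq_zero]
    intro x hx
    have h1 := cap_naturality χ (cosetMap h) n x
    rw [hx, map_zero] at h1
    have h2 := (injective_iff_map_eq_zero _).1
      (cosetMap_injective_of_involution hK hσ hχ h n) _ h1.symm
    exact (injective_iff_map_eq_zero _).1 (cap_bijective_of_involution hK hσ hχ n).1 _ h2

lemma cosetMap_surjective_of_section {K H : Subgroup G} (h : K ≤ H)
    (v : (G ⧸ K) →₀ ZMod 2) (hv : ∀ g ∈ H, permRepresentation (ZMod 2) G (G ⧸ K) g v = v)
    (hp : (cosetMap h).hom v = Finsupp.single ((1 : G) : G ⧸ H) 1) (n : ℕ) :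
    Function.Surjective (Hmap (cosetMap h) n) := by
  intro x
  refine ⟨Hmap (cosetHom H (permRep (ZMod 2) G (G ⧸ K)) v hv) n x, ?_⟩
  rw [← Hmap_comp_apply]
  have : cosetHom H (permRep (ZMod 2) G (G ⧸ K)) v hv ≫ cosetMap h = 𝟙 _ := by
    refine coset_hom_ext H ?_
    change (cosetMap h).hom ((cosetHom H (permRep (ZMod 2) G (G ⧸ K)) v hv).hom _) = _
    rw [cosetHom_single, map_one, Module.End.one_apply, hp]
    rfl
  rw [this, Hmap_id_apply]

lemma mem_zpowers_involution {σ : G} (hσ : σ * σ = 1) (g : G) (hg : g ∈ Subgroup.zpowers σ) :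
    g = 1 ∨ g = σ := by
  obtain ⟨n, rfl⟩ := Subgroup.mem_zpowers_iff.1 hg
  have h2 : σ ^ (2 : ℤ) = 1 := by rw [zpow_two, hσ]
  obtain ⟨m, rfl | rfl⟩ := n.even_or_odd'
  · left; rw [zpow_mul, h2, one_zpow]
  · right; rw [zpow_add, zpow_mul, h2, one_zpow, one_mul, zpow_one]

/-- A vector of a coset representation summing three translates of the base coset. -/
lemma three_section {K H : Subgroup G} (h : K ≤ H) {r : G} (hr : r ∈ H) (hr3 : r ^ 3 = 1)
    (hg : ∀ g ∈ H, ∃ s : G, (∃ i : ℕ, g = r ^ i * s) ∧ s ∈ K ∧ (s * r = r * s ∨ s * r = r ^ 2 * s))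
    (n : ℕ) : Function.Surjective (Hmap (cosetMap h) n) := by
  let c : ℕ → (G ⧸ K) →₀ ZMod 2 := fun i => Finsupp.single ((r ^ i : G) : G ⧸ K) 1
  have hc3 : c 3 = c 0 := by simp [c, hr3]
  have hcm : ∀ (g : G) (i : ℕ), permRepresentation (ZMod 2) G (G ⧸ K) g (c i) =
      Finsupp.single ((g * r ^ i : G) : G ⧸ K) 1 := fun g i => permRepresentation_single _ _ _
  have hrv : permRepresentation (ZMod 2) G (G ⧸ K) r (c 0 + c 1 + c 2) = c 0 + c 1 + c 2 := by
    have h1 : ∀ i, permRepresentation (ZMod 2) G (G ⧸ K) r (c i) = c (i + 1) := fun i => by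
      rw [hcm, ← pow_succ']
    rw [map_add, map_add, h1, h1, h1, hc3]; abel
  refine cosetMap_surjective_of_section h (c 0 + c 1 + c 2) (fun g hg' => ?_) ?_ n
  · obtain ⟨s, ⟨i, rfl⟩, hs, hsr⟩ := hg g hg'
    have key : permRepresentation (ZMod 2) G (G ⧸ K) s (c 0 + c 1 + c 2) = c 0 + c 1 + c 2 := by
      have h0 : ∀ x : G, ((x * s : G) : G ⧸ K) = (x : G ⧸ K) := fun x =>
        QuotientGroup.eq.2 (by simpa using hs)
      rw [map_add, map_add, hcm, hcm, hcm]
      rcases hsr with hsr | hsr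
      · have e1 : s * r ^ 1 = r ^ 1 * s := by rw [pow_one, hsr]
        have e2 : s * r ^ 2 = r ^ 2 * s := by
          rw [pow_two, ← mul_assoc, hsr, mul_assoc, hsr, mul_assoc]
        rw [e1, e2, h0, h0, pow_zero, mul_one, ← one_mul s, h0]
        simp [c]
      · have e1 : s * r ^ 1 = r ^ 2 * s := by rw [pow_one, hsr]
        have e2 : s * r ^ 2 = r ^ 1 * s := by
          have h4 : r ^ 2 * r ^ 2 = r ^ 1 := by
            rw [← pow_add, show 2 + 2 = 3 + 1 from rfl, pow_add, hr3, one_mul]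
          have h5 : s * r ^ 2 = s * r * r := by rw [pow_two, mul_assoc]
          rw [h5, hsr, mul_assoc, hsr, ← mul_assoc, h4]
        rw [e1, e2, h0, h0, pow_zero, mul_one, ← one_mul s, h0]
        simp only [c, pow_zero]
        abel
    rw [map_mul, Module.End.mul_apply, key]
    clear hg'
    induction i with
    | zero => simp
    | succ i ih => rw [pow_succ, map_mul, Module.End.mul_apply, hrv, ih]
  · have h1 : ∀ i, (cosetMap h).hom (c i) = Finsupp.single ((1 : G) : G ⧸ H) 1 := by
      intro i
      refine (permMap_single _ _ _ _ _).trans ?_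
      congr 1
      exact QuotientGroup.eq.2 (by simpa using H.pow_mem hr i)
    refine (map_add (cosetMap h).hom _ _).trans ?_
    rw [h1]
    refine (congrArg (· + _) ((map_add (cosetMap h).hom _ _).trans (by rw [h1, h1]))).trans ?_
    rw [← Finsupp.single_add, ← Finsupp.single_add]
    rfl

lemma subsingleton_of_order_three {H : Subgroup G} {r : G} (hr : r ∈ H) (hr3 : r ^ 3 = 1)
    (hH : ∀ g ∈ H, ∃ i : ℕ, g = r ^ i) (n : ℕ) : Subsingleton (HC H (n + 1)) := by
  have := subsingleton_of_bot (G := G) (K := ⊥) rfl n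
  refine (three_section (bot_le : (⊥ : Subgroup G) ≤ H) hr hr3 (fun g hg => ?_)
    (n + 1)).subsingleton
  obtain ⟨i, rfl⟩ := hH g hg
  exact ⟨1, ⟨i, by simp⟩, Subgroup.one_mem _, Or.inl (by simp)⟩

lemma hasDim_dihedral {H : Subgroup G} {r σ : G} (hr : r ∈ H) (hσH : σ ∈ H) (hr3 : r ^ 3 = 1)
    (hσ : σ * σ = 1) (hσr : σ * r = r ^ 2 * σ) (hH : ∀ g ∈ H, ∃ i : ℕ, g = r ^ i ∨ g = r ^ i * σ)
    (hχ : χ σ = Multiplicative.ofAdd 1) (n : ℕ) : HasDim (HC H n) 1 := by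
  have hle : Subgroup.zpowers σ ≤ H := by rwa [Subgroup.zpowers_le]
  have hσ' := Subgroup.mem_zpowers σ
  have hz := mem_zpowers_involution hσ
  refine (hasDim_involution hz hσ' hχ n).congr (Hmap (cosetMap hle) n)
    ⟨cosetMap_injective_of_involution hz hσ' hχ hle n, ?_⟩
  refine three_section hle hr hr3 (fun g hg => ?_) n
  obtain ⟨i, rfl | rfl⟩ := hH g hg
  · exact ⟨1, ⟨i, by simp⟩, Subgroup.one_mem _, Or.inl (by simp)⟩
  · exact ⟨σ, ⟨i, rfl⟩, hσ', Or.inr hσr⟩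

lemma hasDim_klein {χ' : G →* Multiplicative (ZMod 2)} {H : Subgroup G} {σ τ : G} (hσH : σ ∈ H)
    (hτH : τ ∈ H) (hσ : σ * σ = 1) (hH : ∀ g ∈ H, g = 1 ∨ g = σ ∨ g = τ ∨ g = σ * τ)
    (h1 : χ σ = 1) (h2 : χ τ = Multiplicative.ofAdd 1) (h3 : χ' σ = Multiplicative.ofAdd 1) :
    ∀ n, HasDim (HC H n) (n + 1)
  | 0 => hasDim_coset_zero H
  | n + 1 => by
    have hle : Subgroup.zpowers σ ≤ H := by rwa [Subgroup.zpowers_le]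
    have hσ' := Subgroup.mem_zpowers σ
    have hz := mem_zpowers_involution hσ
    have hi := cosetMap_injective_of_involution hz hσ' h3 hle
    obtain ⟨e1, e2⟩ := gysin_of_injective (χ := χ) hle hτH h2 (fun g hg => by
      rcases hz g hg with rfl | rfl
      · exact map_one _
      · exact h1) (fun g hg hg' => by
      rcases hH g hg with rfl | rfl | rfl | rfl
      · exact Subgroup.one_mem _
      · exact hσ'
      · rw [h2] at hg'; exact absurd hg' (by decide)
      · rw [map_mul, h1, h2] at hg'; exact absurd hg' (by decide)) hi n
    have := (hasDim_involution hz hσ' h3 (n + 1)).extension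
      (hasDim_klein hσH hτH hσ hH h1 h2 h3 n) _ _ (hi (n + 1)) e1 e2
    rwa [add_comm 1 (n + 1)] at this

end Stabilizers

end BianchiHomology

namespace BianchiHomology

section Sums
set_option linter.unusedSectionVars false
variable {G : Type} [Group G] {ι : Type} [Fintype ι] [DecidableEq ι]

/-- The disjoint union of coset spaces. -/
abbrev Orb (K : ι → Subgroup G) : Type := Σ o, G ⧸ K o

/-- The permutation representation on a disjoint union of coset spaces. -/
noncomputable abbrev C (K : ι → Subgroup G) : Rep.{0} (ZMod 2) G := permRep (ZMod 2) G (Orb K)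

/-- The inclusion of an orbit. -/
noncomputable def incl (K : ι → Subgroup G) (o : ι) : permRep (ZMod 2) G (G ⧸ K o) ⟶ C K :=
  permMap (ZMod 2) (fun x => (⟨o, x⟩ : Orb K)) fun _ _ => rfl

/-- The projection to an orbit. -/
noncomputable def orbProj (K : ι → Subgroup G) (o : ι) : C K ⟶ permRep (ZMod 2) G (G ⧸ K o) :=
  permHom _ (fun s : Orb K => if h : s.1 = o then Finsupp.single (h ▸ s.2) 1 else 0) (by
    rintro g ⟨o', x⟩
    by_cases h : o' = o
    · subst h
      have e := permRepresentation_single (k := ZMod 2) g x 1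
      simpa [Sigma.smul_mk] using e.symm
    · simp [Sigma.smul_mk, h])

lemma incl_single (K : ι → Subgroup G) (o : ι) (x : G ⧸ K o) (r : ZMod 2) :
    (incl K o).hom (Finsupp.single x r) = Finsupp.single ⟨o, x⟩ r := permMap_single _ _ _ _ _

lemma orbProj_single_same (K : ι → Subgroup G) (o : ι) (x : G ⧸ K o) :
    (orbProj K o).hom (Finsupp.single ⟨o, x⟩ 1) = Finsupp.single x 1 := by
  rw [orbProj, permHom_single, one_smul]; simp

lemma orbProj_single_ne (K : ι → Subgroup G) {o o' : ι} (h : o' ≠ o) (x : G ⧸ K o') :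
    (orbProj K o).hom (Finsupp.single ⟨o', x⟩ 1) = 0 := by
  rw [orbProj, permHom_single, one_smul]; simp [h]

lemma incl_orbProj (K : ι → Subgroup G) (o : ι) : incl K o ≫ orbProj K o = 𝟙 _ := by
  refine permRep_hom_ext fun x => ?_
  change (orbProj K o).hom ((incl K o).hom _) = _
  rw [incl_single, orbProj_single_same]; rfl

lemma incl_orbProj_ne (K : ι → Subgroup G) {o o' : ι} (h : o' ≠ o) :
    incl K o' ≫ orbProj K o = 0 := by
  refine permRep_hom_ext fun x => ?_
  change (orbProj K o).hom ((incl K o').hom _) = _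
  rw [incl_single, orbProj_single_ne K h]; rfl

lemma rep_sum_apply {A B : Rep.{0} (ZMod 2) G} (s : Finset ι) (f : ι → (A ⟶ B)) (a : A) :
    (∑ i ∈ s, f i).hom a = ∑ i ∈ s, (f i).hom a := by
  let e : (A ⟶ B) →+ B := AddMonoidHom.mk' (fun f => f.hom a) fun f g => rfl
  exact map_sum e f s

lemma sum_orbProj_incl (K : ι → Subgroup G) : ∑ o, orbProj K o ≫ incl K o = 𝟙 (C K) := by
  refine permRep_hom_ext ?_
  rintro ⟨o, x⟩
  rw [rep_sum_apply, Finset.sum_eq_single o]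
  · change (incl K o).hom ((orbProj K o).hom _) = _
    rw [orbProj_single_same, incl_single]; rfl
  · intro o' _ h
    change (incl K o').hom ((orbProj K o').hom _) = _
    rw [orbProj_single_ne K h.symm, map_zero]
  · simp

lemma Hmap_orbProj_injective (K : ι → Subgroup G) (n : ℕ) {x y : groupHomology (C K) n}
    (h : ∀ o, Hmap (orbProj K o) n x = Hmap (orbProj K o) n y) : x = y := by
  have e : ∀ z : groupHomology (C K) n,
      z = ∑ o, Hmap (incl K o) n (Hmap (orbProj K o) n z) := by
    intro z
    conv_lhs => rw [← Hmap_id_apply n z, ← sum_orbProj_incl, Hmap_sum, LinearMap.sum_apply]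
    simp only [Hmap_comp_apply]
  rw [e x, e y]
  simp only [h]

/-- The homology of a disjoint union decomposes as a direct sum. -/
lemma orbProj_bijective (K : ι → Subgroup G) (n : ℕ) : Function.Bijective
    (LinearMap.pi fun o => Hmap (orbProj K o) n : groupHomology (C K) n →ₗ[ZMod 2]
      ∀ o, HC (K o) n) := by
  refine ⟨fun x y h => Hmap_orbProj_injective K n fun o => congrFun h o, fun y => ?_⟩
  refine ⟨∑ o, Hmap (incl K o) n (y o), funext fun o => ?_⟩
  rw [LinearMap.pi_apply, map_sum, Finset.sum_eq_single o]
  · rw [← Hmap_comp_apply, incl_orbProj, Hmap_id_apply]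
  · intro o' _ h
    rw [← Hmap_comp_apply, incl_orbProj_ne K h, Hmap_zero, LinearMap.zero_apply]
  · simp

lemma HasDim.pi {V : ι → Type} [∀ o, AddCommGroup (V o)] [∀ o, Module (ZMod 2) (V o)] {d : ι → ℕ}
    (h : ∀ o, HasDim (V o) (d o)) : HasDim (∀ o, V o) (∑ o, d o) := by
  have := fun o => (h o).1
  refine ⟨inferInstance, ?_⟩
  rw [Module.finrank_pi_fintype]
  exact Finset.sum_congr rfl fun o _ => (h o).2

lemma hasDim_orb (K : ι → Subgroup G) (n : ℕ) {d : ι → ℕ} (h : ∀ o, HasDim (HC (K o) n) (d o)) :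
    HasDim (groupHomology (C K) n) (∑ o, d o) := by
  let e := LinearEquiv.ofBijective _ (orbProj_bijective K n)
  exact (HasDim.pi h).congr e.symm.toLinearMap e.symm.bijective

/-- The coordinates of a chain in terms of orbits. -/
noncomputable def orbCoord (K : ι → Subgroup G) : (Orb K →₀ ZMod 2) →ₗ[ZMod 2] (ι → ZMod 2) :=
  Finsupp.linearCombination (ZMod 2) fun s => Pi.single s.1 1

lemma orbCoord_single (K : ι → Subgroup G) (s : Orb K) (r : ZMod 2) :
    orbCoord K (Finsupp.single s r) = Pi.single s.1 r := by
  rw [orbCoord, Finsupp.linearCombination_single, ← Pi.single_smul, smul_eq_mul, mul_one]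

lemma orbCoord_smul (K : ι → Subgroup G) (g : G) (a : Orb K →₀ ZMod 2) :
    orbCoord K (permRepresentation (ZMod 2) G (Orb K) g a) = orbCoord K a := by
  induction a using Finsupp.induction_linear with
  | zero => simp
  | add a b ha hb => simp only [map_add, ha, hb]
  | single x r => rw [permRepresentation_single, orbCoord_single, orbCoord_single]; rfl

/-- The coordinates in degree zero homology. -/
noncomputable def h0coord (K : ι → Subgroup G) :
    groupHomology (C K) 0 →ₗ[ZMod 2] (ι → ZMod 2) :=
  (exists_h0lift (C K) (orbCoord K) (orbCoord_smul K)).choose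

lemma h0coord_mk (K : ι → Subgroup G) (a : Orb K →₀ ZMod 2) :
    h0coord K (h0mk (C K) a) = orbCoord K a :=
  (exists_h0lift (C K) (orbCoord K) (orbCoord_smul K)).choose_spec a

lemma single_coset_one {K : ι → Subgroup G} (s : Orb K) (r : ZMod 2) :
    ∃ g : G, Finsupp.single s r = permRepresentation (ZMod 2) G (Orb K) g
      (Finsupp.single ⟨s.1, ((1 : G) : G ⧸ K s.1)⟩ r) := by
  obtain ⟨o, x⟩ := s
  induction x using QuotientGroup.induction_on with
  | H x =>
    refine ⟨x, ?_⟩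
    rw [permRepresentation_single, Sigma.smul_mk]
    congr 2
    change (x : G ⧸ K o) = ((x * 1 : G) : G ⧸ K o)
    rw [mul_one]

lemma h0mk_eq_sum (K : ι → Subgroup G) (a : Orb K →₀ ZMod 2) :
    h0mk (C K) a = ∑ o, h0mk (C K) (Finsupp.single ⟨o, ((1 : G) : G ⧸ K o)⟩ (orbCoord K a o)) := by
  let f : ι → (ZMod 2 →ₗ[ZMod 2] groupHomology (C K) 0) := fun o =>
    h0mk (C K) ∘ₗ Finsupp.lsingle (⟨o, ((1 : G) : G ⧸ K o)⟩ : Orb K)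
  have key : h0mk (C K) = (∑ o, f o ∘ₗ LinearMap.proj o) ∘ₗ orbCoord K := by
    refine Finsupp.lhom_ext fun s r => ?_
    rw [LinearMap.comp_apply, orbCoord_single, LinearMap.sum_apply, Finset.sum_eq_single s.1]
    · obtain ⟨g, hg⟩ := single_coset_one s r
      rw [hg, LinearMap.comp_apply, LinearMap.proj_apply, Pi.single_eq_same]
      exact h0mk_smul (A := C K) g _
    · intro o _ ho
      rw [LinearMap.comp_apply, LinearMap.proj_apply, Pi.single_eq_of_ne ho, map_zero]
    · simp
  refine (LinearMap.congr_fun key a).trans ?_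
  rw [LinearMap.comp_apply, LinearMap.sum_apply]
  rfl

lemma h0coord_bijective (K : ι → Subgroup G) : Function.Bijective (h0coord K) := by
  constructor
  · rw [injective_iff_map_eq_zero]
    intro x hx
    obtain ⟨a, rfl⟩ := h0mk_surjective _ x
    rw [h0mk_eq_sum]
    rw [h0coord_mk] at hx
    refine Finset.sum_eq_zero fun o _ => ?_
    rw [hx, Pi.zero_apply, Finsupp.single_zero]
    exact map_zero (h0mk (C K))
  · intro c
    refine ⟨h0mk (C K) (∑ o, Finsupp.single ⟨o, ((1 : G) : G ⧸ K o)⟩ (c o)), ?_⟩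
    rw [h0coord_mk, map_sum]
    simp only [orbCoord_single]
    exact Finset.univ_sum_single c

lemma h0coord_map {κ : Type} [Fintype κ] [DecidableEq κ] {K : ι → Subgroup G}
    {H : κ → Subgroup G} (f : C K ⟶ C H) {N : ι → κ → ZMod 2}
    (hN : ∀ o, orbCoord H (f.hom (Finsupp.single ⟨o, ((1 : G) : G ⧸ K o)⟩ 1)) = N o)
    (x : groupHomology (C K) 0) :
    h0coord H (Hmap f 0 x) = ∑ o, h0coord K x o • N o := by
  obtain ⟨a, rfl⟩ := h0mk_surjective _ x
  rw [h0mk_eq_sum, map_sum, map_sum, ← h0mk_eq_sum, h0coord_mk]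
  refine Finset.sum_congr rfl fun o _ => ?_
  rw [h0mk_map, h0coord_mk, ← hN, ← map_smul]
  have : (Finsupp.single (⟨o, ((1 : G) : G ⧸ K o)⟩ : Orb K) (orbCoord K a o)) = orbCoord K a o •
      (Finsupp.single (⟨o, ((1 : G) : G ⧸ K o)⟩ : Orb K) (1 : ZMod 2)) := by simp
  rw [this]
  exact congrArg (orbCoord H) (map_smul f.hom _ _)

open scoped Classical in
lemma h0coord_eq_ite {K : ι → Subgroup G} (o : ι) (x : groupHomology (C K) 0) :
    h0coord K x o = if Hmap (orbProj K o) 0 x = 0 then 0 else 1 := by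
  obtain ⟨ε, hε⟩ := exists_h0aug (G := G) (ZMod 2) (G ⧸ K o)
  have key : h0coord K x o = ε (Hmap (orbProj K o) 0 x) := by
    obtain ⟨a, rfl⟩ := h0mk_surjective _ x
    rw [h0mk_map, h0coord_mk]
    have : LinearMap.proj o ∘ₗ orbCoord K =
        ε.toLinearMap ∘ₗ h0mk _ ∘ₗ (orbProj K o).hom.toLinearMap := by
      refine Finsupp.lhom_ext' fun s => LinearMap.ext_ring ?_
      change orbCoord K (Finsupp.single s 1) o = ε (h0mk _ ((orbProj K o).hom (Finsupp.single s 1)))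
      rw [orbCoord_single]
      obtain ⟨o', x⟩ := s
      by_cases h : o' = o
      · subst h
        rw [orbProj_single_same, hε, Pi.single_eq_same]
      · rw [orbProj_single_ne K h, map_zero, map_zero, Pi.single_eq_of_ne (Ne.symm h)]
    exact LinearMap.congr_fun this a
  rw [key]
  split_ifs with h
  · rw [h, map_zero]
  · have : ε (Hmap (orbProj K o) 0 x) ≠ 0 := fun h' => h (ε.map_eq_zero_iff.1 h')
    revert this
    generalize ε (Hmap (orbProj K o) 0 x) = t
    revert t; decide

/-- Iterated cap products. -/
noncomputable def capIter (w : ℕ → (G →* Multiplicative (ZMod 2))) (A : Rep.{0} (ZMod 2) G) :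
    (n : ℕ) → groupHomology A n →ₗ[ZMod 2] groupHomology A 0
  | 0 => LinearMap.id
  | n + 1 => capIter w A n ∘ₗ cap (w n) A n

lemma capIter_naturality (w : ℕ → (G →* Multiplicative (ZMod 2))) {A B : Rep.{0} (ZMod 2) G}
    (f : A ⟶ B) : ∀ (n : ℕ) (x : groupHomology A n),
      capIter w B n (Hmap f n x) = Hmap f 0 (capIter w A n x)
  | 0, _ => rfl
  | n + 1, x => by
    rw [capIter, LinearMap.comp_apply, cap_naturality, capIter_naturality w f n]; rfl

lemma capIter_involution (w : ℕ → (G →* Multiplicative (ZMod 2))) {K : Subgroup G} {σ : G}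
    (hK : ∀ g ∈ K, g = 1 ∨ g = σ) (hσ : σ ∈ K) : ∀ (n : ℕ) (x : HC K n),
      capIter w (permRep (ZMod 2) G (G ⧸ K)) n x = 0 ↔
        ¬ ((∀ j < n, w j σ = Multiplicative.ofAdd 1) ∧ x ≠ 0)
  | 0, x => by simp [capIter]
  | n + 1, x => by
    rw [capIter, LinearMap.comp_apply, capIter_involution w hK hσ n]
    by_cases h : w n σ = Multiplicative.ofAdd 1
    · have hb := cap_bijective_of_involution hK hσ h n
      have e : cap (w n) (permRep (ZMod 2) G (G ⧸ K)) n x = 0 ↔ x = 0 :=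
        ⟨fun h => (injective_iff_map_eq_zero _).1 hb.1 _ h, fun h => by rw [h, map_zero]⟩
      rw [ne_eq, e, Nat.forall_lt_succ_right]
      simp [h]
    · have h1 : w n σ = 1 := by
        revert h
        generalize w n σ = t
        change t ≠ _ → _
        revert t; decide
      rw [cap_eq_zero (w n) K (fun g hg => by
        rcases hK g hg with rfl | rfl
        · exact map_one _
        · exact h1)]
      rw [Nat.forall_lt_succ_right]
      simp [h]

end Sums

end BianchiHomology

namespace BianchiHomology

set_option linter.unusedSectionVars false

section LinearAlgebra

/-- The end points of the orbit representatives of edges. -/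
def edgeEnds : Fin 19 → Fin 8 × Fin 8 :=
  ![(0, 1), (0, 3), (0, 4), (1, 7), (1, 5), (2, 3), (2, 6), (3, 7), (3, 7), (3, 5), (4, 5), (4, 7),
    (6, 7), (0, 4), (0, 2), (1, 5), (1, 6), (2, 5), (4, 6)]

/-- The incidence matrix between orbits of edges and orbits of vertices. -/
def edgeMatrix (o : Fin 19) (i : Fin 8) : ZMod 2 :=
  (if i = (edgeEnds o).1 then 1 else 0) + (if i = (edgeEnds o).2 then 1 else 0)

/-- The values of the two characters on the stabiliser of an edge. -/
def edgeValue : Fin 19 → ZMod 2 × ZMod 2 :=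
  ![0, 0, 0, 0, 0, 0, (0, 1), 0, 0, 0, 0, 0, 0, (1, 0), (1, 0), (1, 1), (1, 1), (1, 1), (1, 0)]

/-- The edges occurring an odd number of times in the boundary of a two-cell. -/
def cellEdges : Fin 11 → List (Fin 19) :=
  ![[0, 1, 3, 7], [0, 4, 10, 13], [0, 1, 3, 8], [1, 5, 14], [0, 2, 10, 15], [3, 12, 16], [],
    [5, 9, 17], [7, 9, 10, 11], [8, 9, 10, 11], [11, 12, 18]]

/-- The incidence matrix between orbits of two-cells and orbits of edges. -/
def cellMatrix (t : Fin 11) (o : Fin 19) : ZMod 2 := if o ∈ cellEdges t then 1 else 0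

/-- The standard pairing. -/
def pairing (u v : ZMod 2 × ZMod 2) : ZMod 2 := u.1 * v.1 + u.2 * v.2

lemma sum_mul_eq (b : Fin 19 → ZMod 2) (S : Finset (Fin 19)) (c : Fin 19 → ZMod 2)
    (hc : ∀ o, c o = if o ∈ S then 1 else 0) : ∑ o, b o * c o = ∑ o ∈ S, b o := by
  simp only [hc, mul_ite, mul_one, mul_zero]
  rw [Finset.sum_ite_mem, Finset.univ_inter]

/-- The combined coefficient of an edge. -/
def wordCoeff (u u' : ZMod 2 × ZMod 2) (i : Fin 8) (o : Fin 19) : ZMod 2 :=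
  if pairing u (edgeValue o) = 1 ∧ pairing u' (edgeValue o) = 1 then edgeMatrix o i else 0

lemma eq_zero_of_wordCoeff {b : Fin 19 → ZMod 2}
    (h : ∀ u u' i, ∑ o, b o * wordCoeff u u' i o = 0) (o : Fin 19) (ho : edgeValue o ≠ 0) :
    b o = 0 := by
  have e (u u' i) (S : Finset (Fin 19)) (hS : ∀ o, wordCoeff u u' i o = if o ∈ S then 1 else 0) :
      ∑ o ∈ S, b o = 0 := by rw [← sum_mul_eq b S _ hS, h]
  have e14 := e (1, 0) (1, 1) 2 {14} (by decide)
  have e18 := e (1, 0) (1, 1) 6 {18} (by decide)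
  have e13 := e (1, 0) (1, 1) 0 {13, 14} (by decide)
  have e6 := e (0, 1) (1, 1) 2 {6} (by decide)
  have e17 := e (1, 0) (0, 1) 2 {17} (by decide)
  have e16 := e (1, 0) (0, 1) 6 {16} (by decide)
  have e15 := e (1, 0) (0, 1) 1 {15, 16} (by decide)
  rw [Finset.sum_singleton] at e14 e18 e6 e17 e16
  rw [Finset.sum_pair (by decide), e14, add_zero] at e13
  rw [Finset.sum_pair (by decide), e16, add_zero] at e15
  have hmem : o ∈ ({6, 13, 14, 15, 16, 17, 18} : Finset (Fin 19)) := by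
    revert o; decide
  simp only [Finset.mem_insert, Finset.mem_singleton] at hmem
  rcases hmem with rfl | rfl | rfl | rfl | rfl | rfl | rfl <;> assumption

lemma eq_of_wordCoeff {b : Fin 19 → ZMod 2}
    (h : ∀ u i, ∑ o, b o * wordCoeff u u i o = 0) (o : Fin 19) (ho : edgeValue o ≠ 0) :
    b o = b 15 := by
  have e (u i) (S : Finset (Fin 19)) (hS : ∀ o, wordCoeff u u i o = if o ∈ S then 1 else 0) :
      ∑ o ∈ S, b o = 0 := by rw [← sum_mul_eq b S _ hS, h]
  have two : ∀ a c : ZMod 2, a + c = 0 → a = c := by decide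
  have p (u i) (a c : Fin 19) (hac : a ≠ c)
      (hS : ∀ o, wordCoeff u u i o = if o ∈ ({a, c} : Finset (Fin 19)) then 1 else 0) :
      b a = b c := by
    have := e u i {a, c} hS
    rw [Finset.sum_pair hac] at this
    exact two _ _ this
  have e1 := p (1, 0) 0 13 14 (by decide) (by decide)
  have e2 := p (1, 0) 4 13 18 (by decide) (by decide)
  have e3 := p (1, 0) 6 18 16 (by decide) (by decide)
  have e4 := p (1, 0) 1 16 15 (by decide) (by decide)
  have e5 := p (1, 0) 5 17 15 (by decide) (by decide)
  have e6 := p (0, 1) 6 6 16 (by decide) (by decide)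
  have hmem : o ∈ ({6, 13, 14, 15, 16, 17, 18} : Finset (Fin 19)) := by
    revert o; decide
  simp only [Finset.mem_insert, Finset.mem_singleton] at hmem
  rcases hmem with rfl | rfl | rfl | rfl | rfl | rfl | rfl
  · rw [e6, e4]
  · rw [e2, e3, e4]
  · rw [← e1, e2, e3, e4]
  · rfl
  · exact e4
  · exact e5
  · rw [e3, e4]

lemma cellMatrix_kernel {c : Fin 11 → ZMod 2} (h : ∑ t, c t • cellMatrix t = 0) :
    c 6 = 0 → c 9 = 0 → c = 0 := by
  intro h6 h9
  have e (o) (S : Finset (Fin 11)) (hS : ∀ t, cellMatrix t o = if t ∈ S then 1 else 0) :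
      ∑ t ∈ S, c t = 0 := by
    have := congrFun h o
    simp only [Finset.sum_apply, Pi.smul_apply, smul_eq_mul, hS, mul_ite, mul_one, mul_zero,
      Pi.zero_apply] at this
    rwa [Finset.sum_ite_mem, Finset.univ_inter] at this
  have f8 := e 8 {2, 9} (by decide)
  have f7 := e 7 {0, 8} (by decide)
  have f9 := e 9 {7, 8, 9} (by decide)
  have f4 := e 4 {1} (by decide)
  have f14 := e 14 {3} (by decide)
  have f15 := e 15 {4} (by decide)
  have f16 := e 16 {5} (by decide)
  have f17 := e 17 {7} (by decide)
  have f18 := e 18 {10} (by decide)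
  rw [Finset.sum_singleton] at f4 f14 f15 f16 f17 f18
  rw [Finset.sum_pair (by decide), h9, add_zero] at f8
  rw [Finset.sum_insert (by decide), Finset.sum_pair (by decide), f17, h9, zero_add, add_zero] at f9
  rw [Finset.sum_pair (by decide), f9, add_zero] at f7
  funext t
  fin_cases t <;> assumption

lemma finrank_cellMatrix_ker (f : (Fin 11 → ZMod 2) →ₗ[ZMod 2] (Fin 19 → ZMod 2))
    (hf : ∀ c, f c = ∑ t, c t • cellMatrix t) : Module.finrank (ZMod 2) (LinearMap.ker f) = 2 := by
  let g : LinearMap.ker f →ₗ[ZMod 2] ZMod 2 × ZMod 2 :=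
    ((LinearMap.proj 6).prod (LinearMap.proj 9)) ∘ₗ (LinearMap.ker f).subtype
  have hg : Function.Bijective g := by
    constructor
    · rw [injective_iff_map_eq_zero]
      rintro ⟨c, hc⟩ h
      obtain ⟨h6, h9⟩ := Prod.mk.inj h
      rw [LinearMap.mem_ker, hf] at hc
      exact Subtype.ext (cellMatrix_kernel hc h6 h9)
    · rintro ⟨a, b⟩
      have hk : ∀ a b : ZMod 2, ∑ t, (![b, 0, b, 0, 0, 0, a, 0, b, b, 0] : Fin 11 → ZMod 2) t •
          cellMatrix t = 0 := by decide
      exact ⟨⟨![b, 0, b, 0, 0, 0, a, 0, b, b, 0], by rw [LinearMap.mem_ker, hf]; exact hk a b⟩, rfl⟩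
  rw [(LinearEquiv.ofBijective g hg).finrank_eq]
  simp

end LinearAlgebra

end BianchiHomology

namespace BianchiHomology

set_option linter.unusedSectionVars false
section Syzygy
variable {G : Type} [Group G]

/-- The trivial representation. -/
abbrev triv (G : Type) [Group G] : Rep.{0} (ZMod 2) G :=
  Rep.of (Representation.trivial (ZMod 2) G (ZMod 2))

/-- The augmentation of a permutation representation. -/
noncomputable def augm (X : Type) [MulAction G X] : permRep (ZMod 2) G X ⟶ triv G :=
  permHom _ (fun _ => (1 : ZMod 2)) fun _ _ => rfl

lemma augm_single (X : Type) [MulAction G X] (x : X) (r : ZMod 2) :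
    (augm (G := G) X).hom (Finsupp.single x r) = r := by
  exact (permHom_single _ _ _ x r).trans (mul_one r)

/-- The kernel of a morphism as a representation. -/
def kerRepresentation {A B : Rep.{0} (ZMod 2) G} (f : A ⟶ B) :
    Representation (ZMod 2) G (LinearMap.ker f.hom.toLinearMap) where
  toFun g := (A.ρ g).restrict fun a ha => by
    have ha : f.hom a = 0 := ha
    change f.hom (A.ρ g a) = 0
    rw [hom_equivariant, ha, map_zero]
  map_one' := LinearMap.ext fun a => Subtype.ext (LinearMap.congr_fun (map_one A.ρ) a.1)
  map_mul' g h := LinearMap.ext fun a => Subtype.ext (LinearMap.congr_fun (map_mul A.ρ g h) a.1)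

lemma exists_syzygy {A₂ A₁ A₀ B : Rep.{0} (ZMod 2) G} (d₂ : A₂ ⟶ A₁) (d₁ : A₁ ⟶ A₀) (ε : A₀ ⟶ B)
    (h₂ : Function.Injective d₂.hom) (h₁ : Function.Exact d₂.hom d₁.hom)
    (h₀ : Function.Exact d₁.hom ε.hom) (hε : Function.Surjective ε.hom) :
    ∃ (Z : Rep.{0} (ZMod 2) G) (p : A₁ ⟶ Z) (i : Z ⟶ A₀) (w₁ : d₂ ≫ p = 0) (w₂ : i ≫ ε = 0),
      p ≫ i = d₁ ∧ (ShortComplex.mk d₂ p w₁).ShortExact ∧ (ShortComplex.mk i ε w₂).ShortExact := by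
  let Z := Rep.of (kerRepresentation ε)
  let i : Z ⟶ A₀ := mkHom (σ := A₀.ρ) (LinearMap.ker ε.hom.toLinearMap).subtype fun _ _ => rfl
  let p : A₁ ⟶ Z := mkHom (ρ := A₁.ρ) (d₁.hom.toLinearMap.codRestrict
    (LinearMap.ker ε.hom.toLinearMap) fun a => (h₀ _).2 ⟨a, rfl⟩) fun g a =>
      Subtype.ext (hom_equivariant d₁ g a)
  have hp : ∀ a, (p.hom a).1 = d₁.hom a := fun _ => rfl
  refine ⟨Z, p, i, rep_hom_ext fun a => ?_, rep_hom_ext fun a => a.2, rfl, ?_, ?_⟩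
  · exact Subtype.ext ((h₁ _).2 ⟨a, rfl⟩)
  · refine shortExact_mk _ _ _ h₂ (fun a => ?_) fun z => ?_
    · rw [← h₁ a, ← hp]
      exact Subtype.ext_iff
    · obtain ⟨a, ha⟩ := (h₀ z.1).1 z.2
      exact ⟨a, Subtype.ext ha⟩
  · refine shortExact_mk _ _ _ Subtype.val_injective (fun a => ?_) hε
    exact ⟨fun h => ⟨⟨a, h⟩, rfl⟩, by rintro ⟨z, rfl⟩; exact z.2⟩

end Syzygy

section Counting
variable {U V W : Type} [AddCommGroup U] [Module (ZMod 2) U] [AddCommGroup V] [Module (ZMod 2) V]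
  [AddCommGroup W] [Module (ZMod 2) W]

/-- The rank of a linear map over the field with two elements. -/
noncomputable def rk (f : U →ₗ[ZMod 2] V) : ℕ := Module.finrank (ZMod 2) (LinearMap.range f)

lemma exact_count {f : U →ₗ[ZMod 2] V} {g : V →ₗ[ZMod 2] W} (h : Function.Exact f g)
    [Module.Finite (ZMod 2) U] [Module.Finite (ZMod 2) W] : HasDim V (rk f + rk g) := by
  have h1 : HasDim (LinearMap.range f) (rk f) := ⟨inferInstance, rfl⟩
  have h2 : HasDim (LinearMap.range g) (rk g) := ⟨inferInstance, rfl⟩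
  refine h1.extension h2 (LinearMap.range f).subtype g.rangeRestrict
    (Submodule.injective_subtype _) (fun v => ?_) g.surjective_rangeRestrict
  constructor
  · intro hv
    obtain ⟨u, hu⟩ := (h v).1 (congrArg Subtype.val hv)
    exact ⟨⟨v, u, hu⟩, rfl⟩
  · rintro ⟨⟨_, u, rfl⟩, rfl⟩
    exact Subtype.ext ((h _).2 ⟨u, rfl⟩)

lemma rk_of_injective {f : U →ₗ[ZMod 2] V} (h : Function.Injective f) :
    rk f = Module.finrank (ZMod 2) U := LinearMap.finrank_range_of_inj h

lemma rk_of_surjective {f : U →ₗ[ZMod 2] V} (h : Function.Surjective f) :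
    rk f = Module.finrank (ZMod 2) V := by rw [rk, LinearMap.range_eq_top.2 h, finrank_top]

lemma rk_add_ker [Module.Finite (ZMod 2) U] (f : U →ₗ[ZMod 2] V) :
    rk f + Module.finrank (ZMod 2) (LinearMap.ker f) = Module.finrank (ZMod 2) U :=
  LinearMap.finrank_range_add_finrank_ker f

lemma rk_eq_zero_of_injective {f : U →ₗ[ZMod 2] V} {g : V →ₗ[ZMod 2] W} (h : Function.Exact f g)
    (hg : Function.Injective g) : rk f = 0 := by
  have : f = 0 := LinearMap.ext fun u => hg (by rw [(h _).2 ⟨u, rfl⟩, LinearMap.zero_apply, map_zero])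
  rw [rk, this, LinearMap.range_zero]; exact finrank_bot _ _

lemma rk_comp_le [Module.Finite (ZMod 2) V] (f : U →ₗ[ZMod 2] V) (g : V →ₗ[ZMod 2] W) :
    rk (g ∘ₗ f) ≤ rk g :=
  Submodule.finrank_mono (LinearMap.range_comp_le_range f g)

lemma rk_add_le [Module.Finite (ZMod 2) V] (f : U →ₗ[ZMod 2] V) (g : V →ₗ[ZMod 2] W)
    (h : g ∘ₗ f = 0) : rk f + rk g ≤ Module.finrank (ZMod 2) V := by
  have := rk_add_ker g
  have h2 : rk f ≤ Module.finrank (ZMod 2) (LinearMap.ker g) :=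
    Submodule.finrank_mono (LinearMap.range_le_ker_iff.2 h)
  omega

end Counting

end BianchiHomology

namespace BianchiHomology

set_option linter.unusedSectionVars false

/-- An exact equivariant complex with the orbit data of the two-dimensional retract. -/
structure CellData (G : Type) [Group G] where
  /-- The first character. -/
  χ₁ : G →* Multiplicative (ZMod 2)
  /-- The second character. -/
  χ₂ : G →* Multiplicative (ZMod 2)
  /-- Vertex stabilisers. -/
  H : Fin 8 → Subgroup G
  /-- Edge stabilisers. -/
  K : Fin 19 → Subgroup G
  /-- Cell stabilisers. -/
  J : Fin 11 → Subgroup G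
  hJ : ∀ t, J t = ⊥
  /-- The second differential. -/
  d₂ : C J ⟶ C K
  /-- The first differential. -/
  d₁ : C K ⟶ C H
  inj : Function.Injective d₂.hom
  exact₁ : Function.Exact d₂.hom d₁.hom
  exact₀ : Function.Exact d₁.hom (augm (G := G) (Orb H)).hom
  hN₁ : ∀ o, orbCoord H (d₁.hom (Finsupp.single ⟨o, ((1 : G) : G ⧸ K o)⟩ 1)) = edgeMatrix o
  hN₂ : ∀ t, orbCoord K (d₂.hom (Finsupp.single ⟨t, ((1 : G) : G ⧸ J t)⟩ 1)) = cellMatrix t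
  hE : ∀ o, (edgeValue o = 0 ∧ ∀ n, Subsingleton (HC (K o) (n + 1))) ∨
    (edgeValue o ≠ 0 ∧ ∃ σ ∈ K o, (∀ g ∈ K o, g = 1 ∨ g = σ) ∧
      χ₁ σ = Multiplicative.ofAdd (edgeValue o).1 ∧ χ₂ σ = Multiplicative.ofAdd (edgeValue o).2)
  hV : ∀ n i, HasDim (HC (H i) (n + 1)) ((![1, 1, n + 2, 0, 1, 1, n + 2, 0] : Fin 8 → ℕ) i)
  hσ₀ : ∃ σ ∈ H 0, σ * σ = 1 ∧ χ₁ σ = Multiplicative.ofAdd 1 ∧ χ₂ σ = 1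
  hσ₁ : ∃ σ ∈ H 1, σ * σ = 1 ∧ χ₂ σ = Multiplicative.ofAdd 1

namespace CellData
variable {G : Type} [Group G] (D : CellData G)

/-- Products of the two characters. -/
def chr (u : ZMod 2 × ZMod 2) : G →* Multiplicative (ZMod 2) :=
  D.χ₁ ^ u.1.val * D.χ₂ ^ u.2.val

lemma chr_apply (u v : ZMod 2 × ZMod 2) {σ : G} (h₁ : D.χ₁ σ = Multiplicative.ofAdd v.1)
    (h₂ : D.χ₂ σ = Multiplicative.ofAdd v.2) :
    D.chr u σ = Multiplicative.ofAdd (pairing u v) := by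
  rw [chr, MonoidHom.mul_apply, MonoidHom.pow_apply, MonoidHom.pow_apply, h₁, h₂]
  have : ∀ u v : ZMod 2 × ZMod 2, Multiplicative.ofAdd v.1 ^ u.1.val *
    Multiplicative.ofAdd v.2 ^ u.2.val = Multiplicative.ofAdd (pairing u v) := by decide
  exact this u v

open Classical in
/-- The support of a homology class of the edges. -/
noncomputable def supp {n : ℕ} (x : groupHomology (C D.K) n) (o : Fin 19) : ZMod 2 :=
  if Hmap (orbProj D.K o) n x = 0 then 0 else 1

lemma supp_eq_zero {n : ℕ} {x : groupHomology (C D.K) n} {o : Fin 19} :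
    D.supp x o = 0 ↔ Hmap (orbProj D.K o) n x = 0 := by
  rw [supp]; split_ifs with h <;> simp [h]

lemma eq_zero_of_supp {n : ℕ} {x : groupHomology (C D.K) (n + 1)}
    (h : ∀ o, edgeValue o ≠ 0 → D.supp x o = 0) : x = 0 := by
  refine Hmap_orbProj_injective D.K _ fun o => ?_
  rw [map_zero]
  rcases D.hE o with ⟨_, hs⟩ | ⟨ho, _⟩
  · exact (hs n).elim _ _
  · exact D.supp_eq_zero.1 (h o ho)

lemma sum_wordCoeff {n : ℕ} {x : groupHomology (C D.K) (n + 1)} (hx : Hmap D.d₁ (n + 1) x = 0)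
    (u u' : ZMod 2 × ZMod 2) (h : n = 0 → u = u') (i : Fin 8) :
    ∑ o, D.supp x o * wordCoeff u u' i o = 0 := by
  let w : ℕ → (G →* Multiplicative (ZMod 2)) := fun j => D.chr (if j = 0 then u else u')
  have h1 := capIter_naturality w D.d₁ (n + 1) x
  rw [hx, map_zero] at h1
  have h2 := h0coord_map D.d₁ D.hN₁ (capIter w (C D.K) (n + 1) x)
  rw [← h1, map_zero] at h2
  have h3 := congrFun h2 i
  rw [Finset.sum_apply] at h3
  refine Eq.trans (Finset.sum_congr rfl fun o _ => ?_) h3.symm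
  rw [Pi.smul_apply, smul_eq_mul, h0coord_eq_ite, ← capIter_naturality]
  rcases D.hE o with ⟨ho, hs⟩ | ⟨ho, σ, hσ, hK, h₁, h₂⟩
  · have e : Hmap (orbProj D.K o) (n + 1) x = 0 := (hs n).elim _ _
    rw [D.supp_eq_zero.2 e, e, map_zero, if_pos rfl, zero_mul, zero_mul]
  · have hw : ∀ j, w j σ = Multiplicative.ofAdd 1 ↔
        pairing (if j = 0 then u else u') (edgeValue o) = 1 := fun j => by
      rw [D.chr_apply _ _ h₁ h₂]; exact Multiplicative.ofAdd.injective.eq_iff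
    have hall : (∀ j < n + 1, w j σ = Multiplicative.ofAdd 1) ↔
        (pairing u (edgeValue o) = 1 ∧ pairing u' (edgeValue o) = 1) := by
      constructor
      · intro hj
        have e0 := (hw 0).1 (hj 0 (Nat.succ_pos n))
        rw [if_pos rfl] at e0
        refine ⟨e0, ?_⟩
        rcases n with _ | n
        · rwa [← h rfl]
        · have e1 := (hw 1).1 (hj 1 (by omega))
          rwa [if_neg one_ne_zero] at e1
      · rintro ⟨e0, e1⟩ j _
        rw [hw]; split_ifs
        exacts [e0, e1]
    rw [wordCoeff]
    have key := capIter_involution w hK hσ (n + 1) (Hmap (orbProj D.K o) (n + 1) x)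
    by_cases ha : ∀ j < n + 1, w j σ = Multiplicative.ofAdd 1
    · rw [if_pos (hall.1 ha)]
      by_cases hz : Hmap (orbProj D.K o) (n + 1) x = 0
      · rw [D.supp_eq_zero.2 hz, if_pos (key.2 fun h => h.2 hz)]
      · rw [if_neg fun h => key.1 h ⟨ha, hz⟩, supp, if_neg hz]
    · rw [if_neg fun h => ha (hall.2 h), if_pos (key.2 fun h => ha h.1), zero_mul, mul_zero]

lemma injective_of_two_le (n : ℕ) : Function.Injective (Hmap D.d₁ (n + 2)) := by
  rw [injective_iff_map_eq_zero]
  intro x hx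
  exact D.eq_zero_of_supp fun o ho => eq_zero_of_wordCoeff
    (fun u u' i => D.sum_wordCoeff (n := n + 1) hx u u' (fun h => absurd h (by omega)) i) o ho

lemma hasDim_edges (n : ℕ) : HasDim (groupHomology (C D.K) (n + 1)) 7 := by
  have h : ∀ o, HasDim (HC (D.K o) (n + 1)) (if edgeValue o = 0 then 0 else 1) := by
    intro o
    rcases D.hE o with ⟨ho, hs⟩ | ⟨ho, σ, hσ, hK, h₁, h₂⟩
    · rw [if_pos ho]
      have := hs n
      exact HasDim.of_subsingleton
    · rw [if_neg ho]
      have : ∀ v : ZMod 2 × ZMod 2, v ≠ 0 → ∃ u, pairing u v = 1 := by decide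
      obtain ⟨u, hu⟩ := this _ ho
      exact hasDim_involution hK hσ ((D.chr_apply u _ h₁ h₂).trans (congrArg _ hu)) _
  have hs : ∑ o, (if edgeValue o = 0 then 0 else 1) = 7 := by decide
  have := hasDim_orb D.K (n + 1) h
  rwa [hs] at this

lemma finrank_ker_one :
    Module.finrank (ZMod 2) (LinearMap.ker (Hmap D.d₁ 1)) ≤ 1 := by
  let f : LinearMap.ker (Hmap D.d₁ 1) →ₗ[ZMod 2] HC (D.K 15) 1 :=
    Hmap (orbProj D.K 15) 1 ∘ₗ (LinearMap.ker (Hmap D.d₁ 1)).subtype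
  have hf : Function.Injective f := by
    rw [injective_iff_map_eq_zero]
    rintro ⟨x, hx⟩ h
    refine Subtype.ext (D.eq_zero_of_supp (n := 0) fun o ho => ?_)
    rw [eq_of_wordCoeff (fun u i => D.sum_wordCoeff (n := 0) hx u u (fun _ => rfl) i) o ho]
    exact D.supp_eq_zero.2 h
  have h15 : HasDim (HC (D.K 15) 1) 1 := by
    rcases D.hE 15 with ⟨ho, hs⟩ | ⟨ho, σ, hσ, hK, h₁, h₂⟩
    · exact absurd ho (by decide)
    · exact hasDim_involution hK hσ h₁ _
  have := h15.1
  exact (LinearMap.finrank_le_finrank_of_injective hf).trans h15.2.le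

lemma hasDim_vertices (n : ℕ) : HasDim (groupHomology (C D.H) (n + 1)) (2 * n + 8) := by
  have := hasDim_orb D.H (n + 1) (D.hV n)
  rw [Fin.sum_univ_eight] at this
  convert this using 1
  change 2 * n + 8 = 1 + 1 + (n + 2) + 0 + 1 + 1 + (n + 2) + 0
  omega

lemma hasDim_zero {ι : Type} [Fintype ι] [DecidableEq ι] (K : ι → Subgroup G) :
    HasDim (groupHomology (C K) 0) (Fintype.card ι) := by
  let e := LinearEquiv.ofBijective _ (h0coord_bijective K)
  exact HasDim.congr (V := ι → ZMod 2) ⟨inferInstance, Module.finrank_fintype_fun_eq_card _⟩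
    e.symm.toLinearMap e.symm.bijective

lemma hasDim_triv : HasDim (groupHomology (triv G) 0) 1 := by
  obtain ⟨ψ, hψ⟩ := exists_h0lift (triv G) (W := ZMod 2) LinearMap.id fun g a => rfl
  refine HasDim.congr (V := ZMod 2) ⟨inferInstance, Module.finrank_self _⟩ (h0mk (triv G))
    ⟨fun a b h => ?_, h0mk_surjective _⟩
  have := congrArg ψ h
  rwa [hψ, hψ] at this

lemma augm_surjective (X : Type) [MulAction G X] [Nonempty X] :
    Function.Surjective (augm (G := G) X).hom :=
  fun r => ⟨Finsupp.single (Classical.arbitrary X) r, augm_single X _ r⟩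

lemma exists_cap {i : Fin 8} {σ : G} (hσ : σ ∈ D.H i) (hσ2 : σ * σ = 1)
    {χ : G →* Multiplicative (ZMod 2)} (hχ : χ σ = Multiplicative.ofAdd 1)
    (z : groupHomology (triv G) 0) :
    ∃ x : groupHomology (C D.H) 1, cap χ _ 0 (Hmap (augm (Orb D.H)) 1 x) = z ∧
      ∀ χ' : G →* Multiplicative (ZMod 2), χ' σ = 1 →
        cap χ' _ 0 (Hmap (augm (Orb D.H)) 1 x) = 0 := by
  let S := Subgroup.zpowers σ
  have hz := mem_zpowers_involution hσ2
  have hle : S ≤ D.H i := by rwa [Subgroup.zpowers_le]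
  let f : permRep (ZMod 2) G (G ⧸ S) ⟶ C D.H := cosetMap hle ≫ incl D.H i
  have h1 : Function.Surjective (f ≫ augm (G := G) (Orb D.H)).hom := by
    intro r
    refine ⟨r • Finsupp.single ((1 : G) : G ⧸ S) 1, ?_⟩
    have e1 : (cosetMap hle).hom (Finsupp.single ((1 : G) : G ⧸ S) (1 : ZMod 2)) =
      Finsupp.single ((1 : G) : G ⧸ D.H i) 1 := permMap_single _ _ _ _ _
    have e2 : f.hom (Finsupp.single ((1 : G) : G ⧸ S) (1 : ZMod 2)) =
        Finsupp.single ⟨i, ((1 : G) : G ⧸ D.H i)⟩ 1 := by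
      change (incl D.H i).hom ((cosetMap hle).hom _) = _
      rw [e1, incl_single]
    change (augm (G := G) (Orb D.H)).hom (f.hom (r • Finsupp.single ((1 : G) : G ⧸ S) 1)) = r
    have e3 : f.hom (r • Finsupp.single ((1 : G) : G ⧸ S) 1) =
        r • Finsupp.single ⟨i, ((1 : G) : G ⧸ D.H i)⟩ 1 := by
      rw [← e2]; exact map_smul f.hom.toLinearMap r _
    rw [e3, Finsupp.smul_single, smul_eq_mul, mul_one, augm_single]
  obtain ⟨y₀, hy₀⟩ := Hmap_zero_surjective _ h1 z
  obtain ⟨y, rfl⟩ := (cap_bijective_of_involution hz (Subgroup.mem_zpowers σ) hχ 0).2 y₀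
  refine ⟨Hmap f 1 y, ?_, fun χ' hχ' => ?_⟩
  · rw [← Hmap_comp_apply, cap_naturality, hy₀]
  · rw [← Hmap_comp_apply, cap_naturality, cap_eq_zero χ' S ?_ 0 y, map_zero]
    intro g hg
    rcases hz g hg with rfl | rfl
    exacts [map_one _, hχ']

lemma rank_le {Z : Rep.{0} (ZMod 2) G} (i : Z ⟶ C D.H) (h : i ≫ augm (Orb D.H) = 0) :
    rk (Hmap i 1) ≤ 6 := by
  let ε := Hmap (augm (G := G) (Orb D.H)) 1
  let Φ : groupHomology (C D.H) 1 →ₗ[ZMod 2] groupHomology (triv G) 0 × groupHomology (triv G) 0 :=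
    (cap D.χ₁ _ 0 ∘ₗ ε).prod (cap D.χ₂ _ 0 ∘ₗ ε)
  have hΦ : Function.Surjective Φ := by
    rintro ⟨a, b⟩
    obtain ⟨σ₀, h0, h02, h01, h00⟩ := D.hσ₀
    obtain ⟨σ₁, h1, h12, h11⟩ := D.hσ₁
    obtain ⟨y, hy, _⟩ := D.exists_cap h1 h12 h11 b
    obtain ⟨x, hx, hx'⟩ := D.exists_cap h0 h02 h01 (a - cap D.χ₁ _ 0 (ε y))
    refine ⟨x + y, Prod.ext ?_ ?_⟩
    · change cap D.χ₁ _ 0 (ε (x + y)) = a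
      rw [map_add, map_add, hx, sub_add_cancel]
    · change cap D.χ₂ _ 0 (ε (x + y)) = b
      rw [map_add, map_add, hx' _ h00, hy, zero_add]
  have h8 := D.hasDim_vertices 0
  have := h8.1
  have ht := hasDim_triv (G := G)
  have := ht.1
  have key := rk_add_le (Hmap i 1) Φ (LinearMap.ext fun z => by
    have : ε (Hmap i 1 z) = 0 := by
      rw [← Hmap_comp_apply, h, Hmap_zero]; rfl
    refine Prod.ext ?_ ?_
    · change cap D.χ₁ _ 0 (ε (Hmap i 1 z)) = 0
      rw [this, map_zero]
    · change cap D.χ₂ _ 0 (ε (Hmap i 1 z)) = 0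
      rw [this, map_zero])
  rw [rk_of_surjective hΦ, Module.finrank_prod, ht.2, h8.2] at key
  omega

lemma finrank_ker_zero : Module.finrank (ZMod 2) (LinearMap.ker (Hmap D.d₂ 0)) = 2 := by
  let e₁ := LinearEquiv.ofBijective _ (h0coord_bijective D.J)
  let e₂ := LinearEquiv.ofBijective _ (h0coord_bijective D.K)
  let f := e₂.toLinearMap ∘ₗ Hmap D.d₂ 0 ∘ₗ e₁.symm.toLinearMap
  have hf : ∀ c, f c = ∑ t, c t • cellMatrix t := fun c => by
    have := h0coord_map D.d₂ D.hN₂ (e₁.symm c)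
    refine this.trans (Finset.sum_congr rfl fun t _ => ?_)
    have e : h0coord D.J (e₁.symm c) = c := e₁.apply_symm_apply c
    rw [e]
  refine Eq.trans ?_ (finrank_cellMatrix_ker f hf)
  have hk : LinearMap.ker f = (LinearMap.ker (Hmap D.d₂ 0)).map e₁.toLinearMap := by
    ext c
    rw [Submodule.mem_map_equiv, LinearMap.mem_ker, LinearMap.mem_ker]
    exact e₂.map_eq_zero_iff
  rw [hk]
  exact (e₁.submoduleMap _).finrank_eq

lemma exists_hasDim_syzygy :
    ∃ (Z : Rep.{0} (ZMod 2) G) (i : Z ⟶ C D.H) (w : i ≫ augm (Orb D.H) = 0),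
      (ShortComplex.mk i _ w).ShortExact ∧ HasDim (groupHomology Z 0) 10 ∧
      HasDim (groupHomology Z 1) 9 ∧ (∀ n, HasDim (groupHomology Z (n + 2)) 7) ∧
      6 ≤ rk (Hmap i 1) ∧ ∀ n, Function.Injective (Hmap i (n + 2)) := by
  have : Nonempty (Orb D.H) := ⟨⟨0, ((1 : G) : G ⧸ D.H 0)⟩⟩
  obtain ⟨Z, p, i, w₁, w₂, hpi, s₁, s₂⟩ := exists_syzygy D.d₂ D.d₁ (augm (Orb D.H)) D.inj D.exact₁
    D.exact₀ (augm_surjective _)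
  have hT : ∀ n, Subsingleton (groupHomology (C D.J) (n + 1)) := fun n => by
    constructor
    intro x y
    refine Hmap_orbProj_injective D.J _ fun o => ?_
    exact (subsingleton_of_bot (D.hJ o) n).elim _ _
  have hd₁ : ∀ n, Hmap D.d₁ n = Hmap i n ∘ₗ Hmap p n := fun n => by rw [← hpi, Hmap_comp]
  have pinj : ∀ n, Function.Injective (Hmap p (n + 1)) := fun n => by
    rw [injective_iff_map_eq_zero]
    intro x hx
    obtain ⟨y, rfl⟩ := (exact_two s₁ (n + 1) x).1 hx
    have := (hT n).elim y 0
    rw [this]; exact map_zero _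
  have psurj : ∀ n, Function.Surjective (Hmap p (n + 2)) := fun n x =>
    (exact_three s₁ (n + 1) x).1 ((hT n).elim _ _)
  have iinj : ∀ n, Function.Injective (Hmap i (n + 2)) := fun n => by
    rw [injective_iff_map_eq_zero]
    intro x hx
    obtain ⟨y, rfl⟩ := psurj n x
    have e : Hmap D.d₁ (n + 2) y = 0 := by rw [hd₁]; exact hx
    rw [(injective_iff_map_eq_zero _).1 (D.injective_of_two_le n) y e, map_zero]
  have E0 := hasDim_zero D.K
  have V0 := hasDim_zero D.H
  have T0 := hasDim_zero D.J
  have E1 := D.hasDim_edges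
  have V1 := D.hasDim_vertices
  have t0 := hasDim_triv (G := G)
  rw [Fintype.card_fin] at E0 V0 T0
  have := E0.1
  have := V0.1
  have := T0.1
  have := fun n => (E1 n).1
  have := fun n => (V1 n).1
  have := t0.1
  have Z2 : ∀ n, HasDim (groupHomology Z (n + 2)) 7 := fun n =>
    (E1 (n + 1)).congr (Hmap p (n + 2)) ⟨pinj (n + 1), psurj n⟩
  have := fun n => (Z2 n).1
  have kd₂ := D.finrank_ker_zero
  have rd₂ := rk_add_ker (Hmap D.d₂ 0)
  rw [kd₂, T0.2] at rd₂
  have rconn : rk (conn s₁ 0) = 2 := by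
    refine Eq.trans ?_ kd₂
    rw [rk, ← (exact_one s₁ 0).linearMap_ker_eq]
  have Z1 := exact_count (exact_three s₁ 0)
  rw [show rk (conn s₁ 0) = 2 from rconn,
    show rk (Hmap p 1) = 7 from (rk_of_injective (pinj 0)).trans (E1 0).2] at Z1
  have := Z1.1
  have psurj0 : Function.Surjective (Hmap p 0) :=
    Hmap_zero_surjective p ((Rep.epi_iff_surjective p).1 s₁.epi_g)
  have : Module.Finite (ZMod 2) (groupHomology Z 0) := Module.Finite.of_surjective _ psurj0
  have x₁ : Function.Exact (Hmap D.d₂ 0) (Hmap p 0) := exact_two s₁ 0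
  have Z0 := (exact_count x₁).2
  rw [E0.2, rk_of_surjective psurj0] at Z0
  have hri := rk_comp_le (Hmap p 1) (Hmap i 1)
  rw [← hd₁] at hri
  have hk1 := rk_add_ker (Hmap D.d₁ 1)
  rw [(E1 0).2] at hk1
  have hk2 := D.finrank_ker_one
  refine ⟨Z, i, w₂, s₂, ⟨inferInstance, by omega⟩, ?_, Z2, by omega, iinj⟩
  rwa [Nat.add_comm] at Z1

theorem finrank_homology {G : Type} [Group G] (D : CellData G) :
    Module.finrank (ZMod 2) (groupHomology (triv G) 1) = 5 ∧
    Module.finrank (ZMod 2) (groupHomology (triv G) 2) = 6 ∧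
    ∀ q, Module.finrank (ZMod 2) (groupHomology (triv G) (q + 3)) = 2 * q + 5 := by
  obtain ⟨Z, i, w, s, Z0, Z1, Z2, hi, hinj⟩ := D.exists_hasDim_syzygy
  have V0 := hasDim_zero D.H
  have V1 := D.hasDim_vertices
  have t0 := hasDim_triv (G := G)
  rw [Fintype.card_fin] at V0
  have := V0.1
  have := fun n => (V1 n).1
  have := t0.1
  have := Z0.1
  have := Z1.1
  have := fun n => (Z2 n).1
  have : Nonempty (Orb D.H) := ⟨⟨0, ((1 : G) : G ⧸ D.H 0)⟩⟩
  have hZ : ∀ n, Module.Finite (ZMod 2) (groupHomology Z n)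
    | 0 => Z0.1
    | 1 => Z1.1
    | n + 2 => (Z2 n).1
  have xC : ∀ n, Function.Exact (Hmap i n) (Hmap (augm (G := G) (Orb D.H)) n) :=
    fun n => exact_two s n
  have xT : ∀ n, Function.Exact (Hmap (augm (G := G) (Orb D.H)) (n + 1)) (conn s n) :=
    fun n => exact_three s n
  have xZ : ∀ n, Function.Exact (conn s n) (Hmap i n) := fun n => exact_one s n
  obtain ⟨rε, hrε⟩ : ∃ f : ℕ → ℕ, ∀ n, rk (Hmap (augm (G := G) (Orb D.H)) n) = f n :=
    ⟨fun n => rk (Hmap (augm (G := G) (Orb D.H)) n), fun _ => rfl⟩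
  obtain ⟨rδ, hrδ⟩ : ∃ f : ℕ → ℕ, ∀ n, rk (conn s n) = f n :=
    ⟨fun n => rk (conn s n), fun _ => rfl⟩
  obtain ⟨ri, hri⟩ : ∃ f : ℕ → ℕ, ∀ n, rk (Hmap i n) = f n :=
    ⟨fun n => rk (Hmap i n), fun _ => rfl⟩
  have hT' : ∀ n, HasDim (groupHomology (triv G) (n + 1)) (rε (n + 1) + rδ n) := fun n => by
    rw [← hrε, ← hrδ]; exact exact_count (xT n)
  have := fun n => (hT' n).1
  have c0 : 8 = ri 0 + rε 0 := by rw [← V0.2, ← hri, ← hrε]; exact (exact_count (xC 0)).2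
  have c1 : ∀ n, 2 * n + 8 = ri (n + 1) + rε (n + 1) := fun n => by
    rw [← hri, ← hrε, ← (V1 n).2]; exact (exact_count (xC (n + 1))).2
  have z0 : 10 = rδ 0 + ri 0 := by rw [← Z0.2, ← hri, ← hrδ]; exact (exact_count (xZ 0)).2
  have z1 : 9 = rδ 1 + ri 1 := by rw [← Z1.2, ← hri, ← hrδ]; exact (exact_count (xZ 1)).2
  have hε0 : rε 0 = 1 := by
    rw [← hrε]
    exact (rk_of_surjective (Hmap_zero_surjective _ (augm_surjective (G := G) (Orb D.H)))).trans
      t0.2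
  have hi2 : ∀ n, ri (n + 2) = 7 := fun n => by
    rw [← hri]; exact (rk_of_injective (hinj n)).trans (Z2 n).2
  have hi6 : ri 1 ≤ 6 := by rw [← hri]; exact D.rank_le i w
  have hconn : ∀ n, rδ (n + 2) = 0 := fun n => by
    rw [← hrδ]; exact rk_eq_zero_of_injective (xZ _) (hinj n)
  rw [hri] at hi
  refine ⟨(hT' 0).2.trans ?_, (hT' 1).2.trans ?_, fun q => (hT' (q + 2)).2.trans ?_⟩
  · have := c1 0
    simp only [Nat.zero_add] at this ⊢
    omega
  · have := c1 1
    have := hi2 0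
    simp only [Nat.zero_add, Nat.reduceAdd] at *
    omega
  · have := c1 (q + 2)
    have := hi2 (q + 1)
    have := hconn q
    rw [show q + 1 + 2 = q + 2 + 1 from rfl] at *
    omega

end CellData

end BianchiHomology

namespace BianchiHomology

section Morse
variable {V E T : Type} {d₂ : (T →₀ ZMod 2) →ₗ[ZMod 2] (E →₀ ZMod 2)}
  {d₁ : (E →₀ ZMod 2) →ₗ[ZMod 2] (V →₀ ZMod 2)}

/-- A family of chains with leading terms is linearly independent. -/
lemma injective_of_leading {X Y : Type} {d : (X →₀ ZMod 2) →ₗ[ZMod 2] (Y →₀ ZMod 2)} {μ : X → Y}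
    {r : Y → ℕ} (hμ : Function.Injective μ)
    (h : ∀ x, ∃ w : Y →₀ ZMod 2, (∀ y ∈ w.support, r y < r (μ x)) ∧
      d (Finsupp.single x 1) = Finsupp.single (μ x) 1 + w) : Function.Injective d := by
  rw [injective_iff_map_eq_zero]
  intro c hc
  by_contra hne
  obtain ⟨x, hx, hmax⟩ := Finset.exists_max_image c.support (fun x => r (μ x))
    (Finsupp.support_nonempty_iff.2 hne)
  have key : d c (μ x) = c x := by
    conv_lhs => rw [← Finsupp.sum_single c, Finsupp.sum, map_sum, Finsupp.finsetSum_apply]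
    rw [Finset.sum_eq_single x]
    · obtain ⟨w, hw, e⟩ := h x
      rw [← mul_one (c x), ← smul_eq_mul, ← Finsupp.smul_single, map_smul, e]
      simp only [Finsupp.smul_apply, Finsupp.add_apply, Finsupp.single_eq_same, smul_eq_mul]
      have : w (μ x) = 0 := by
        by_contra h0
        exact lt_irrefl _ (hw _ (Finsupp.mem_support_iff.2 h0))
      rw [this, add_zero, mul_one]
    · intro y hy hyx
      obtain ⟨w, hw, e⟩ := h y
      rw [← mul_one (c y), ← smul_eq_mul, ← Finsupp.smul_single, map_smul, e]
      have : w (μ x) = 0 := by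
        by_contra h0
        exact absurd (hw _ (Finsupp.mem_support_iff.2 h0)) (not_lt.2 (hmax y hy))
      rw [Finsupp.smul_apply, Finsupp.add_apply, this,
        Finsupp.single_eq_of_ne (fun h => hyx (hμ h.symm)), add_zero, smul_zero]
    · exact fun h => absurd hx h
  rw [hc] at key
  exact Finsupp.mem_support_iff.1 hx key.symm

/-- Exactness in the middle from a perfect matching with leading terms. -/
lemma exact_of_leading {μ : T → E} {rE : E → ℕ} {rV : V → ℕ} {U : Type} {j : U → V}
    (hj : Function.Injective j) {ν : U → E}
    (hd : ∀ c, d₁ (d₂ c) = 0)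
    (h₂ : ∀ x, ∃ w : E →₀ ZMod 2, (∀ y ∈ w.support, rE y < rE (μ x)) ∧
      d₂ (Finsupp.single x 1) = Finsupp.single (μ x) 1 + w)
    (h₁ : ∀ x, ∃ w : V →₀ ZMod 2, (∀ y ∈ w.support, rV y < rV (j x)) ∧
      d₁ (Finsupp.single (ν x) 1) = Finsupp.single (j x) 1 + w)
    (hcov : ∀ e, (∃ t, μ t = e) ∨ ∃ u, ν u = e) : Function.Exact d₂ d₁ := by
  let N : (U →₀ ZMod 2) →ₗ[ZMod 2] (E →₀ ZMod 2) := Finsupp.lmapDomain _ _ ν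
  have hN : ∀ u, N (Finsupp.single u 1) = Finsupp.single (ν u) 1 := fun u =>
    Finsupp.mapDomain_single
  have hinj : Function.Injective (d₁ ∘ₗ N) := injective_of_leading hj fun u => by
    rw [LinearMap.comp_apply, hN]; exact h₁ u
  let S := LinearMap.range d₂ ⊔ LinearMap.range N
  have hS : ∀ n e, rE e < n → Finsupp.single e (1 : ZMod 2) ∈ S := by
    intro n
    induction n with
    | zero => intro e h; exact absurd h (Nat.not_lt_zero _)
    | succ n ih =>
      intro e he
      rcases hcov e with ⟨t, rfl⟩ | ⟨u, rfl⟩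
      · obtain ⟨w, hw, e'⟩ := h₂ t
        rw [eq_sub_of_add_eq e'.symm]
        refine S.sub_mem (Submodule.mem_sup_left ⟨_, rfl⟩) ?_
        rw [← Finsupp.sum_single w]
        refine S.sum_mem fun y hy => ?_
        rw [← mul_one (w y), ← smul_eq_mul, ← Finsupp.smul_single]
        exact S.smul_mem _ (ih _ (lt_of_lt_of_le (hw y hy) (Nat.lt_succ_iff.1 he)))
      · exact Submodule.mem_sup_right ⟨_, hN u⟩
  intro z
  refine ⟨fun hz => ?_, by rintro ⟨c, rfl⟩; exact hd c⟩
  have hz' : z ∈ S := by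
    rw [← Finsupp.sum_single z]
    refine S.sum_mem fun y _ => ?_
    rw [← mul_one (z y), ← smul_eq_mul, ← Finsupp.smul_single]
    exact S.smul_mem _ (hS _ y (Nat.lt_succ_self _))
  obtain ⟨_, ⟨c, rfl⟩, _, ⟨b, rfl⟩, rfl⟩ := Submodule.mem_sup.1 hz'
  rw [map_add, hd, zero_add] at hz
  have : b = 0 := hinj (hz.trans (map_zero _).symm)
  exact ⟨c, by rw [this, map_zero, add_zero]⟩

/-- Exactness at the vertices from descending edges. -/
lemma exact_augmentation {rV : V → ℕ} (P₀ : V)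
    (hd : ∀ c, Finsupp.linearCombination (ZMod 2) (fun _ : V => (1 : ZMod 2)) (d₁ c) = 0)
    (h₁ : ∀ P, P ≠ P₀ → ∃ e Q, rV Q < rV P ∧
      d₁ (Finsupp.single e 1) = Finsupp.single P 1 + Finsupp.single Q 1) :
    Function.Exact d₁ (Finsupp.linearCombination (ZMod 2) (fun _ : V => (1 : ZMod 2))) := by
  let S := LinearMap.range d₁
  have hS : ∀ n P, rV P < n → Finsupp.single P (1 : ZMod 2) - Finsupp.single P₀ 1 ∈ S := by
    intro n
    induction n with
    | zero => intro e h; exact absurd h (Nat.not_lt_zero _)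
    | succ n ih =>
      intro P hP
      by_cases h : P = P₀
      · rw [h, sub_self]; exact S.zero_mem
      obtain ⟨e, Q, hQ, he⟩ := h₁ P h
      have h2 := ih Q (lt_of_lt_of_le hQ (Nat.lt_succ_iff.1 hP))
      have h3 : d₁ (Finsupp.single e 1) ∈ S := ⟨_, rfl⟩
      rw [he] at h3
      have h4 := S.add_mem h3 h2
      have h5 : (Finsupp.single Q (1 : ZMod 2)) + Finsupp.single Q 1 = 0 := add_self_zmod _
      have h6 : Finsupp.single P (1 : ZMod 2) - Finsupp.single P₀ 1 =
          Finsupp.single P 1 + Finsupp.single Q 1 + (Finsupp.single Q 1 - Finsupp.single P₀ 1) := by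
        rw [add_sub, add_assoc, h5, add_zero]
      rwa [h6]
  intro z
  refine ⟨fun hz => ?_, by rintro ⟨c, rfl⟩; exact hd c⟩
  have key : z = z.sum fun P r => r • (Finsupp.single P (1 : ZMod 2) - Finsupp.single P₀ 1) := by
    have e : (z.sum fun P r => r • Finsupp.single P₀ (1 : ZMod 2)) = 0 := by
      rw [Finsupp.linearCombination_apply] at hz
      rw [Finsupp.sum, ← Finset.sum_smul]
      have : ∑ i ∈ z.support, z i = 0 := by simpa [Finsupp.sum] using hz
      rw [this, zero_smul]
    simp only [smul_sub]
    rw [Finsupp.sum_sub, e, sub_zero]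
    conv_lhs => rw [← Finsupp.sum_single z]
    simp
  rw [key]
  exact S.sum_mem fun P _ => S.smul_mem _ (hS _ P (Nat.lt_succ_self _))

end Morse

end BianchiHomology

namespace BianchiHomology

/-- A two by two matrix over `ℤ[√-13]`; the entry `a + a' √-13` is stored as the pair `a, a'`. -/
@[ext] structure IMat where
  a : ℤ
  a' : ℤ
  b : ℤ
  b' : ℤ
  c : ℤ
  c' : ℤ
  d : ℤ
  d' : ℤ
  deriving DecidableEq

/-- An integral vector, standing for a Hermitian form or for a linear functional on such forms. -/
@[ext] structure Vec where
  x : ℤ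
  y : ℤ
  z : ℤ
  w : ℤ
  deriving DecidableEq

namespace IMat

/-- The identity matrix. -/
def one : IMat := ⟨1, 0, 0, 0, 0, 0, 1, 0⟩

/-- The matrix product. -/
def mul (m n : IMat) : IMat :=
  ⟨m.a * n.a - 13 * (m.a' * n.a') + (m.b * n.c - 13 * (m.b' * n.c')),
   m.a * n.a' + m.a' * n.a + (m.b * n.c' + m.b' * n.c),
   m.a * n.b - 13 * (m.a' * n.b') + (m.b * n.d - 13 * (m.b' * n.d')),
   m.a * n.b' + m.a' * n.b + (m.b * n.d' + m.b' * n.d),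
   m.c * n.a - 13 * (m.c' * n.a') + (m.d * n.c - 13 * (m.d' * n.c')),
   m.c * n.a' + m.c' * n.a + (m.d * n.c' + m.d' * n.c),
   m.c * n.b - 13 * (m.c' * n.b') + (m.d * n.d - 13 * (m.d' * n.d')),
   m.c * n.b' + m.c' * n.b + (m.d * n.d' + m.d' * n.d)⟩

/-- The adjugate matrix. -/
def adj (m : IMat) : IMat := ⟨m.d, m.d', -m.b, -m.b', -m.c, -m.c', m.a, m.a'⟩

/-- The negated matrix. -/
def neg (m : IMat) : IMat := ⟨-m.a, -m.a', -m.b, -m.b', -m.c, -m.c', -m.d, -m.d'⟩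

/-- The matrix has determinant one. -/
def Unimod (m : IMat) : Prop :=
  m.a * m.d - 13 * (m.a' * m.d') - (m.b * m.c - 13 * (m.b' * m.c')) = 1 ∧
    m.a * m.d' + m.a' * m.d - (m.b * m.c' + m.b' * m.c) = 0

instance (m : IMat) : Decidable m.Unimod := by unfold Unimod; infer_instance

lemma Unimod.mul {m n : IMat} (hm : m.Unimod) (hn : n.Unimod) : (m.mul n).Unimod := by
  obtain ⟨a, a', b, b', c, c', d, d'⟩ := m
  obtain ⟨e, e', f, f', g, g', h, h'⟩ := n
  simp only [Unimod, IMat.mul] at *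
  obtain ⟨h1, h2⟩ := hm
  obtain ⟨h3, h4⟩ := hn
  constructor
  · linear_combination (e * h - 13 * (e' * h') - (f * g - 13 * (f' * g'))) * h1 + h3 -
      13 * (e * h' + e' * h - (f * g' + f' * g)) * h2
  · linear_combination (e * h' + e' * h - (f * g' + f' * g)) * h1 + h4 +
      (e * h - 13 * (e' * h') - (f * g - 13 * (f' * g'))) * h2

lemma Unimod.adj {m : IMat} (hm : m.Unimod) : m.adj.Unimod := by
  obtain ⟨h1, h2⟩ := hm
  simp only [Unimod, IMat.adj]
  constructor
  · linear_combination h1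
  · linear_combination h2

lemma Unimod.neg {m : IMat} (hm : m.Unimod) : m.neg.Unimod := by
  obtain ⟨h1, h2⟩ := hm
  simp only [Unimod, IMat.neg]
  constructor
  · linear_combination h1
  · linear_combination h2

lemma unimod_one : one.Unimod := by decide

lemma mul_adj {m : IMat} (hm : m.Unimod) : m.mul m.adj = one := by
  obtain ⟨h1, h2⟩ := hm
  ext <;> simp only [mul, adj, one]
  · linear_combination h1
  · linear_combination h2
  · ring
  · ring
  · ring
  · ring
  · linear_combination h1
  · linear_combination h2

lemma adj_mul {m : IMat} (hm : m.Unimod) : m.adj.mul m = one := by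
  have := mul_adj hm.adj
  simpa only [adj, neg_neg] using this

lemma mul_one (m : IMat) : m.mul one = m := by
  ext <;> simp only [mul, one] <;> ring

lemma mul_assoc (m n k : IMat) : (m.mul n).mul k = m.mul (n.mul k) := by
  ext <;> simp only [mul] <;> ring

lemma adj_adj (m : IMat) : m.adj.adj = m := by
  simp only [adj, neg_neg]

lemma adj_mul_rev (m n : IMat) : (m.mul n).adj = n.adj.mul m.adj := by
  ext <;> simp only [mul, adj] <;> ring

end IMat

namespace Vec

/-- Pulling back a functional along the action of a matrix on Hermitian forms. -/
def pull (L : Vec) (m : IMat) : Vec :=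
  ⟨L.x * (m.a * m.a + 13 * (m.a' * m.a')) + L.y * (m.c * m.c + 13 * (m.c' * m.c')) +
      L.z * (m.a * m.c + 13 * (m.a' * m.c')) + L.w * (m.a' * m.c - m.a * m.c'),
   L.x * (m.b * m.b + 13 * (m.b' * m.b')) + L.y * (m.d * m.d + 13 * (m.d' * m.d')) +
      L.z * (m.b * m.d + 13 * (m.b' * m.d')) + L.w * (m.b' * m.d - m.b * m.d'),
   2 * (L.x * (m.a * m.b + 13 * (m.a' * m.b'))) + 2 * (L.y * (m.c * m.d + 13 * (m.c' * m.d'))) +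
      L.z * (m.a * m.d + 13 * (m.a' * m.d') + (m.b * m.c + 13 * (m.b' * m.c'))) +
      L.w * (m.a' * m.d - m.a * m.d' + (m.b' * m.c - m.b * m.c')),
   -26 * (L.x * (m.a' * m.b - m.a * m.b')) + -26 * (L.y * (m.c' * m.d - m.c * m.d')) +
      L.z * (-13 * (m.a' * m.d - m.a * m.d') + 13 * (m.b' * m.c - m.b * m.c')) +
      L.w * (m.a * m.d + 13 * (m.a' * m.d') - (m.b * m.c + 13 * (m.b' * m.c')))⟩

/-- The action of a matrix on functionals. -/
def act (m : IMat) (L : Vec) : Vec := L.pull m.adj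

lemma pull_pull (L : Vec) (m n : IMat) : (L.pull m).pull n = L.pull (m.mul n) := by
  ext <;> simp only [pull, IMat.mul] <;> ring

lemma pull_one (L : Vec) : L.pull IMat.one = L := by
  ext <;> simp only [pull, IMat.one] <;> ring

lemma pull_neg (L : Vec) (m : IMat) : L.pull m.neg = L.pull m := by
  ext <;> simp only [pull, IMat.neg] <;> ring

lemma act_mul (m n : IMat) (L : Vec) : act (m.mul n) L = act m (act n L) := by
  rw [act, IMat.adj_mul_rev, ← pull_pull]; rfl

lemma act_one (L : Vec) : act IMat.one L = L := by
  ext <;> simp only [act, pull, IMat.one, IMat.adj] <;> ring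

lemma act_neg (m : IMat) (L : Vec) : act m.neg L = act m L := by
  rw [act, show m.neg.adj = m.adj.neg by simp only [IMat.neg, IMat.adj], pull_neg]; rfl

/-- The discriminant of a functional. -/
def disc (L : Vec) : ℤ := 52 * (L.x * L.y) - 13 * (L.z * L.z) - L.w * L.w

lemma disc_pull (L : Vec) {m : IMat} (hm : m.Unimod) : (L.pull m).disc = L.disc := by
  obtain ⟨h1, h2⟩ := hm
  obtain ⟨a, a', b, b', c, c', d, d'⟩ := m
  simp only at h1 h2
  have key : (L.pull ⟨a, a', b, b', c, c', d, d'⟩).disc = L.disc *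
      ((a * d - 13 * (a' * d') - (b * c - 13 * (b' * c'))) ^ 2 +
        13 * (a * d' + a' * d - (b * c' + b' * c)) ^ 2) := by
    simp only [pull, disc]; ring
  rw [key, h1, h2]; ring

/-- A functional that is nonnegative on positive semidefinite forms. -/
def Psd (L : Vec) : Prop := 0 ≤ L.x ∧ 0 ≤ L.y ∧ 0 ≤ L.disc

instance (L : Vec) : Decidable L.Psd := by unfold Psd; infer_instance

/-- Completing the square for the value of a functional on a rank one form. -/
lemma complete_square (l k p q a a' c c' : ℤ) :
    52 * (l * (l * (a * a + 13 * (a' * a')) + k * (c * c + 13 * (c' * c')) +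
      p * (a * c + 13 * (a' * c')) + q * (a' * c - a * c'))) =
    13 * (2 * (l * a) + p * c - q * c') ^ 2 + (26 * (l * a') + 13 * (p * c') + q * c) ^ 2 +
      (52 * (l * k) - 13 * (p * p) - q * q) * (c * c + 13 * (c' * c')) := by ring

lemma rank_one_nonneg {L : Vec} (hL : L.Psd) (a a' c c' : ℤ) :
    0 ≤ L.x * (a * a + 13 * (a' * a')) + L.y * (c * c + 13 * (c' * c')) +
      L.z * (a * c + 13 * (a' * c')) + L.w * (a' * c - a * c') := by
  obtain ⟨h0, h1, h2⟩ := hL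
  have hc : 0 ≤ c * c + 13 * (c' * c') := by nlinarith [mul_self_nonneg c, mul_self_nonneg c']
  rw [disc] at h2
  rcases h0.lt_or_eq with h0 | h0
  · have := complete_square L.x L.y L.z L.w a a' c c'
    have h3 := mul_nonneg h2 hc
    by_contra! hneg
    nlinarith [mul_pos h0 (neg_pos.2 hneg), sq_nonneg (2 * (L.x * a) + L.z * c - L.w * c'),
      sq_nonneg (26 * (L.x * a') + 13 * (L.z * c') + L.w * c)]
  · have hz : L.z = 0 := by nlinarith [mul_self_nonneg L.z, mul_self_nonneg L.w]
    have hw : L.w = 0 := by nlinarith [mul_self_nonneg L.z, mul_self_nonneg L.w]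
    rw [← h0, hz, hw]
    nlinarith [mul_nonneg h1 hc]

lemma Psd.pull {L : Vec} (hL : L.Psd) {m : IMat} (hm : m.Unimod) : (L.pull m).Psd :=
  ⟨rank_one_nonneg hL _ _ _ _, rank_one_nonneg hL _ _ _ _, by rw [disc_pull L hm]; exact hL.2.2⟩

lemma Psd.act {L : Vec} (hL : L.Psd) {m : IMat} (hm : m.Unimod) : (act m L).Psd := hL.pull hm.adj

/-- Sum of functionals. -/
def add (L M : Vec) : Vec := ⟨L.x + M.x, L.y + M.y, L.z + M.z, L.w + M.w⟩

/-- Difference of functionals. -/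
def sub (L M : Vec) : Vec := ⟨L.x - M.x, L.y - M.y, L.z - M.z, L.w - M.w⟩

/-- Integral multiple of a functional. -/
def smul (k : ℤ) (L : Vec) : Vec := ⟨k * L.x, k * L.y, k * L.z, k * L.w⟩

/-- The value of a functional at an integral form. -/
def pair (L v : Vec) : ℤ := L.x * v.x + L.y * v.y + L.z * v.z + L.w * v.w

/-- Complex conjugation. -/
def conj (L : Vec) : Vec := ⟨L.x, L.y, L.z, -L.w⟩

end Vec

/-- A point of the space of real Hermitian forms. -/
structure Pt where
  x : ℝ
  y : ℝ
  z : ℝ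
  w : ℝ

namespace Vec

/-- The value of a functional at a real form. -/
noncomputable def ev (L : Vec) (p : Pt) : ℝ := L.x * p.x + L.y * p.y + L.z * p.z + L.w * p.w

lemma ev_add (L M : Vec) (p : Pt) : (L.add M).ev p = L.ev p + M.ev p := by
  simp only [ev, add]; push_cast; ring

lemma ev_sub (L M : Vec) (p : Pt) : (L.sub M).ev p = L.ev p - M.ev p := by
  simp only [ev, sub]; push_cast; ring

lemma ev_smul (k : ℤ) (L : Vec) (p : Pt) : (L.smul k).ev p = k * L.ev p := by
  simp only [ev, smul]; push_cast; ring

end Vec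

/-- The transform of a real form by the inverse of a matrix. -/
noncomputable def Pt.back (m : IMat) (p : Pt) : Pt :=
  ⟨(Vec.act m ⟨1, 0, 0, 0⟩).ev p, (Vec.act m ⟨0, 1, 0, 0⟩).ev p, (Vec.act m ⟨0, 0, 1, 0⟩).ev p,
    (Vec.act m ⟨0, 0, 0, 1⟩).ev p⟩

namespace Vec

lemma ev_act (m : IMat) (L : Vec) (p : Pt) : (act m L).ev p = L.ev (p.back m) := by
  simp only [ev, act, pull, Pt.back, IMat.adj]; push_cast; ring

lemma Psd.ev_nonneg {L : Vec} (hL : L.Psd) {p : Pt} (hx : 0 ≤ p.x) (hy : 0 ≤ p.y)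
    (hp : p.z ^ 2 + 13 * p.w ^ 2 ≤ p.x * p.y) : 0 ≤ L.ev p := by
  obtain ⟨h0, h1, h2⟩ := hL
  have h0' : (0 : ℝ) ≤ L.x := by exact_mod_cast h0
  have h1' : (0 : ℝ) ≤ L.y := by exact_mod_cast h1
  have h2' : (0 : ℝ) ≤ 52 * (L.x * L.y) - 13 * (L.z * L.z) - L.w * L.w := by
    rw [disc] at h2; exact_mod_cast h2
  have hX : 0 ≤ L.x * p.x + L.y * p.y := by positivity
  have hsq : (L.z * p.z + L.w * p.w) ^ 2 ≤ (L.x * p.x + L.y * p.y) ^ 2 := by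
    have e1 : (L.z ^ 2 + L.w ^ 2 / 13) * (p.z ^ 2 + 13 * p.w ^ 2) ≤
        (4 * (L.x * L.y : ℝ)) * (p.x * p.y) := by
      apply mul_le_mul _ hp (by positivity) (by positivity)
      linarith
    have e2 : (L.z * p.z + L.w * p.w) ^ 2 ≤
        ((L.z : ℝ) ^ 2 + L.w ^ 2 / 13) * (p.z ^ 2 + 13 * p.w ^ 2) := by
      nlinarith [sq_nonneg (13 * L.z * p.w - L.w * p.z : ℝ)]
    nlinarith [sq_nonneg (L.x * p.x - L.y * p.y : ℝ)]
  have := abs_le_of_sq_le_sq' hsq hX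
  rw [ev]; linarith [this.1]

/-- The action of a matrix on integral forms. -/
def form (m : IMat) (v : Vec) : Vec :=
  ⟨pair (pull ⟨1, 0, 0, 0⟩ m) v, pair (pull ⟨0, 1, 0, 0⟩ m) v, pair (pull ⟨0, 0, 1, 0⟩ m) v,
    pair (pull ⟨0, 0, 0, 1⟩ m) v⟩

lemma pair_pull (L : Vec) (m : IMat) (v : Vec) : (L.pull m).pair v = L.pair (form m v) := by
  simp only [form, pair, pull]; ring

end Vec

end BianchiHomology

namespace BianchiHomology

/-- The functionals representing the orbits of vertices. -/
def rep : Fin 8 → Vec :=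
  ![⟨3, 3, 0, 21⟩, ⟨3, 3, 3, 18⟩, ⟨3, 6, 0, 30⟩, ⟨3, 5, 1, 27⟩, ⟨3, 3, 0, -21⟩, ⟨3, 3, 3, -18⟩,
    ⟨3, 6, 0, -30⟩, ⟨3, 5, 1, -27⟩]

/-- The stabilisers of the representatives of vertices, up to sign. -/
def stab : Fin 8 → List IMat :=
  ![[⟨1, 0, 0, 0, 0, 0, 1, 0⟩, ⟨0, 0, 1, 0, -1, 0, 0, 0⟩, ⟨0, 1, -4, 0, -3, 0, 0, -1⟩, ⟨0, 1,
    -3, 0, -4, 0, 0, -1⟩, ⟨3, 0, 0, 1, 0, 1, -4, 0⟩, ⟨4, 0, 0, 1, 0, 1, -3, 0⟩], [⟨1, 0, 0, 0, 0,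
    0, 1, 0⟩, ⟨0, 0, 1, 0, -1, 0, -1, 0⟩, ⟨1, 0, 1, 0, -1, 0, 0, 0⟩, ⟨2, -1, 4, 0, 2, 1, -2, 1⟩,
    ⟨2, 1, -2, 1, -4, 0, -2, -1⟩, ⟨4, 0, 2, 1, -2, 1, -4, 0⟩], [⟨1, 0, 0, 0, 0, 0, 1, 0⟩, ⟨0, 1,
    -6, 0, -2, 0, 0, -1⟩, ⟨0, 1, -4, 0, -3, 0, 0, -1⟩, ⟨5, 0, 0, 2, 0, 1, -5, 0⟩], [⟨1, 0, 0, 0,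
    0, 0, 1, 0⟩], [⟨1, 0, 0, 0, 0, 0, 1, 0⟩, ⟨0, 0, 1, 0, -1, 0, 0, 0⟩, ⟨0, 1, 3, 0, 4, 0, 0, -1⟩,
    ⟨0, 1, 4, 0, 3, 0, 0, -1⟩, ⟨3, 0, 0, -1, 0, -1, -4, 0⟩, ⟨4, 0, 0, -1, 0, -1, -3, 0⟩], [⟨1, 0,
    0, 0, 0, 0, 1, 0⟩, ⟨0, 0, 1, 0, -1, 0, -1, 0⟩, ⟨1, 0, 1, 0, -1, 0, 0, 0⟩, ⟨2, -1, -2, -1, -4,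
    0, -2, 1⟩, ⟨2, 1, 4, 0, 2, -1, -2, -1⟩, ⟨4, 0, 2, -1, -2, -1, -4, 0⟩], [⟨1, 0, 0, 0, 0, 0, 1,
    0⟩, ⟨0, 1, 4, 0, 3, 0, 0, -1⟩, ⟨0, 1, 6, 0, 2, 0, 0, -1⟩, ⟨5, 0, 0, -2, 0, -1, -5, 0⟩], [⟨1,
    0, 0, 0, 0, 0, 1, 0⟩]]

/-- The matrix carrying a representative of vertices to the end of an edge. -/
def glue : Fin 19 → IMat :=
  ![⟨0, 1, -3, 0, -4, 0, 0, -1⟩, ⟨0, 0, 1, 0, -1, 0, 0, 0⟩, ⟨0, 4, 14, 1, -14, 1, 0, 4⟩, ⟨3, 0,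
    1, -1, -2, 1, 4, 1⟩, ⟨4, 0, 2, 1, -2, 1, -4, 0⟩, ⟨0, 1, -4, 0, -3, 0, 0, -1⟩, ⟨0, 1, 9, 0, -3,
    0, 0, 2⟩, ⟨1, 2, 9, 0, -6, 0, -1, 2⟩, ⟨1, 1, 5, 0, -3, 0, -1, 1⟩, ⟨1, 1, 5, 0, -3, 0, -1, 1⟩,
    ⟨0, 1, 3, 0, 4, 0, 0, -1⟩, ⟨0, 0, 1, 0, -1, 0, 0, 0⟩, ⟨0, 1, 4, 0, 3, 0, 0, -1⟩, ⟨0, 1, -3, 0,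
    -4, 0, 0, -1⟩, ⟨1, 0, 0, 0, 0, 0, 1, 0⟩, ⟨14, -1, 0, -4, 0, 4, 14, 1⟩, ⟨1, -1, -5, 0, 2, 1, 4,
    -1⟩, ⟨5, 0, 1, -1, 1, 1, 3, 0⟩, ⟨0, 1, 3, 0, 4, 0, 0, -1⟩]

/-- The boundaries of the two-cells. -/
def bdry : Fin 11 → List (Fin 19 × IMat) :=
  ![[(0, ⟨0, 1, -3, 0, -4, 0, 0, -1⟩), (3, ⟨1, 0, 0, 0, 0, 0, 1, 0⟩), (7, ⟨3, 0, 0, 1, 0, 1, -4,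
    0⟩), (1, ⟨0, 1, -3, 0, -4, 0, 0, -1⟩)], [(0, ⟨0, 1, -4, 0, -3, 0, 0, -1⟩), (4, ⟨1, 2, -6, 1,
    -8, 0, -3, -2⟩), (10, ⟨0, 7, 22, 0, -29, 0, 0, 7⟩), (13, ⟨1, 0, 0, 0, 0, 0, 1, 0⟩)], [(0, ⟨4,
    0, 0, 1, 0, 1, -3, 0⟩), (3, ⟨1, 0, 0, 0, 1, 0, 1, 0⟩), (8, ⟨0, 0, 1, 0, -1, 0, 0, 0⟩), (1, ⟨1,
    0, 0, 0, 0, 0, 1, 0⟩)], [(1, ⟨0, 0, 1, 0, -1, 0, 0, 0⟩), (5, ⟨0, 1, -4, 0, -3, 0, 0, -1⟩),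
    (14, ⟨1, 0, 0, 0, 0, 0, 1, 0⟩)], [(0, ⟨8, 0, -1, 2, -3, 2, -6, -1⟩), (2, ⟨2, 1, -4, 0, -4, 0,
    2, -1⟩), (10, ⟨8, 4, 12, -3, -16, 1, 7, 4⟩), (15, ⟨1, 0, 0, 0, 0, 0, 1, 0⟩)], [(3, ⟨0, 0, 1,
    0, -1, 0, -1, 0⟩), (12, ⟨1, -1, -5, 0, 2, 1, 4, -1⟩), (16, ⟨1, 0, 0, 0, 0, 0, 1, 0⟩)], [(5,
    ⟨1, 0, 0, 0, 0, 0, 1, 0⟩), (7, ⟨0, 1, -4, 0, -3, 0, 0, -1⟩), (8, ⟨1, 0, 1, 0, 0, 0, 1, 0⟩),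
    (5, ⟨3, -1, 4, 1, 3, 0, 0, 1⟩), (6, ⟨3, -1, 4, 1, 3, 0, 0, 1⟩), (12, ⟨3, -2, -9, -1, 3, 0, 0,
    -1⟩), (8, ⟨2, -2, 9, 0, 3, 0, 1, 1⟩), (7, ⟨2, -2, 9, 0, 3, 0, 1, 1⟩), (12, ⟨1, 0, 0, -1, 0, 0,
    1, 0⟩), (6, ⟨0, 1, -4, 0, -3, 0, 0, -1⟩)], [(5, ⟨1, 0, 0, 0, 0, 0, 1, 0⟩), (9, ⟨0, 1, -4, 0,
    -3, 0, 0, -1⟩), (17, ⟨1, 0, 0, 0, 0, 0, 1, 0⟩)], [(9, ⟨1, 0, 0, 0, 0, 0, 1, 0⟩), (10, ⟨9, 0,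
    -1, -2, -1, 2, 6, 0⟩), (11, ⟨9, 0, -1, -2, -1, 2, 6, 0⟩), (7, ⟨1, 0, 0, 0, 0, 0, 1, 0⟩)], [(8,
    ⟨1, 0, 0, 0, 0, 0, 1, 0⟩), (11, ⟨5, 0, -1, -1, -1, 1, 3, 0⟩), (10, ⟨7, 1, 3, -2, -4, 1, 4,
    1⟩), (9, ⟨1, 0, 0, 0, 0, 0, 1, 0⟩)], [(11, ⟨0, 1, 4, 0, 3, 0, 0, -1⟩), (12, ⟨0, 1, 3, 0, 4, 0,
    0, -1⟩), (18, ⟨0, 0, 1, 0, -1, 0, 0, 0⟩)]]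

/-- The corners of the two-cells. -/
def corners : Fin 11 → List (Fin 8 × IMat) :=
  ![[(0, ⟨0, 0, 1, 0, -1, 0, 0, 0⟩), (1, ⟨1, 0, 0, 0, 0, 0, 1, 0⟩), (7, ⟨3, 0, 1, -1, -2, 1, 4,
    1⟩), (3, ⟨3, 0, 0, 1, 0, 1, -4, 0⟩)], [(0, ⟨0, 0, 1, 0, -1, 0, 0, 0⟩), (1, ⟨3, 0, 0, 1, 0, 1,
    -4, 0⟩), (5, ⟨3, 0, 0, 1, 0, 1, -4, 0⟩), (4, ⟨0, 1, -3, 0, -4, 0, 0, -1⟩)], [(0, ⟨0, 0, 1, 0,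
    -1, 0, 0, 0⟩), (1, ⟨0, 0, 1, 0, -1, 0, 0, 0⟩), (7, ⟨3, 0, 1, -1, 1, 1, 5, 0⟩), (3, ⟨0, 0, 1,
    0, -1, 0, 0, 0⟩)], [(0, ⟨0, 0, 1, 0, -1, 0, 0, 0⟩), (3, ⟨1, 0, 0, 0, 0, 0, 1, 0⟩), (2, ⟨1, 0,
    0, 0, 0, 0, 1, 0⟩)], [(1, ⟨1, 0, 0, 0, 0, 0, 1, 0⟩), (0, ⟨2, 1, -4, 0, -4, 0, 2, -1⟩), (4, ⟨4,
    4, 15, 0, -15, 0, -4, 4⟩), (5, ⟨14, -1, 0, -4, 0, 4, 14, 1⟩)], [(1, ⟨1, 0, 0, 0, 0, 0, 1, 0⟩),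
    (7, ⟨2, -1, -4, -1, 1, 1, 5, 0⟩), (6, ⟨1, -1, -5, 0, 2, 1, 4, -1⟩)], [(2, ⟨1, 0, 0, 0, 0, 0,
    1, 0⟩), (3, ⟨0, 1, -4, 0, -3, 0, 0, -1⟩), (7, ⟨2, -1, -4, -1, 3, 0, 1, -1⟩), (3, ⟨1, 0, 1, 0,
    0, 0, 1, 0⟩), (2, ⟨1, 0, 1, 0, 0, 0, 1, 0⟩), (6, ⟨1, 0, 1, -1, 0, 0, 1, 0⟩), (7, ⟨1, 0, 1, -1,
    0, 0, 1, 0⟩), (3, ⟨2, -2, 9, 0, 3, 0, 1, 1⟩), (7, ⟨0, 2, 9, 0, -3, 0, 0, 1⟩), (6, ⟨1, 0, 0,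
    -1, 0, 0, 1, 0⟩)], [(2, ⟨1, 0, 0, 0, 0, 0, 1, 0⟩), (3, ⟨0, 1, -4, 0, -3, 0, 0, -1⟩), (5, ⟨5,
    0, 1, -1, 1, 1, 3, 0⟩)], [(3, ⟨1, 0, 0, 0, 0, 0, 1, 0⟩), (5, ⟨1, 1, 5, 0, -3, 0, -1, 1⟩), (4,
    ⟨1, 1, 4, -1, -3, 0, 2, 1⟩), (7, ⟨1, 2, 9, 0, -6, 0, -1, 2⟩)], [(3, ⟨1, 0, 0, 0, 0, 0, 1, 0⟩),
    (7, ⟨1, 1, 5, 0, -3, 0, -1, 1⟩), (4, ⟨1, 1, 5, 0, -3, 0, -1, 1⟩), (5, ⟨1, 1, 5, 0, -3, 0, -1,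
    1⟩)], [(4, ⟨0, 0, 1, 0, -1, 0, 0, 0⟩), (7, ⟨4, 0, 0, -1, 0, -1, -3, 0⟩), (6, ⟨0, 1, 3, 0, 4,
    0, 0, -1⟩)]]

/-- The edges at a vertex: the orbit, the position in the stabiliser, and whether the vertex is the
second end. -/
def star : Fin 8 → List (Fin 19 × ℕ × Bool) :=
  ![[(0, 1, false), (0, 2, false), (0, 3, false), (0, 0, false), (0, 4, false), (0, 5, false),
    (1, 1, false), (1, 2, false), (1, 3, false), (1, 0, false), (1, 4, false), (1, 5, false), (2,
    1, false), (2, 0, false), (13, 1, false), (13, 0, false), (13, 3, false), (14, 1, false), (14,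
    0, false), (14, 3, false)], [(0, 0, true), (0, 3, true), (0, 2, true), (0, 1, true), (0, 4,
    true), (0, 5, true), (3, 1, false), (3, 0, false), (3, 2, false), (3, 3, false), (3, 4,
    false), (3, 5, false), (4, 0, false), (4, 3, false), (15, 1, false), (15, 0, false), (15, 2,
    false), (16, 1, false), (16, 0, false), (16, 2, false)], [(5, 1, false), (5, 2, false), (5, 0,
    false), (5, 3, false), (6, 0, false), (6, 2, false), (14, 1, true), (14, 0, true), (17, 1,
    false), (17, 0, false)], [(1, 0, true), (5, 0, true), (7, 0, false), (8, 0, false), (9, 0,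
    false)], [(10, 1, false), (10, 3, false), (10, 2, false), (10, 0, false), (10, 4, false), (10,
    5, false), (11, 1, false), (11, 3, false), (11, 2, false), (11, 0, false), (11, 4, false),
    (11, 5, false), (2, 0, true), (2, 1, true), (13, 3, true), (13, 2, true), (13, 0, true), (18,
    3, false), (18, 2, false), (18, 0, false)], [(10, 0, true), (10, 4, true), (10, 2, true), (10,
    1, true), (10, 3, true), (10, 5, true), (9, 2, true), (9, 1, true), (9, 0, true), (9, 5,
    true), (9, 4, true), (9, 3, true), (4, 3, true), (4, 0, true), (15, 1, true), (15, 0, true),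
    (15, 2, true), (17, 2, true), (17, 1, true), (17, 0, true)], [(12, 2, false), (12, 1, false),
    (12, 0, false), (12, 3, false), (6, 1, true), (6, 0, true), (18, 2, true), (18, 0, true), (16,
    1, true), (16, 0, true)], [(11, 0, true), (12, 0, true), (7, 0, true), (8, 0, true), (3, 0,
    true)]]

/-- The corners of two-cells at a vertex: the positions of the two edges in the star, the orbit of the
cell, the position of the corner and the position in the stabiliser. -/
def links : Fin 8 → List (ℕ × ℕ × Fin 11 × ℕ × ℕ) :=
  ![[(6, 0, 0, 0, 2), (7, 0, 2, 0, 5), (0, 12, 4, 1, 2), (14, 0, 1, 0, 3), (7, 1, 0, 0, 3), (8,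
    1, 2, 0, 4), (1, 12, 4, 1, 3), (15, 1, 1, 0, 1), (6, 2, 2, 0, 0), (8, 2, 0, 0, 1), (2, 12, 4,
    1, 1), (16, 2, 1, 0, 2), (9, 3, 0, 0, 4), (10, 3, 2, 0, 3), (3, 13, 4, 1, 4), (15, 3, 1, 0,
    5), (10, 4, 0, 0, 5), (11, 4, 2, 0, 2), (4, 13, 4, 1, 5), (14, 4, 1, 0, 0), (9, 5, 2, 0, 1),
    (11, 5, 0, 0, 0), (5, 13, 4, 1, 0), (16, 5, 1, 0, 4), (18, 6, 3, 0, 1), (19, 7, 3, 0, 2), (17,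
    8, 3, 0, 3), (17, 9, 3, 0, 0), (19, 10, 3, 0, 4), (18, 11, 3, 0, 5)], [(0, 7, 0, 1, 0), (0, 8,
    2, 1, 0), (0, 13, 1, 1, 0), (15, 0, 4, 0, 5), (1, 9, 0, 1, 3), (1, 10, 2, 1, 3), (1, 12, 1, 1,
    3), (14, 1, 4, 0, 1), (2, 6, 2, 1, 2), (2, 8, 0, 1, 2), (2, 13, 1, 1, 2), (16, 2, 4, 0, 4),
    (3, 6, 0, 1, 1), (3, 7, 2, 1, 1), (3, 13, 1, 1, 1), (14, 3, 4, 0, 3), (4, 10, 0, 1, 4), (4,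
    11, 2, 1, 4), (4, 12, 1, 1, 4), (16, 4, 4, 0, 2), (5, 9, 2, 1, 5), (5, 11, 0, 1, 5), (5, 12,
    1, 1, 5), (15, 5, 4, 0, 0), (18, 6, 5, 0, 0), (19, 7, 5, 0, 2), (17, 8, 5, 0, 1), (19, 9, 5,
    0, 4), (18, 10, 5, 0, 5), (17, 11, 5, 0, 3)], [(0, 4, 6, 4, 3), (5, 0, 6, 0, 1), (0, 6, 3, 2,
    3), (8, 0, 7, 0, 1), (4, 1, 6, 0, 2), (1, 5, 6, 4, 0), (1, 7, 3, 2, 0), (8, 1, 7, 0, 2), (2,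
    4, 6, 4, 2), (5, 2, 6, 0, 0), (2, 7, 3, 2, 2), (9, 2, 7, 0, 0), (4, 3, 6, 0, 3), (3, 5, 6, 4,
    1), (3, 6, 3, 2, 1), (9, 3, 7, 0, 3)], [(0, 1, 3, 1, 0), (2, 0, 0, 3, 0), (3, 0, 2, 3, 0), (1,
    2, 6, 1, 0), (3, 1, 6, 3, 0), (1, 4, 7, 1, 0), (3, 2, 6, 7, 0), (2, 4, 8, 0, 0), (4, 3, 9, 0,
    0)], [(0, 6, 8, 2, 3), (7, 0, 9, 2, 5), (12, 0, 4, 2, 5), (0, 14, 1, 3, 3), (1, 7, 8, 2, 2),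
    (8, 1, 9, 2, 4), (12, 1, 4, 2, 4), (1, 15, 1, 3, 2), (6, 2, 9, 2, 0), (2, 8, 8, 2, 1), (12, 2,
    4, 2, 0), (2, 16, 1, 3, 1), (3, 9, 8, 2, 4), (10, 3, 9, 2, 2), (13, 3, 4, 2, 2), (3, 15, 1, 3,
    4), (4, 10, 8, 2, 5), (11, 4, 9, 2, 3), (13, 4, 4, 2, 3), (4, 14, 1, 3, 5), (9, 5, 9, 2, 1),
    (5, 11, 8, 2, 0), (13, 5, 4, 2, 1), (5, 16, 1, 3, 0), (18, 6, 10, 0, 2), (19, 7, 10, 0, 1),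
    (17, 8, 10, 0, 3), (17, 9, 10, 0, 5), (19, 10, 10, 0, 0), (18, 11, 10, 0, 4)], [(7, 0, 8, 1,
    1), (0, 8, 9, 3, 0), (13, 0, 1, 2, 0), (0, 15, 4, 3, 5), (9, 1, 8, 1, 5), (1, 10, 9, 3, 4),
    (12, 1, 1, 2, 4), (1, 14, 4, 3, 1), (2, 6, 9, 3, 2), (8, 2, 8, 1, 0), (13, 2, 1, 2, 2), (2,
    16, 4, 3, 3), (6, 3, 8, 1, 2), (3, 7, 9, 3, 1), (13, 3, 1, 2, 1), (3, 14, 4, 3, 4), (10, 4, 8,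
    1, 4), (4, 11, 9, 3, 3), (12, 4, 1, 2, 3), (4, 16, 4, 3, 2), (5, 9, 9, 3, 5), (11, 5, 8, 1,
    3), (12, 5, 1, 2, 5), (5, 15, 4, 3, 0), (6, 18, 7, 2, 1), (7, 19, 7, 2, 0), (8, 17, 7, 2, 2),
    (9, 19, 7, 2, 4), (10, 18, 7, 2, 3), (11, 17, 7, 2, 5)], [(4, 0, 6, 5, 3), (0, 5, 6, 9, 2),
    (0, 6, 10, 2, 2), (0, 8, 5, 2, 2), (1, 4, 6, 9, 1), (5, 1, 6, 5, 0), (1, 7, 10, 2, 1), (1, 8,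
    5, 2, 1), (4, 2, 6, 5, 1), (2, 5, 6, 9, 0), (2, 7, 10, 2, 0), (2, 9, 5, 2, 0), (3, 4, 6, 9,
    3), (5, 3, 6, 5, 2), (3, 6, 10, 2, 3), (3, 9, 5, 2, 3)], [(0, 1, 10, 1, 0), (0, 2, 8, 3, 0),
    (3, 0, 9, 1, 0), (2, 1, 6, 8, 0), (1, 3, 6, 6, 0), (4, 1, 5, 1, 0), (2, 3, 6, 2, 0), (4, 2, 0,
    2, 0), (4, 3, 2, 2, 0)]]

/-- Combinations of the differences along the edges of a star which are nonnegative on forms, grouped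
by the largest position. -/
def clauses : Fin 4 → List (List (List (ℕ × ℕ) × List (ℕ × ℕ))) :=
  ![[[], [], [], [([(0, 1), (3, 1)], []), ([(2, 1), (3, 1)], [])], [([(1, 1), (4, 1)], []),
    ([(2, 1), (4, 1)], [])], [([(0, 1), (5, 1)], []), ([(1, 1), (5, 1)], [])], [([(1, 1), (6, 1)],
    []), ([(3, 1), (6, 1)], []), ([(0, 7), (2, 7)], [(6, 6)])], [([(2, 1), (7, 1)], []), ([(5, 1),
    (7, 1)], []), ([(6, 1), (7, 1)], []), ([(0, 7), (1, 7)], [(7, 6)])], [([(0, 1), (8, 1)], []),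
    ([(4, 1), (8, 1)], []), ([(6, 1), (8, 1)], []), ([(7, 1), (8, 1)], []), ([(1, 7), (2, 7)],
    [(8, 6)])], [([(0, 1), (9, 1)], []), ([(4, 1), (9, 1)], []), ([(6, 1), (9, 1)], []), ([(7, 1),
    (9, 1)], []), ([(5, 4), (8, 7)], [(9, 5)]), ([(3, 4), (8, 7)], [(9, 5)]), ([(3, 7), (5, 7)],
    [(9, 6)]), ([(2, 4), (9, 7)], [(8, 5)]), ([(1, 4), (9, 7)], [(8, 5)])], [([(2, 1), (10, 1)],
    []), ([(5, 1), (10, 1)], []), ([(6, 1), (10, 1)], []), ([(8, 1), (10, 1)], []), ([(9, 1), (10,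
    1)], []), ([(4, 4), (7, 7)], [(10, 5)]), ([(3, 4), (7, 7)], [(10, 5)]), ([(3, 7), (4, 7)],
    [(10, 6)]), ([(1, 4), (10, 7)], [(7, 5)]), ([(0, 4), (10, 7)], [(7, 5)])], [([(1, 1), (11,
    1)], []), ([(3, 1), (11, 1)], []), ([(7, 1), (11, 1)], []), ([(8, 1), (11, 1)], []), ([(9, 1),
    (11, 1)], []), ([(10, 1), (11, 1)], []), ([(5, 4), (6, 7)], [(11, 5)]), ([(4, 4), (6, 7)],
    [(11, 5)]), ([(4, 7), (5, 7)], [(11, 6)]), ([(2, 4), (11, 7)], [(6, 5)]), ([(0, 4), (11, 7)],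
    [(6, 5)])], [([(3, 1), (12, 1)], []), ([(4, 1), (12, 1)], []), ([(5, 1), (12, 1)], []), ([(9,
    1), (12, 1)], []), ([(10, 1), (12, 1)], []), ([(11, 1), (12, 1)], []), ([(8, 36), (12, 7)],
    []), ([(7, 36), (12, 7)], []), ([(6, 36), (12, 7)], [])], [([(0, 1), (13, 1)], []), ([(1, 1),
    (13, 1)], []), ([(2, 1), (13, 1)], []), ([(6, 1), (13, 1)], []), ([(7, 1), (13, 1)], []),
    ([(8, 1), (13, 1)], []), ([(12, 1), (13, 1)], []), ([(11, 36), (13, 7)], []), ([(10, 36), (13,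
    7)], []), ([(9, 36), (13, 7)], [])], [([(1, 1), (14, 1)], []), ([(2, 1), (14, 1)], []), ([(3,
    1), (14, 1)], []), ([(5, 1), (14, 1)], []), ([(8, 1), (14, 1)], []), ([(9, 1), (14, 1)], []),
    ([(12, 1), (14, 1)], []), ([(13, 1), (14, 1)], []), ([(14, 1)], [(0, 7), (4, 7)]), ([(0, 7),
    (4, 7)], [(14, 1)])], [([(0, 1), (15, 1)], []), ([(2, 1), (15, 1)], []), ([(4, 1), (15, 1)],
    []), ([(5, 1), (15, 1)], []), ([(6, 1), (15, 1)], []), ([(11, 1), (15, 1)], []), ([(12, 1),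
    (15, 1)], []), ([(13, 1), (15, 1)], []), ([(14, 1), (15, 1)], []), ([(15, 1)], [(1, 7), (3,
    7)]), ([(1, 7), (3, 7)], [(15, 1)])], [([(0, 1), (16, 1)], []), ([(1, 1), (16, 1)], []), ([(3,
    1), (16, 1)], []), ([(4, 1), (16, 1)], []), ([(7, 1), (16, 1)], []), ([(10, 1), (16, 1)], []),
    ([(12, 1), (16, 1)], []), ([(13, 1), (16, 1)], []), ([(14, 1), (16, 1)], []), ([(15, 1), (16,
    1)], []), ([(16, 1)], [(2, 7), (5, 7)]), ([(2, 7), (5, 7)], [(16, 1)])], [([(0, 1), (17, 1)],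
    []), ([(4, 1), (17, 1)], []), ([(6, 1), (17, 1)], []), ([(7, 1), (17, 1)], []), ([(10, 1),
    (17, 1)], []), ([(11, 1), (17, 1)], []), ([(12, 1), (17, 1)], []), ([(13, 1), (17, 1)], []),
    ([(14, 1), (17, 1)], []), ([(16, 3), (17, 14)], []), ([(15, 3), (17, 14)], []), ([(8, 3), (9,
    3)], [(17, 4)]), ([(5, 3), (17, 7)], [(9, 9)]), ([(3, 3), (17, 7)], [(9, 9)]), ([(2, 3), (17,
    7)], [(8, 9)]), ([(1, 3), (17, 7)], [(8, 9)])], [([(1, 1), (18, 1)], []), ([(3, 1), (18, 1)],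
    []), ([(7, 1), (18, 1)], []), ([(8, 1), (18, 1)], []), ([(9, 1), (18, 1)], []), ([(10, 1),
    (18, 1)], []), ([(12, 1), (18, 1)], []), ([(13, 1), (18, 1)], []), ([(15, 1), (18, 1)], []),
    ([(17, 1), (18, 1)], []), ([(16, 3), (18, 14)], []), ([(14, 3), (18, 14)], []), ([(6, 3), (11,
    3)], [(18, 4)]), ([(5, 3), (18, 7)], [(11, 9)]), ([(4, 3), (18, 7)], [(11, 9)]), ([(2, 3),
    (18, 7)], [(6, 9)]), ([(0, 3), (18, 7)], [(6, 9)])], [([(2, 1), (19, 1)], []), ([(5, 1), (19,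
    1)], []), ([(6, 1), (19, 1)], []), ([(8, 1), (19, 1)], []), ([(9, 1), (19, 1)], []), ([(11,
    1), (19, 1)], []), ([(12, 1), (19, 1)], []), ([(13, 1), (19, 1)], []), ([(16, 1), (19, 1)],
    []), ([(17, 1), (19, 1)], []), ([(18, 1), (19, 1)], []), ([(15, 3), (19, 14)], []), ([(14, 3),
    (19, 14)], []), ([(7, 3), (10, 3)], [(19, 4)]), ([(4, 3), (19, 7)], [(10, 9)]), ([(3, 3), (19,
    7)], [(10, 9)]), ([(1, 3), (19, 7)], [(7, 9)]), ([(0, 3), (19, 7)], [(7, 9)])]], [[], [([(0,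
    1), (1, 1)], [])], [([(1, 1), (2, 1)], [])], [], [([(0, 1), (4, 1)], []), ([(3, 1), (4, 1)],
    [])], [([(2, 1), (5, 1)], []), ([(3, 1), (5, 1)], [])], [([(0, 1), (6, 1)], []), ([(5, 1), (6,
    1)], []), ([(2, 7), (3, 7)], [(6, 6)])], [([(2, 1), (7, 1)], []), ([(4, 1), (7, 1)], []),
    ([(6, 1), (7, 1)], []), ([(0, 7), (3, 7)], [(7, 6)])], [([(1, 1), (8, 1)], []), ([(3, 1), (8,
    1)], []), ([(6, 1), (8, 1)], []), ([(7, 1), (8, 1)], []), ([(0, 7), (2, 7)], [(8, 6)])],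
    [([(2, 1), (9, 1)], []), ([(4, 1), (9, 1)], []), ([(6, 1), (9, 1)], []), ([(8, 1), (9, 1)],
    []), ([(5, 4), (7, 7)], [(9, 5)]), ([(3, 4), (9, 7)], [(7, 5)]), ([(1, 4), (7, 7)], [(9, 5)]),
    ([(1, 7), (5, 7)], [(9, 6)]), ([(0, 4), (9, 7)], [(7, 5)])], [([(0, 1), (10, 1)], []), ([(5,
    1), (10, 1)], []), ([(7, 1), (10, 1)], []), ([(8, 1), (10, 1)], []), ([(9, 1), (10, 1)], []),
    ([(4, 4), (6, 7)], [(10, 5)]), ([(3, 4), (10, 7)], [(6, 5)]), ([(2, 4), (10, 7)], [(6, 5)]),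
    ([(1, 4), (6, 7)], [(10, 5)]), ([(1, 7), (4, 7)], [(10, 6)])], [([(1, 1), (11, 1)], []), ([(3,
    1), (11, 1)], []), ([(6, 1), (11, 1)], []), ([(7, 1), (11, 1)], []), ([(9, 1), (11, 1)], []),
    ([(10, 1), (11, 1)], []), ([(5, 4), (8, 7)], [(11, 5)]), ([(4, 4), (8, 7)], [(11, 5)]), ([(4,
    7), (5, 7)], [(11, 6)]), ([(2, 4), (11, 7)], [(8, 5)]), ([(0, 4), (11, 7)], [(8, 5)])], [([(0,
    1), (12, 1)], []), ([(2, 1), (12, 1)], []), ([(3, 1), (12, 1)], []), ([(6, 1), (12, 1)], []),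
    ([(7, 1), (12, 1)], []), ([(8, 1), (12, 1)], []), ([(11, 36), (12, 7)], []), ([(10, 36), (12,
    7)], []), ([(9, 36), (12, 7)], [])], [([(1, 1), (13, 1)], []), ([(4, 1), (13, 1)], []), ([(5,
    1), (13, 1)], []), ([(9, 1), (13, 1)], []), ([(10, 1), (13, 1)], []), ([(11, 1), (13, 1)],
    []), ([(12, 1), (13, 1)], []), ([(8, 36), (13, 7)], []), ([(7, 36), (13, 7)], []), ([(6, 36),
    (13, 7)], [])], [([(0, 1), (14, 1)], []), ([(2, 1), (14, 1)], []), ([(4, 1), (14, 1)], []),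
    ([(5, 1), (14, 1)], []), ([(8, 1), (14, 1)], []), ([(11, 1), (14, 1)], []), ([(12, 1), (14,
    1)], []), ([(13, 1), (14, 1)], []), ([(14, 1)], [(1, 7), (3, 7)]), ([(1, 7), (3, 7)], [(14,
    1)])], [([(1, 1), (15, 1)], []), ([(2, 1), (15, 1)], []), ([(3, 1), (15, 1)], []), ([(4, 1),
    (15, 1)], []), ([(6, 1), (15, 1)], []), ([(10, 1), (15, 1)], []), ([(12, 1), (15, 1)], []),
    ([(13, 1), (15, 1)], []), ([(14, 1), (15, 1)], []), ([(15, 1)], [(0, 7), (5, 7)]), ([(0, 7),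
    (5, 7)], [(15, 1)])], [([(0, 1), (16, 1)], []), ([(1, 1), (16, 1)], []), ([(3, 1), (16, 1)],
    []), ([(5, 1), (16, 1)], []), ([(7, 1), (16, 1)], []), ([(9, 1), (16, 1)], []), ([(12, 1),
    (16, 1)], []), ([(13, 1), (16, 1)], []), ([(14, 1), (16, 1)], []), ([(15, 1), (16, 1)], []),
    ([(16, 1)], [(2, 7), (4, 7)]), ([(2, 7), (4, 7)], [(16, 1)])], [([(1, 1), (17, 1)], []), ([(3,
    1), (17, 1)], []), ([(6, 1), (17, 1)], []), ([(7, 1), (17, 1)], []), ([(9, 1), (17, 1)], []),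
    ([(10, 1), (17, 1)], []), ([(12, 1), (17, 1)], []), ([(13, 1), (17, 1)], []), ([(14, 1), (17,
    1)], []), ([(16, 3), (17, 14)], []), ([(15, 3), (17, 14)], []), ([(8, 3), (11, 3)], [(17,
    4)]), ([(5, 3), (17, 7)], [(11, 9)]), ([(4, 3), (17, 7)], [(11, 9)]), ([(2, 3), (17, 7)], [(8,
    9)]), ([(0, 3), (17, 7)], [(8, 9)])], [([(0, 1), (18, 1)], []), ([(5, 1), (18, 1)], []), ([(7,
    1), (18, 1)], []), ([(8, 1), (18, 1)], []), ([(9, 1), (18, 1)], []), ([(11, 1), (18, 1)], []),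
    ([(12, 1), (18, 1)], []), ([(13, 1), (18, 1)], []), ([(15, 1), (18, 1)], []), ([(17, 1), (18,
    1)], []), ([(16, 3), (18, 14)], []), ([(14, 3), (18, 14)], []), ([(6, 3), (10, 3)], [(18,
    4)]), ([(4, 3), (18, 7)], [(10, 9)]), ([(3, 3), (18, 7)], [(6, 9)]), ([(2, 3), (18, 7)], [(6,
    9)]), ([(1, 3), (18, 7)], [(10, 9)])], [([(2, 1), (19, 1)], []), ([(4, 1), (19, 1)], []),
    ([(6, 1), (19, 1)], []), ([(8, 1), (19, 1)], []), ([(10, 1), (19, 1)], []), ([(11, 1), (19,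
    1)], []), ([(12, 1), (19, 1)], []), ([(13, 1), (19, 1)], []), ([(16, 1), (19, 1)], []), ([(17,
    1), (19, 1)], []), ([(18, 1), (19, 1)], []), ([(15, 3), (19, 14)], []), ([(14, 3), (19, 14)],
    []), ([(7, 3), (9, 3)], [(19, 4)]), ([(5, 3), (19, 7)], [(9, 9)]), ([(3, 3), (19, 7)], [(7,
    9)]), ([(1, 3), (19, 7)], [(9, 9)]), ([(0, 3), (19, 7)], [(7, 9)])]], [[], [], [([(0, 1), (2,
    1)], [])], [([(1, 1), (3, 1)], [])], [], [([(4, 1), (5, 1)], [])], [([(1, 2), (6, 1)], []),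
    ([(2, 2), (6, 1)], []), ([(4, 1), (6, 2)], []), ([(5, 1), (6, 2)], []), ([(6, 2)], [(0, 3),
    (3, 3)]), ([(0, 3), (3, 3)], [(6, 2)])], [([(0, 2), (7, 1)], []), ([(3, 2), (7, 1)], []),
    ([(4, 1), (7, 2)], []), ([(5, 1), (7, 2)], []), ([(6, 1), (7, 1)], []), ([(7, 2)], [(1, 3),
    (2, 3)]), ([(1, 3), (2, 3)], [(7, 2)])], [([(2, 2), (8, 1)], []), ([(3, 2), (8, 1)], []),
    ([(4, 1), (8, 2)], []), ([(5, 1), (8, 2)], []), ([(0, 3), (1, 3)], [(8, 2)])], [([(0, 2), (9,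
    1)], []), ([(1, 2), (9, 1)], []), ([(4, 1), (9, 2)], []), ([(5, 1), (9, 2)], []), ([(8, 1),
    (9, 1)], []), ([(2, 3), (3, 3)], [(9, 2)])]], [[], [], [([(0, 4), (1, 14), (2, 9)], [])],
    [([(0, 4), (2, 7), (3, 7)], []), ([(0, 4), (1, 14), (3, 9)], []), ([(1, 1), (2, 1), (3, 1)],
    [])], [([(0, 1), (4, 1)], []), ([(2, 7), (3, 7), (4, 4)], []), ([(1, 14), (3, 9), (4, 4)],
    []), ([(1, 14), (2, 9), (4, 4)], [])]]]

/-- Isotropic forms spanning the cone of a vertex. -/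
def rays : Fin 4 → List Vec :=
  ![[⟨7, 8, 2, -2⟩, ⟨13, 16, 0, -4⟩, ⟨7, 8, -2, -2⟩, ⟨13, 9, 0, -3⟩, ⟨0, 1, 0, 0⟩, ⟨1, 0, 0, 0⟩,
    ⟨11, 11, 2, -3⟩, ⟨8, 7, -2, -2⟩, ⟨9, 13, 0, -3⟩, ⟨16, 13, 0, -4⟩, ⟨8, 7, 2, -2⟩, ⟨11, 11, -2,
    -3⟩], [⟨7, 8, -2, -2⟩, ⟨17, 16, -8, -4⟩, ⟨11, 8, -6, -2⟩, ⟨0, 1, 0, 0⟩, ⟨1, 1, -1, 0⟩, ⟨1, 0,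
    0, 0⟩, ⟨8, 11, -6, -2⟩, ⟨16, 17, -8, -4⟩, ⟨8, 7, -2, -2⟩, ⟨11, 7, -5, -2⟩, ⟨17, 17, -9, -4⟩,
    ⟨7, 11, -5, -2⟩], [⟨13, 9, 0, -3⟩, ⟨7, 2, 1, -1⟩, ⟨13, 4, 0, -2⟩, ⟨7, 2, -1, -1⟩, ⟨1, 0, 0,
    0⟩, ⟨19, 11, -1, -4⟩, ⟨25, 13, 0, -5⟩, ⟨19, 11, 1, -4⟩], [⟨13, 9, 0, -3⟩, ⟨14, 9, -3, -3⟩, ⟨7,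
    2, -1, -1⟩, ⟨1, 0, 0, 0⟩, ⟨19, 11, -1, -4⟩, ⟨8, 7, -2, -2⟩]]

/-- Decompositions of the cone of a vertex into simplicial cones. -/
def cones : Fin 4 → ℕ × List (ℕ × Vec × (ℤ × List (ℕ × ℕ × ℕ)) × (ℤ × List (ℕ × ℕ × ℕ))) :=
  ![(1, [(0, ⟨12, 13, 1, 91⟩, (648, [(0, 72, 1), (12, 1, 3), (6, 36, 11), (20, 216, 7)]), (108,
    [(0, 12, 1), (7, 6, 3), (4, 1, 11), (20, 36, 9)])), (2, ⟨0, 1, 0, 4⟩, (144, [(2, 12, 1), (5,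
    1, 2), (8, 6, 5), (20, 144, 4)]), (864, [(2, 72, 1), (6, 36, 2), (12, 1, 5), (20, 864, 7)])),
    (4, ⟨-12, -13, 1, -91⟩, (108, [(4, 12, 1), (10, 6, 3), (0, 1, 6), (20, 36, 9)]), (648, [(4,
    72, 1), (13, 1, 3), (11, 36, 6), (20, 216, 10)])), (5, ⟨0, 1, 0, 4⟩, (144, [(5, 12, 1), (2, 1,
    0), (9, 6, 5), (20, 144, 4)]), (864, [(5, 72, 1), (11, 36, 0), (13, 1, 5), (20, 864, 10)])),
    (6, ⟨0, 0, 0, 0⟩, (288, [(6, 36, 1), (2, 4, 3), (0, 4, 5), (11, 9, 7)]), (288, [(6, 36, 1),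
    (2, 4, 3), (0, 4, 5), (11, 9, 7)])), (8, ⟨0, 0, 0, 0⟩, (72, [(8, 36, 1), (9, 9, 2), (1, 4, 4),
    (2, 4, 8)]), (72, [(8, 36, 1), (9, 9, 2), (1, 4, 4), (2, 4, 8)])), (9, ⟨0, 0, 0, 0⟩, (72, [(9,
    36, 1), (8, 9, 0), (3, 4, 4), (5, 4, 8)]), (72, [(9, 36, 1), (8, 9, 0), (3, 4, 4), (5, 4,
    8)])), (11, ⟨0, 0, 0, 0⟩, (288, [(11, 36, 1), (5, 4, 3), (4, 4, 5), (6, 9, 10)]), (288, [(11,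
    36, 1), (5, 4, 3), (4, 4, 5), (6, 9, 10)])), (12, ⟨0, 0, 0, 0⟩, (216, [(12, 3, 1), (0, 1, 2),
    (1, 1, 7), (2, 1, 11)]), (216, [(12, 3, 1), (0, 1, 2), (1, 1, 7), (2, 1, 11)])), (13, ⟨0, 0,
    0, 0⟩, (216, [(13, 3, 1), (4, 1, 0), (5, 1, 6), (3, 1, 10)]), (216, [(13, 3, 1), (4, 1, 0),
    (5, 1, 6), (3, 1, 10)]))]), (0, [(1, ⟨8, 4, 5, 39⟩, (648, [(1, 72, 0), (12, 1, 6), (10, 36,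
    7), (20, 216, 10)]), (108, [(1, 12, 0), (9, 6, 6), (3, 1, 7), (20, 36, 11)])), (2, ⟨0, 1, 0,
    4⟩, (864, [(2, 72, 0), (13, 1, 2), (6, 36, 5), (20, 864, 4)]), (144, [(2, 12, 0), (8, 6, 2),
    (4, 1, 5), (20, 144, 9)])), (3, ⟨4, 0, 1, 13⟩, (648, [(3, 72, 0), (6, 36, 3), (13, 1, 6), (20,
    216, 4)]), (108, [(3, 12, 0), (1, 1, 3), (7, 6, 6), (20, 36, 11)])), (4, ⟨0, -1, 0, -4⟩, (144,
    [(4, 12, 0), (2, 1, 1), (11, 6, 2), (20, 144, 9)]), (864, [(4, 72, 0), (10, 36, 1), (12, 1,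
    2), (20, 864, 10)])), (6, ⟨0, 0, 0, 0⟩, (288, [(6, 36, 0), (3, 4, 2), (10, 9, 4), (2, 4, 6)]),
    (288, [(6, 36, 0), (3, 4, 2), (10, 9, 4), (2, 4, 6)])), (8, ⟨0, 0, 0, 0⟩, (72, [(8, 36, 0),
    (11, 9, 5), (2, 4, 8), (0, 4, 9)]), (72, [(8, 36, 0), (11, 9, 5), (2, 4, 8), (0, 4, 9)])),
    (10, ⟨0, 0, 0, 0⟩, (288, [(10, 36, 0), (1, 4, 2), (4, 4, 6), (6, 9, 10)]), (288, [(10, 36, 0),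
    (1, 4, 2), (4, 4, 6), (6, 9, 10)])), (11, ⟨0, 0, 0, 0⟩, (72, [(11, 36, 0), (8, 9, 1), (4, 4,
    8), (5, 4, 9)]), (72, [(11, 36, 0), (8, 9, 1), (4, 4, 8), (5, 4, 9)])), (12, ⟨0, 0, 0, 0⟩,
    (216, [(12, 3, 0), (1, 1, 1), (4, 1, 7), (5, 1, 10)]), (216, [(12, 3, 0), (1, 1, 1), (4, 1,
    7), (5, 1, 10)])), (13, ⟨0, 0, 0, 0⟩, (216, [(13, 3, 0), (2, 1, 3), (0, 1, 4), (3, 1, 5)]),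
    (216, [(13, 3, 0), (2, 1, 3), (0, 1, 4), (3, 1, 5)]))]), (0, [(0, ⟨6, 13, -3, 65⟩, (108, [(0,
    54, 0), (1, 27, 2), (5, 2, 5), (10, 18, 3)]), (108, [(0, 54, 0), (4, 2, 2), (3, 27, 5), (10,
    18, 6)])), (3, ⟨3, 5, -3, 28⟩, (108, [(3, 54, 0), (0, 27, 1), (5, 2, 6), (10, 36, 2)]), (108,
    [(3, 54, 0), (4, 2, 1), (2, 27, 6), (10, 36, 7)])), (5, ⟨-3, -8, 0, -37⟩, (54, [(5, 2, 0), (0,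
    1, 1), (3, 1, 3), (10, 18, 2)]), (54, [(5, 2, 0), (1, 1, 1), (2, 1, 3), (10, 18, 4)]))]), (0,
    [(3, ⟨0, -1, 0, -3⟩, (18, [(3, 3, 0), (1, 1, 1), (4, 1, 3), (5, 18, 2)]), (36, [(3, 6, 0), (0,
    2, 1), (2, 1, 3), (5, 36, 5)])), (4, ⟨0, 0, 0, 0⟩, (18, [(4, 6, 0), (1, 2, 1), (2, 1, 2), (3,
    1, 4)]), (18, [(4, 6, 0), (1, 2, 1), (2, 1, 2), (3, 1, 4)]))])]

/-- The position of a vertex up to complex conjugation. -/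
def half : Fin 8 → Fin 4 := ![0, 1, 2, 3, 0, 1, 2, 3]

/-- Complex conjugation for the second half of the vertices. -/
def reflect (i : Fin 8) (v : Vec) : Vec := if (i : ℕ) < 4 then v else v.conj

/-- An element of the stabiliser of a representative. -/
def stabAt (i : Fin 8) (n : ℕ) : IMat := (stab i).getD n IMat.one

/-- The matrix of an edge in the star of a representative. -/
def starMat (i : Fin 8) (e : Fin 19 × ℕ × Bool) : IMat :=
  if e.2.2 then (stabAt i e.2.1).mul (glue e.1).adj else stabAt i e.2.1

/-- The end of an edge in the star of a representative. -/
def starEnd (i : Fin 8) (e : Fin 19 × ℕ × Bool) : Vec :=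
  if e.2.2 then Vec.act (starMat i e) (rep (edgeEnds e.1).1)
  else Vec.act ((starMat i e).mul (glue e.1)) (rep (edgeEnds e.1).2)

/-- The neighbours of a representative. -/
def nbs (i : Fin 8) : List Vec := (star i).map (starEnd i)

/-- A neighbour of a representative. -/
def nb (i : Fin 8) (s : ℕ) : Vec := (nbs i).getD s (rep i)

/-- The number of corners of a two-cell. -/
def size (t : Fin 11) : ℕ := (corners t).length

/-- A corner of a two-cell. -/
def cornerAt (t : Fin 11) (k : ℕ) : Fin 8 × IMat := (corners t).getD (k % size t) (0, IMat.one)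

/-- A boundary edge of a two-cell. -/
def bdryAt (t : Fin 11) (k : ℕ) : Fin 19 × IMat := (bdry t).getD k (0, IMat.one)

/-- The functional of a corner of a two-cell. -/
def cor (t : Fin 11) (k : ℕ) : Vec := Vec.act (cornerAt t k).2 (rep (cornerAt t k).1)

lemma stab_spec : ∀ i, ∀ h ∈ stab i, h.Unimod ∧ Vec.act h (rep i) = rep i := by decide +kernel

lemma stabAt_spec : ∀ i, ∀ n < (stab i).length, stabAt i n ∈ stab i := by decide +kernel

lemma mem_stab_iff : ∀ i, ∀ h ∈ stab i, ∃ n < (stab i).length, stabAt i n = h := by decide +kernel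

lemma glue_unimod : ∀ o, (glue o).Unimod := by decide +kernel

lemma size_pos : ∀ t, 3 ≤ size t ∧ (bdry t).length = size t := by decide +kernel

lemma corner_unimod : ∀ t, ∀ k < size t, (cornerAt t k).2.Unimod := by decide +kernel

lemma bdry_unimod : ∀ t, ∀ k < size t, (bdryAt t k).2.Unimod := by decide +kernel

lemma star_spec : ∀ i, ∀ e ∈ star i, e.2.1 < (stab i).length ∧
    (if e.2.2 then (edgeEnds e.1).2 else (edgeEnds e.1).1) = i := by decide +kernel

lemma star_complete : ∀ o,
    (∀ h ∈ stab (edgeEnds o).1,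
      Vec.act (h.mul (glue o)) (rep (edgeEnds o).2) ∈ nbs (edgeEnds o).1) ∧
    (∀ h ∈ stab (edgeEnds o).2,
      Vec.act (h.mul (glue o).adj) (rep (edgeEnds o).1) ∈ nbs (edgeEnds o).2) := by decide +kernel

lemma nbs_nodup : ∀ i, (nbs i).Nodup := by decide +kernel

lemma ends_ne : ∀ o, rep (edgeEnds o).1 ≠ Vec.act (glue o) (rep (edgeEnds o).2) := by
  decide +kernel

lemma edge_unique : ∀ o o', ∀ h ∈ stab (edgeEnds o).1,
    ((edgeEnds o).1 = (edgeEnds o').1 → Vec.act (glue o) (rep (edgeEnds o).2) =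
      Vec.act (h.mul (glue o')) (rep (edgeEnds o').2) → o = o') ∧
    ((edgeEnds o).1 = (edgeEnds o').2 → Vec.act (glue o) (rep (edgeEnds o).2) ≠
      Vec.act (h.mul (glue o').adj) (rep (edgeEnds o').1)) := by decide +kernel

lemma links_spec : ∀ i, ∀ l ∈ links i, l.1 < (nbs i).length ∧ l.2.1 < (nbs i).length ∧
    l.1 ≠ l.2.1 ∧ l.2.2.2.1 < size l.2.2.1 ∧ l.2.2.2.2 < (stab i).length ∧
    (cornerAt l.2.2.1 l.2.2.2.1).1 = i ∧
    nb i l.1 = Vec.act ((stabAt i l.2.2.2.2).mul (cornerAt l.2.2.1 l.2.2.2.1).2.adj)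
      (cor l.2.2.1 (l.2.2.2.1 + size l.2.2.1 - 1)) ∧
    nb i l.2.1 = Vec.act ((stabAt i l.2.2.2.2).mul (cornerAt l.2.2.1 l.2.2.2.1).2.adj)
      (cor l.2.2.1 (l.2.2.2.1 + 1)) := by decide +kernel

lemma links_complete : ∀ t, ∀ k < size t, ∀ n < (stab (cornerAt t k).1).length,
    ∃ l ∈ links (cornerAt t k).1, l.2.2 = (t, k, n) := by decide +kernel

lemma bdry_spec : ∀ t, ∀ k < size t,
    (Vec.act (bdryAt t k).2 (rep (edgeEnds (bdryAt t k).1).1) = cor t k ∧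
      Vec.act ((bdryAt t k).2.mul (glue (bdryAt t k).1)) (rep (edgeEnds (bdryAt t k).1).2) =
        cor t (k + 1)) ∨
    (Vec.act (bdryAt t k).2 (rep (edgeEnds (bdryAt t k).1).1) = cor t (k + 1) ∧
      Vec.act ((bdryAt t k).2.mul (glue (bdryAt t k).1)) (rep (edgeEnds (bdryAt t k).1).2) =
        cor t k) := by decide +kernel

lemma cor_ne : ∀ t, ∀ k < size t, ∀ k' < size t, k ≠ k' → cor t k ≠ cor t k' := by
  decide +kernel

/-- A coordinate of a vector. -/
def Vec.coord (v : Vec) : Fin 4 → ℤ := ![v.x, v.y, v.z, v.w]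

/-- A minor of two vectors. -/
def Vec.minor (f g : Fin 4) (u v : Vec) : ℤ := u.coord f * v.coord g - u.coord g * v.coord f

lemma cor_convex : ∀ t, ∀ k < size t, ∀ k' < size t, k ≠ k' → ∃ f g : Fin 4,
    0 < Vec.minor f g ((cor t (k + 1)).sub (cor t k)) ((cor t (k + size t - 1)).sub (cor t k)) ∧
    0 ≤ Vec.minor f g ((cor t k').sub (cor t k)) ((cor t (k + size t - 1)).sub (cor t k)) ∧
    0 ≤ Vec.minor f g ((cor t (k + 1)).sub (cor t k)) ((cor t k').sub (cor t k)) ∧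
    ((cor t k').sub (cor t k)).smul (Vec.minor f g ((cor t (k + 1)).sub (cor t k))
      ((cor t (k + size t - 1)).sub (cor t k))) =
    (((cor t (k + 1)).sub (cor t k)).smul (Vec.minor f g ((cor t k').sub (cor t k))
      ((cor t (k + size t - 1)).sub (cor t k)))).add
    (((cor t (k + size t - 1)).sub (cor t k)).smul
      (Vec.minor f g ((cor t (k + 1)).sub (cor t k)) ((cor t k').sub (cor t k)))) := by
  decide +kernel

end BianchiHomology

namespace BianchiHomology

/-- The difference along an edge of a star. -/
def diff (i : Fin 8) (s : ℕ) : Vec := (nb i s).sub (rep i)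

/-- An integral combination of differences. -/
def comb (i : Fin 8) (l : List (ℕ × ℕ)) : Vec :=
  l.foldr (fun c v => ((diff i c.1).smul c.2).add v) ⟨0, 0, 0, 0⟩

lemma clauses_spec : ∀ i, (clauses (half i)).length = (star i).length ∧
    ∀ g ∈ clauses (half i), ∀ c ∈ g, c.1 ≠ [] ∧ (∀ a ∈ c.1, 0 < a.2) ∧
      ((comb i c.1).sub (comb i c.2)).Psd := by decide +kernel

/-- A set satisfies the hypothesis of a clause. -/
def violates (k : ℕ) (d : List ℕ) (c : List (ℕ × ℕ) × List (ℕ × ℕ)) : Bool :=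
  c.1.all (fun a => d.contains a.1) && c.2.all (fun b => Nat.ble b.1 k && !d.contains b.1)

/-- Check a property for all sets which violate no clause. -/
def search (P : List ℕ → Bool) : List (List (List (ℕ × ℕ) × List (ℕ × ℕ))) → ℕ → List ℕ → Bool
  | [], _, d => P d
  | g :: gs, k, d => (g.any (violates k d) || search P gs (k + 1) d) &&
      (g.any (violates k (k :: d)) || search P gs (k + 1) (k :: d))

lemma search_sound {P : List ℕ → Bool} {D : ℕ → Prop}
    (gs : List (List (List (ℕ × ℕ) × List (ℕ × ℕ))))
    (hgs : ∀ g ∈ gs, ∀ c ∈ g, ¬ ((∀ a ∈ c.1, D a.1) ∧ ∀ b ∈ c.2, ¬ D b.1)) (k : ℕ) (d : List ℕ)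
    (hd : ∀ s, s ∈ d ↔ s < k ∧ D s) (h : search P gs k d = true) :
    ∃ d', P d' = true ∧ ∀ s, s ∈ d' ↔ s < k + gs.length ∧ D s := by
  induction gs generalizing k d with
  | nil => exact ⟨d, h, hd⟩
  | cons g gs ih =>
    rw [search, Bool.and_eq_true, Bool.or_eq_true, Bool.or_eq_true] at h
    have key : ∀ d', (∀ s, s ∈ d' ↔ s < k + 1 ∧ D s) →
        (g.any (violates k d') = true ∨ search P gs (k + 1) d' = true) →
        ∃ d', P d' = true ∧ ∀ s, s ∈ d' ↔ s < k + (g :: gs).length ∧ D s := by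
      intro d' hd' h'
      rcases h' with h' | h'
      · obtain ⟨c, hc, hv⟩ := List.any_eq_true.1 h'
        rw [violates, Bool.and_eq_true, List.all_eq_true, List.all_eq_true] at hv
        refine absurd ⟨fun a ha => ?_, fun b hb => ?_⟩ (hgs g List.mem_cons_self c hc)
        · exact ((hd' _).1 (List.contains_iff_mem.1 (hv.1 a ha))).2
        · have := hv.2 b hb
          rw [Bool.and_eq_true, Nat.ble_eq] at this
          intro hD
          have hm := List.contains_iff_mem.2 ((hd' _).2 ⟨Nat.lt_succ_of_le this.1, hD⟩)
          rw [hm] at this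
          exact absurd this.2 (by decide)
      · have e : k + 1 + gs.length = k + (g :: gs).length := by
          rw [List.length_cons]; omega
        rw [← e]
        exact ih (fun g' hg' => hgs g' (List.mem_cons_of_mem _ hg')) (k + 1) d' hd' h'
    by_cases hk : D k
    · refine key (k :: d) (fun s => ?_) h.2
      rw [List.mem_cons, hd, Nat.lt_succ_iff_lt_or_eq]
      constructor
      · rintro (rfl | h)
        · exact ⟨Or.inr rfl, hk⟩
        · exact ⟨Or.inl h.1, h.2⟩
      · rintro ⟨h | rfl, h'⟩
        · exact Or.inr ⟨h, h'⟩
        · exact Or.inl rfl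
    · refine key d (fun s => ?_) h.1
      rw [hd, Nat.lt_succ_iff_lt_or_eq]
      constructor
      · exact fun h => ⟨Or.inl h.1, h.2⟩
      · rintro ⟨h | rfl, h'⟩
        · exact ⟨h, h'⟩
        · exact absurd h' hk

/-- A corner joins a position to one of a list of positions. -/
def touches {α : Type} (s : ℕ) (r : List ℕ) (l : ℕ × ℕ × α) : Bool :=
  (Nat.beq l.1 s && r.contains l.2.1) || (Nat.beq l.2.1 s && r.contains l.1)

/-- Every element of a list but the last is joined to exactly one later element. -/
def goodOrder {α : Type} (ls : List (ℕ × ℕ × α)) : List ℕ → Bool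
  | [] => true
  | s :: r => (r.isEmpty || Nat.beq (ls.filter (touches s r)).length 1) && goodOrder ls r

/-- A greedy ordering of a set of positions. -/
def grow {α : Type} (ls : List (ℕ × ℕ × α)) : ℕ → List ℕ → List ℕ → List ℕ
  | 0, r, _ => r
  | n + 1, r, todo =>
    match todo.find? (fun s => r.isEmpty || ls.any (touches s r)) with
    | none => r
    | some s => grow ls n (s :: r) (todo.erase s)

/-- A set of positions is empty or spans a tree. -/
def isTree {α : Type} (ls : List (ℕ × ℕ × α)) (d : List ℕ) : Bool :=
  let l := grow ls d.length [] d
  goodOrder ls l && d.all (fun s => l.contains s) && l.all (fun s => d.contains s) &&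
    decide l.Nodup

lemma search_links : ∀ i, search (isTree (links i)) (clauses (half i)) 0 [] = true := by
  decide +kernel

/-- The number of elements of a list after a given element. -/
def depth : List ℕ → ℕ → ℕ
  | [], _ => 0
  | a :: r, s => if s = a then r.length else depth r s

lemma depth_lt {l : List ℕ} {s : ℕ} (hs : s ∈ l) : depth l s < l.length := by
  induction l with
  | nil => exact absurd hs List.not_mem_nil
  | cons a r ih =>
    rw [depth, List.length_cons]
    split
    · exact Nat.lt_succ_self _
    · next h =>
      exact Nat.lt_succ_of_lt (ih ((List.mem_cons.1 hs).resolve_left h))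

lemma depth_inj {l : List ℕ} {s s' : ℕ} (hs : s ∈ l) (hs' : s' ∈ l) (h : depth l s = depth l s') :
    s = s' := by
  induction l with
  | nil => exact absurd hs List.not_mem_nil
  | cons a r ih =>
    rw [depth, depth] at h
    rw [List.mem_cons] at hs hs'
    split at h <;> split at h
    · next h1 h2 => rw [h1, h2]
    · next h1 h2 => exact absurd h (depth_lt (hs'.resolve_left h2)).ne'
    · next h1 h2 => exact absurd h (depth_lt (hs.resolve_left h1)).ne
    · next h1 h2 => exact ih (hs.resolve_left h1) (hs'.resolve_left h2) h

/-- A corner joins two positions. -/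
def Joins {α : Type} (l : ℕ × ℕ × α) (s s' : ℕ) : Prop :=
  (l.1 = s ∧ l.2.1 = s') ∨ (l.2.1 = s ∧ l.1 = s')

lemma touches_iff {α : Type} {s : ℕ} {r : List ℕ} {l : ℕ × ℕ × α} :
    touches s r l = true ↔ ∃ s' ∈ r, Joins l s s' := by
  rw [touches, Bool.or_eq_true, Bool.and_eq_true, Bool.and_eq_true, Nat.beq_eq, Nat.beq_eq,
    List.contains_iff_mem, List.contains_iff_mem]
  constructor
  · rintro (⟨h, h'⟩ | ⟨h, h'⟩)
    · exact ⟨_, h', Or.inl ⟨h, rfl⟩⟩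
    · exact ⟨_, h', Or.inr ⟨h, rfl⟩⟩
  · rintro ⟨s', hs', ⟨h, rfl⟩ | ⟨h, rfl⟩⟩
    · exact Or.inl ⟨h, hs'⟩
    · exact Or.inr ⟨h, hs'⟩

lemma goodOrder_spec {α : Type} {ls : List (ℕ × ℕ × α)} {l : List ℕ} (hl : goodOrder ls l = true)
    (hn : l.Nodup) (hne : l ≠ []) : ∃ ρ ∈ l, ∀ s ∈ l, s ≠ ρ → ∃ x ∈ ls,
      (∃ s' ∈ l, depth l s' < depth l s ∧ Joins x s s') ∧
      ∀ y ∈ ls, (∃ s' ∈ l, depth l s' < depth l s ∧ Joins y s s') → y = x := by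
  induction l with
  | nil => exact absurd rfl hne
  | cons a r ih =>
    rw [goodOrder, Bool.and_eq_true, Bool.or_eq_true, Nat.beq_eq] at hl
    rw [List.nodup_cons] at hn
    have hd : ∀ s ∈ r, depth (a :: r) s = depth r s := fun s hs => by
      rw [depth, if_neg]; rintro rfl; exact hn.1 hs
    have ha : depth (a :: r) a = r.length := by rw [depth, if_pos rfl]
    have hmem : ∀ s ∈ r, ∀ s', (s' ∈ a :: r ∧ depth (a :: r) s' < depth (a :: r) s) ↔
        (s' ∈ r ∧ depth r s' < depth r s) := by
      intro s hs s'
      rw [List.mem_cons]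
      constructor
      · rintro ⟨rfl | h, h'⟩
        · rw [ha, hd s hs] at h'
          exact absurd (depth_lt hs) (by omega)
        · rw [hd s hs, hd s' h] at h'; exact ⟨h, h'⟩
      · rintro ⟨h, h'⟩
        rw [hd s hs, hd s' h]; exact ⟨Or.inr h, h'⟩
    by_cases hr : r = []
    · subst hr
      refine ⟨a, List.mem_cons_self, fun s hs hne => absurd ?_ hne⟩
      exact List.mem_singleton.1 hs
    · obtain ⟨ρ, hρ, h⟩ := ih hl.2 hn.2 hr
      refine ⟨ρ, List.mem_cons_of_mem _ hρ, fun s hs hsρ => ?_⟩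
      rcases List.mem_cons.1 hs with rfl | hs
      · have h1 := hl.1.resolve_left (by rw [List.isEmpty_iff]; exact hr)
        obtain ⟨x, hx⟩ := List.length_eq_one_iff.1 h1
        have hmem' : ∀ y, (y ∈ ls ∧ ∃ s' ∈ r, Joins y s s') ↔ y = x := fun y => by
          rw [← List.mem_singleton, ← hx, List.mem_filter, touches_iff]
        have hlow : ∀ s' ∈ r, depth (s :: r) s' < depth (s :: r) s := fun s' hs' => by
          rw [ha, hd s' hs']; exact depth_lt hs'
        obtain ⟨hx1, s', hs', hx2⟩ := (hmem' x).2 rfl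
        refine ⟨x, hx1, ⟨s', List.mem_cons_of_mem _ hs', hlow s' hs', hx2⟩, ?_⟩
        rintro y hy ⟨s'', hs'', hlt, hj⟩
        refine (hmem' y).1 ⟨hy, s'', (List.mem_cons.1 hs'').resolve_left ?_, hj⟩
        rintro rfl
        exact lt_irrefl _ hlt
      · obtain ⟨x, hx, ⟨s', h1, h2, h3⟩, hu⟩ := h s hs hsρ
        obtain ⟨h4, h5⟩ := (hmem s hs s').2 ⟨h1, h2⟩
        refine ⟨x, hx, ⟨s', h4, h5, h3⟩, ?_⟩
        rintro y hy ⟨s'', g1, g2, g3⟩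
        obtain ⟨g4, g5⟩ := (hmem s hs s'').1 ⟨g1, g2⟩
        exact hu y hy ⟨s'', g4, g5, g3⟩

/-- A set of positions compatible with the clauses is the vertex set of a tree. -/
lemma exists_order (i : Fin 8) {D : ℕ → Prop}
    (hD : ∀ g ∈ clauses (half i), ∀ c ∈ g, ¬ ((∀ a ∈ c.1, D a.1) ∧ ∀ b ∈ c.2, ¬ D b.1)) :
    ∃ l : List ℕ, (∀ s, s ∈ l ↔ s < (nbs i).length ∧ D s) ∧ l.Nodup ∧
      goodOrder (links i) l = true := by
  obtain ⟨d, hd, hs⟩ := search_sound _ hD 0 [] (fun s => by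
    simp only [List.not_mem_nil, Nat.not_lt_zero, false_and]) (search_links i)
  rw [isTree, Bool.and_eq_true, Bool.and_eq_true, Bool.and_eq_true, List.all_eq_true,
    List.all_eq_true, decide_eq_true_iff] at hd
  obtain ⟨⟨⟨h1, h2⟩, h3⟩, h4⟩ := hd
  refine ⟨_, fun s => ?_, h4, h1⟩
  rw [nbs, List.length_map, ← (clauses_spec i).1, ← zero_add (clauses (half i)).length, ← hs]
  exact ⟨fun h => List.contains_iff_mem.1 (h3 s h), fun h => List.contains_iff_mem.1 (h2 s h)⟩

end BianchiHomology

namespace BianchiHomology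

namespace Vec

/-- A nonzero positive semidefinite integral form of rank one. -/
def Cusp (v : Vec) : Prop :=
  0 ≤ v.x ∧ 0 ≤ v.y ∧ v.x * v.y = v.z * v.z + 13 * (v.w * v.w) ∧ v ≠ ⟨0, 0, 0, 0⟩

instance (v : Vec) : Decidable v.Cusp := by unfold Cusp; infer_instance

/-- An integral form as a real form. -/
noncomputable def toPt (v : Vec) : Pt := ⟨v.x, v.y, v.z, v.w⟩

lemma Psd.pair_nonneg {L v : Vec} (hL : L.Psd) (hv : v.Cusp) : 0 ≤ L.pair v := by
  have h := hL.ev_nonneg (p := v.toPt) (by simpa [toPt] using hv.1) (by simpa [toPt] using hv.2.1)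
    (by
      have := hv.2.2.1
      simp only [toPt]
      have h' : (v.x : ℝ) * v.y = v.z * v.z + 13 * (v.w * v.w) := by exact_mod_cast this
      linarith)
  simp only [ev, toPt] at h
  rw [pair]
  exact_mod_cast h

lemma form_form (m n : IMat) (v : Vec) : form m (form n v) = form (m.mul n) v := by
  ext
  all_goals
    change pair (pull _ m) (form n v) = pair (pull _ (m.mul n)) v
    rw [← pull_pull]
    exact (pair_pull _ n v).symm

lemma form_one (v : Vec) : form IMat.one v = v := by
  ext <;> simp only [form, pull_one, pair] <;> ring

lemma form_zero (m : IMat) : form m ⟨0, 0, 0, 0⟩ = ⟨0, 0, 0, 0⟩ := by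
  simp [form, pair]

lemma Cusp.form {v : Vec} (hv : v.Cusp) {m : IMat} (hm : m.Unimod) : (form m v).Cusp := by
  refine ⟨?_, ?_, ?_, ?_⟩
  · exact Psd.pair_nonneg (Psd.pull (by decide) hm) hv
  · exact Psd.pair_nonneg (Psd.pull (by decide) hm) hv
  · obtain ⟨h1, h2⟩ := hm
    have h3 := hv.2.2.1
    obtain ⟨a, a', b, b', c, c', d, d'⟩ := m
    simp only at h1 h2
    have key : (Vec.form ⟨a, a', b, b', c, c', d, d'⟩ v).x *
        (Vec.form ⟨a, a', b, b', c, c', d, d'⟩ v).y -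
        ((Vec.form ⟨a, a', b, b', c, c', d, d'⟩ v).z * (Vec.form ⟨a, a', b, b', c, c', d, d'⟩ v).z +
        13 * ((Vec.form ⟨a, a', b, b', c, c', d, d'⟩ v).w *
          (Vec.form ⟨a, a', b, b', c, c', d, d'⟩ v).w)) =
        (v.x * v.y - (v.z * v.z + 13 * (v.w * v.w))) *
        ((a * d - 13 * (a' * d') - (b * c - 13 * (b' * c'))) ^ 2 +
          13 * (a * d' + a' * d - (b * c' + b' * c)) ^ 2) := by
      simp only [Vec.form, pair, pull]; ring
    rw [h3, sub_self, zero_mul] at key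
    linarith
  · intro h0
    apply hv.2.2.2
    rw [← form_one v, ← IMat.adj_mul hm, ← form_form, h0, form_zero]

lemma pair_square (L v : Vec) (hv : v.x * v.y = v.z * v.z + 13 * (v.w * v.w)) :
    52 * (L.x * (L.pair v * v.y)) = 13 * (2 * (L.x * v.z) + L.z * v.y) ^ 2 +
      (26 * (L.x * v.w) + L.w * v.y) ^ 2 + L.disc * (v.y * v.y) := by
  simp only [pair, disc]
  linear_combination 52 * L.x ^ 2 * hv

lemma pair_pos {L v : Vec} (hx : 0 < L.x) (hd : 0 < L.disc) (hv : v.Cusp) : 0 < L.pair v := by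
  obtain ⟨h1, h2, h3, h4⟩ := hv
  rcases h2.eq_or_lt with h2 | h2
  · rw [← h2, mul_zero] at h3
    have hz : v.z = 0 := by nlinarith [mul_self_nonneg v.z, mul_self_nonneg v.w]
    have hw : v.w = 0 := by nlinarith [mul_self_nonneg v.z, mul_self_nonneg v.w]
    have hx' : v.x ≠ 0 := fun h => h4 (by ext <;> simp [h, hz, hw, ← h2])
    rw [pair, ← h2, hz, hw]
    have := mul_pos hx (lt_of_le_of_ne h1 hx'.symm)
    linarith
  · have h := pair_square L v h3
    have h5 : 0 < L.x * (L.pair v * v.y) := by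
      have := mul_pos hd (mul_pos h2 h2)
      nlinarith [sq_nonneg (2 * (L.x * v.z) + L.z * v.y), sq_nonneg (26 * (L.x * v.w) + L.w * v.y)]
    exact pos_of_mul_pos_left (pos_of_mul_pos_right h5 hx.le) h2.le

end Vec

lemma rep_pos : ∀ i, 0 < (rep i).x ∧ 0 < (rep i).disc ∧ (rep i).Psd := by decide +kernel

lemma small_pair : ∀ B : Fin 9, ∀ c ∈ Finset.Icc (-4 : ℤ) 3, ∀ d ∈ Finset.Icc (-3 : ℤ) 3,
    ∀ l ∈ Finset.Icc (1 : ℤ) 2, ∀ k ∈ [(27 : ℤ), -27], (3 : ℤ) ∣ l - 5 * B - c - k * d →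
      (l - 5 * B - c - k * d) * B = 3 * (c * c + 13 * (d * d)) → B = 0 := by decide +kernel

lemma pair_ne_small {w : ℤ} (hw : w ∈ [(27 : ℤ), -27]) {v : Vec} (hv : v.Cusp) :
    3 ≤ Vec.pair ⟨3, 5, 1, w⟩ v := by
  have hw2 : w * w = 729 := by
    simp only [List.mem_cons, List.not_mem_nil, or_false] at hw
    rcases hw with rfl | rfl <;> norm_num
  have hd : Vec.disc ⟨3, 5, 1, w⟩ = 38 := by rw [Vec.disc]; linarith
  have hpos := Vec.pair_pos (L := ⟨3, 5, 1, w⟩) (by norm_num) (by rw [hd]; norm_num) hv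
  by_contra! hlt
  have hsq := Vec.pair_square ⟨3, 5, 1, w⟩ v hv.2.2.1
  rw [hd] at hsq
  set l := Vec.pair ⟨3, 5, 1, w⟩ v with hl
  obtain ⟨h1, h2, h3, h4⟩ := hv
  simp only [Vec.pair] at hl
  rcases h2.eq_or_lt with h2 | h2
  · rw [← h2, mul_zero] at h3
    have hz : v.z = 0 := by nlinarith [mul_self_nonneg v.z, mul_self_nonneg v.w]
    have hw : v.w = 0 := by nlinarith [mul_self_nonneg v.z, mul_self_nonneg v.w]
    rw [← h2, hz, hw] at hl
    omega
  · simp only at hsq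
    have hlB : l * v.y ≤ 2 * v.y := mul_le_mul_of_nonneg_right (by omega) h2.le
    have hB : v.y ≤ 8 := by
      nlinarith [sq_nonneg (2 * (3 * v.z) + 1 * v.y), sq_nonneg (26 * (3 * v.w) + w * v.y)]
    have hc : (6 * v.z + v.y) ^ 2 ≤ 14 ^ 2 := by
      nlinarith [sq_nonneg (26 * (3 * v.w) + w * v.y), mul_self_nonneg v.y]
    have hd' : (78 * v.w + w * v.y) ^ 2 ≤ 50 ^ 2 := by
      nlinarith [sq_nonneg (2 * (3 * v.z) + 1 * v.y), mul_self_nonneg v.y]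
    obtain ⟨hc1, hc2⟩ := abs_le_of_sq_le_sq' hc (by norm_num)
    obtain ⟨hd1, hd2⟩ := abs_le_of_sq_le_sq' hd' (by norm_num)
    have hdr : -3 ≤ v.w ∧ v.w ≤ 3 := by
      simp only [List.mem_cons, List.not_mem_nil, or_false] at hw
      rcases hw with rfl | rfl <;> constructor <;> omega
    have := small_pair ⟨v.y.toNat, by omega⟩ v.z (Finset.mem_Icc.2 ⟨by omega, by omega⟩) v.w
      (Finset.mem_Icc.2 hdr) l (Finset.mem_Icc.2 ⟨by omega, by omega⟩) w hw
    have hy : ((v.y.toNat : ℕ) : ℤ) = v.y := Int.toNat_of_nonneg h2.le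
    simp only [hy] at this
    have h := congrArg Fin.val (this ⟨v.x, by linarith⟩ (by
      rw [← h3]; linear_combination (v.y) * hl))
    simp only [Fin.val_zero] at h
    omega

lemma rep_pair_ge (j : Fin 8) {v : Vec} (hv : v.Cusp) : 3 ≤ (rep j).pair v := by
  have hpos := Vec.pair_pos (rep_pos j).1 (rep_pos j).2.1 hv
  have key : ∀ j, (rep j = ⟨3, 5, 1, 27⟩ ∨ rep j = ⟨3, 5, 1, -27⟩) ∨
      ((3 : ℤ) ∣ (rep j).x ∧ (3 : ℤ) ∣ (rep j).y ∧ (3 : ℤ) ∣ (rep j).z ∧ (3 : ℤ) ∣ (rep j).w) := by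
    decide +kernel
  rcases key j with (h | h) | ⟨h1, h2, h3, h4⟩
  · rw [h]; exact pair_ne_small (by simp) hv
  · rw [h]; exact pair_ne_small (by simp) hv
  · refine Int.le_of_dvd hpos ?_
    rw [Vec.pair]
    exact dvd_add (dvd_add (dvd_add (h1.mul_right _) (h2.mul_right _)) (h3.mul_right _))
      (h4.mul_right _)

/-- The functional of a term in the decomposition of a cone. -/
def coneFun (i : Fin 8) (v : Vec) (f : ℕ) (N : Vec) (s : ℕ) : Vec :=
  if s = f then diff i f else if s = (star i).length then N
  else ((diff i s).smul ((diff i f).pair v)).sub ((diff i f).smul ((diff i s).pair v))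

/-- A ray of the cone of a vertex. -/
def ray (i : Fin 8) (n : ℕ) : Vec := reflect i ((rays (half i)).getD n ⟨0, 0, 0, 0⟩)

/-- A column of a sum of rank one endomorphisms. -/
def column (i : Fin 8) (F : ℕ → Vec) (l : List (ℕ × ℕ × ℕ)) (j : Fin 4) : Vec :=
  l.foldr (fun a u => ((F a.1).smul (a.2.1 * (ray i a.2.2).coord j)).add u) ⟨0, 0, 0, 0⟩

lemma column_nonneg (i : Fin 8) {F : ℕ → Vec} {l : List (ℕ × ℕ × ℕ)} {p : Pt} {M : Vec}
    (hF : ∀ a ∈ l, 0 ≤ (F a.1).ev p) (hM : ∀ a ∈ l, 0 ≤ M.pair (ray i a.2.2)) :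
    0 ≤ M.x * (column i F l 0).ev p + M.y * (column i F l 1).ev p +
      M.z * (column i F l 2).ev p + M.w * (column i F l 3).ev p := by
  induction l with
  | nil => simp [column, Vec.ev]
  | cons a l ih =>
    have h := ih (fun b hb => hF b (List.mem_cons_of_mem _ hb))
      (fun b hb => hM b (List.mem_cons_of_mem _ hb))
    have h1 := hF a List.mem_cons_self
    have h2 : (0 : ℝ) ≤ M.pair (ray i a.2.2) := by exact_mod_cast hM a List.mem_cons_self
    have h3 : 0 ≤ (a.2.1 : ℝ) * ((M.pair (ray i a.2.2) : ℝ) * (F a.1).ev p) := by positivity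
    have e : ∀ j, (column i F (a :: l) j).ev p =
        a.2.1 * (ray i a.2.2).coord j * (F a.1).ev p + (column i F l j).ev p := by
      intro j
      change ((((F a.1).smul (a.2.1 * (ray i a.2.2).coord j)).add (column i F l j)).ev p) = _
      rw [Vec.ev_add, Vec.ev_smul]
      push_cast
      ring
    rw [e, e, e, e]
    simp only [Vec.pair, Vec.coord] at h3 ⊢
    push_cast at h3
    simp only [Matrix.cons_val] at h3 ⊢
    linarith

/-- A list of terms gives a multiple of the identity. -/
def Decomposes (i : Fin 8) (F : ℕ → Vec) (D : ℤ) (l : List (ℕ × ℕ × ℕ)) : Prop :=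
  0 < D ∧ column i F l 0 = ⟨D, 0, 0, 0⟩ ∧ column i F l 1 = ⟨0, D, 0, 0⟩ ∧
    column i F l 2 = ⟨0, 0, D, 0⟩ ∧ column i F l 3 = ⟨0, 0, 0, D⟩

instance (i : Fin 8) (F : ℕ → Vec) (D : ℤ) (l : List (ℕ × ℕ × ℕ)) :
    Decidable (Decomposes i F D l) := by unfold Decomposes; infer_instance

lemma Decomposes.nonneg {i : Fin 8} {F : ℕ → Vec} {D : ℤ} {l : List (ℕ × ℕ × ℕ)}
    (h : Decomposes i F D l) {p : Pt} {M : Vec}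
    (hF : ∀ a ∈ l, 0 ≤ (F a.1).ev p) (hM : ∀ a ∈ l, 0 ≤ M.pair (ray i a.2.2)) : 0 ≤ M.ev p := by
  have := column_nonneg i hF hM
  obtain ⟨hD, h0, h1, h2, h3⟩ := h
  rw [h0, h1, h2, h3] at this
  simp only [Vec.ev, Int.cast_zero, zero_mul, add_zero, zero_add] at this
  have hD' : (0 : ℝ) < D := by exact_mod_cast hD
  have e : (M.x * (D * p.x) + M.y * (D * p.y) + M.z * (D * p.z) + M.w * (D * p.w) : ℝ) =
      D * M.ev p := by rw [Vec.ev]; ring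
  rw [e] at this
  exact nonneg_of_mul_nonneg_right this hD'

/-- The apex ray used in the decomposition of the cone of a vertex. -/
def apex (i : Fin 8) : Vec := ray i (cones (half i)).1

lemma cones_spec : ∀ i, (cones (half i)).2 ≠ [] ∧ ∀ e ∈ (cones (half i)).2,
    (e.1 < (nbs i).length ∧ 0 < (diff i e.1).pair (apex i)) ∧
    (∀ u ∈ [(reflect i e.2.1, e.2.2.1), ((reflect i e.2.1).smul (-1), e.2.2.2)],
      Decomposes i (coneFun i (apex i) e.1 u.1) u.2.1 u.2.2 ∧
      ∀ a ∈ u.2.2, ((a.1 = e.1 ∨ a.1 = (star i).length) ∨ a.1 < (nbs i).length ∧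
        ((diff i a.1).pair (apex i) = 0 ∨ a.1 ∈ (cones (half i)).2.map (·.1))) ∧
        (ray i a.2.2).Cusp ∧ (rep i).pair (ray i a.2.2) = 3) := by decide +kernel

theorem rep_minimal (i : Fin 8) {p : Pt} (hp : ∀ s < (nbs i).length, 0 ≤ (diff i s).ev p)
    (j : Fin 8) {m : IMat} (hm : m.Unimod) : (rep i).ev p ≤ (Vec.act m (rep j)).ev p := by
  obtain ⟨hne, hall⟩ := cones_spec i
  set l := (cones (half i)).2 with hl
  have hne' : (l.map (·.1)).toFinset.Nonempty := by
    rw [List.toFinset_nonempty_iff]; simpa using hne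
  obtain ⟨f, hf, hmin⟩ := Finset.exists_min_image (l.map (·.1)).toFinset
    (fun s => (diff i s).ev p / ((diff i s).pair (apex i) : ℝ)) hne'
  rw [List.mem_toFinset, List.mem_map] at hf
  obtain ⟨e, he, rfl⟩ := hf
  obtain ⟨⟨hflt, hfpos⟩, hdec⟩ := hall e he
  have hfpos' : (0 : ℝ) < (diff i e.1).pair (apex i) := by exact_mod_cast hfpos
  have key : ∀ u ∈ [(reflect i e.2.1, e.2.2.1), ((reflect i e.2.1).smul (-1), e.2.2.2)],
      0 ≤ u.1.ev p → 0 ≤ ((Vec.act m (rep j)).sub (rep i)).ev p := by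
    intro u hu hN
    obtain ⟨hD, hterms⟩ := hdec u hu
    refine hD.nonneg (fun a ha => ?_) (fun a ha => ?_)
    · obtain ⟨h1, -, -⟩ := hterms a ha
      rw [coneFun]
      split_ifs with hc1 hc2
      · exact hp _ hflt
      · exact hN
      · rw [Vec.ev_sub, Vec.ev_smul, Vec.ev_smul]
        rcases h1 with (h1 | h1) | ⟨hlt, h1 | h1⟩
        · exact absurd h1 hc1
        · exact absurd h1 hc2
        · rw [h1, Int.cast_zero, zero_mul, sub_zero]
          exact mul_nonneg hfpos'.le (hp _ hlt)
        · have hmm := hmin a.1 (List.mem_toFinset.2 h1)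
          obtain ⟨e', he', h'⟩ := List.mem_map.1 h1
          have hpos := (hall e' he').1.2
          rw [h'] at hpos
          have hpos' : (0 : ℝ) < (diff i a.1).pair (apex i) := by exact_mod_cast hpos
          rw [div_le_div_iff₀ hfpos' hpos'] at hmm
          linarith
    · obtain ⟨-, h1, h2⟩ := hterms a ha
      have h3 : 3 ≤ (Vec.act m (rep j)).pair (ray i a.2.2) := by
        rw [Vec.act, Vec.pair_pull]
        exact rep_pair_ge j (h1.form hm.adj)
      have e1 : ((Vec.act m (rep j)).sub (rep i)).pair (ray i a.2.2) =
          (Vec.act m (rep j)).pair (ray i a.2.2) - (rep i).pair (ray i a.2.2) := by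
        simp only [Vec.pair, Vec.sub]; ring
      rw [e1, h2]; omega
  have : 0 ≤ ((Vec.act m (rep j)).sub (rep i)).ev p := by
    rcases le_total 0 ((reflect i e.2.1).ev p) with h | h
    · exact key _ List.mem_cons_self h
    · refine key _ (List.mem_cons_of_mem _ List.mem_cons_self) ?_
      rw [Vec.ev_smul]; push_cast; linarith
  rw [Vec.ev_sub] at this
  linarith

end BianchiHomology

namespace BianchiHomology

/-- The value of a functional on the rank one form of a column. -/
def Vec.rankOne (L : Vec) (a a' c c' : ℤ) : ℤ :=
  L.x * (a * a + 13 * (a' * a')) + L.y * (c * c + 13 * (c' * c')) +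
    L.z * (a * c + 13 * (a' * c')) + L.w * (a' * c - a * c')

/-- The integers of absolute value at most `n`. -/
def ballZ (n : ℕ) : List ℤ := (List.range (2 * n + 1)).map (fun k : ℕ => (k : ℤ) - n)

lemma mem_ballZ {n : ℕ} {k : ℤ} : k ∈ ballZ n ↔ -n ≤ k ∧ k ≤ n := by
  simp only [ballZ, List.mem_map, List.mem_range]
  constructor
  · rintro ⟨m, hm, rfl⟩; omega
  · rintro ⟨h1, h2⟩; exact ⟨(k + n).toNat, by omega, by omega⟩

/-- The columns on which a representative takes a value at most six. -/
def short (i : Fin 8) : List (ℤ × ℤ × ℤ × ℤ) :=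
  ((ballZ 7).product ((ballZ 2).product ((ballZ 5).product (ballZ 1)))).filter
    (fun y => (rep i).rankOne y.1 y.2.1 y.2.2.1 y.2.2.2 ≤ 6)

lemma short_pairs : ∀ i, ∀ y ∈ short i, ∀ z ∈ short i,
    IMat.Unimod ⟨y.1, y.2.1, z.1, z.2.1, y.2.2.1, y.2.2.2, z.2.2.1, z.2.2.2⟩ →
    ∀ j, (rep i).pull ⟨y.1, y.2.1, z.1, z.2.1, y.2.2.1, y.2.2.2, z.2.2.1, z.2.2.2⟩ = rep j →
    i = j ∧ ∃ h ∈ stab i,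
      h = IMat.adj ⟨y.1, y.2.1, z.1, z.2.1, y.2.2.1, y.2.2.2, z.2.2.1, z.2.2.2⟩ ∨
      h.neg = IMat.adj ⟨y.1, y.2.1, z.1, z.2.1, y.2.2.1, y.2.2.2, z.2.2.1, z.2.2.2⟩ := by
  decide +kernel

lemma rep_bounds : ∀ i, 0 ≤ (rep i).x ∧ 0 ≤ (rep i).y ∧ (rep i).x ≤ 6 ∧ (rep i).y ≤ 6 ∧
    312 * (rep i).x < 36 * (rep i).disc ∧ 312 * (rep i).y < 53 * (rep i).disc := by decide +kernel

lemma Vec.rankOne_bound {L : Vec} (hx : 0 ≤ L.x) (hd : 0 < L.disc) {a a' c c' n k : ℤ}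
    (h : L.rankOne a a' c c' ≤ k) (hb : 52 * k * L.x < n * L.disc) :
    c * c + 13 * (c' * c') < n := by
  have e1 := Vec.complete_square L.x L.y L.z L.w a a' c c'
  change 52 * (L.x * L.rankOne a a' c c') = _ + L.disc * _ at e1
  by_contra! hc
  have h1 := mul_le_mul_of_nonneg_left h hx
  have h2 := mul_le_mul_of_nonneg_left hc hd.le
  linarith [sq_nonneg (2 * (L.x * a) + L.z * c - L.w * c'),
    sq_nonneg (26 * (L.x * a') + 13 * (L.z * c') + L.w * c)]

lemma mem_short {i : Fin 8} {a a' c c' : ℤ} (h : (rep i).rankOne a a' c c' ≤ 6) :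
    (a, a', c, c') ∈ short i := by
  obtain ⟨hx, hy, -, -, h1, h2⟩ := rep_bounds i
  have b1 := Vec.rankOne_bound hx (rep_pos i).2.1 h (n := 36) (by linarith)
  have b2 := Vec.rankOne_bound (L := ⟨(rep i).y, (rep i).x, (rep i).z, -(rep i).w⟩) (a := c)
    (a' := c') (c := a) (c' := a') (k := 6) (n := 53) hy
    (by have := (rep_pos i).2.1; rw [Vec.disc] at this ⊢; linarith)
    (by rw [Vec.rankOne] at h ⊢; linarith) (by rw [Vec.disc] at h2 ⊢; linarith)
  have n1 := mul_self_nonneg a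
  have n2 := mul_self_nonneg a'
  have n3 := mul_self_nonneg c
  have n4 := mul_self_nonneg c'
  rw [short, List.mem_filter]
  refine ⟨?_, by simpa using h⟩
  simp only [List.product, List.mem_flatMap, List.mem_map, mem_ballZ]
  refine ⟨a, ⟨?_, ?_⟩, _, ⟨a', ⟨?_, ?_⟩, _, ⟨c, ⟨?_, ?_⟩, c', ⟨?_, ?_⟩, rfl⟩, rfl⟩, rfl⟩ <;>
    push_cast <;> nlinarith

theorem transporter {i j : Fin 8} {m : IMat} (hm : m.Unimod) (h : Vec.act m (rep i) = rep j) :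
    i = j ∧ ∃ s ∈ stab i, s = m ∨ s.neg = m := by
  have hy : (m.adj.a, m.adj.a', m.adj.c, m.adj.c') ∈ short i := by
    refine mem_short (le_of_eq_of_le (congrArg Vec.x h) (rep_bounds j).2.2.1)
  have hz : (m.adj.b, m.adj.b', m.adj.d, m.adj.d') ∈ short i := by
    refine mem_short (le_of_eq_of_le (congrArg Vec.y h) (rep_bounds j).2.2.2.1)
  have := short_pairs i _ hy _ hz hm.adj j h
  exact IMat.adj_adj m ▸ this

end BianchiHomology

namespace BianchiHomology

/-- A real form in general position, with a height counting smaller values. -/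
structure Generic where
  /-- The form. -/
  p : Pt
  /-- The height. -/
  ht : Vec → ℕ
  inj : ∀ L M : Vec, L.ev p = M.ev p → L = M
  ht_lt_iff : ∀ L M : Vec, L.Psd → (ht L < ht M ↔ L.ev p < M.ev p)
  psd : ∀ L : Vec, L.Psd → 0 ≤ L.ev p

lemma finite_sublevel {p : Pt} (hp : ∀ L : Vec, L.Psd → (L.x : ℝ) + L.y ≤ L.ev p) (c : ℝ) :
    {L : Vec | L.Psd ∧ L.ev p < c}.Finite := by
  set n : ℤ := ⌈c⌉ with hn
  have hfin : ((Set.Icc (0 : ℤ) n ×ˢ Set.Icc (0 : ℤ) n) ×ˢ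
      (Set.Icc (-(52 * n * n)) (52 * n * n) ×ˢ Set.Icc (-(52 * n * n)) (52 * n * n))).Finite :=
    ((Set.finite_Icc _ _).prod (Set.finite_Icc _ _)).prod
      ((Set.finite_Icc _ _).prod (Set.finite_Icc _ _))
  refine (hfin.image (fun q => (⟨q.1.1, q.1.2, q.2.1, q.2.2⟩ : Vec))).subset ?_
  rintro L ⟨hL, hc⟩
  have h1 := (hp L hL).trans hc.le
  have h2 : L.x + L.y ≤ n := by
    have := h1.trans (Int.le_ceil c)
    exact_mod_cast this
  obtain ⟨hx, hy, hd⟩ := hL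
  rw [Vec.disc] at hd
  have hxy : L.x * L.y ≤ n * n := mul_le_mul (by omega) (by omega) hy (by omega)
  have bound : ∀ z : ℤ, z * z ≤ 52 * n * n → -(52 * n * n) ≤ z ∧ z ≤ 52 * n * n := by
    intro z hz
    have h3 : |z| ≤ z * z := by
      rw [← abs_mul_abs_self]
      rcases (abs_nonneg z).eq_or_lt with h | h
      · rw [← h]; norm_num
      · nlinarith
    exact abs_le.1 (h3.trans hz)
  exact ⟨((L.x, L.y), (L.z, L.w)), ⟨⟨⟨hx, le_of_add_le_of_nonneg_left h2 hy⟩, ⟨hy, le_of_add_le_of_nonneg_right h2 hx⟩⟩,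
    ⟨bound _ (by nlinarith [mul_self_nonneg L.z, mul_self_nonneg L.w]),
      bound _ (by nlinarith [mul_self_nonneg L.z, mul_self_nonneg L.w])⟩⟩, rfl⟩

lemma cubic_eq_zero {x : ℝ} (hx : Transcendental ℤ x) {a b c d : ℤ}
    (h : a * x ^ 3 + b * x ^ 2 + c * x + d = 0) : a = 0 ∧ b = 0 ∧ c = 0 ∧ d = 0 := by
  have h0 : Polynomial.C a * Polynomial.X ^ 3 + Polynomial.C b * Polynomial.X ^ 2 +
      Polynomial.C c * Polynomial.X + Polynomial.C d = 0 := by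
    refine (transcendental_iff.1 hx) _ ?_
    rw [map_add, map_add, map_add, map_mul, map_mul, map_mul, map_pow, map_pow, Polynomial.aeval_X,
      Polynomial.aeval_C, Polynomial.aeval_C, Polynomial.aeval_C, Polynomial.aeval_C]
    exact h
  have hc := fun n => congrArg (fun q => Polynomial.coeff q n) h0
  refine ⟨?_, ?_, ?_, ?_⟩
  · simpa only [Polynomial.coeff_add, Polynomial.coeff_C_mul, Polynomial.coeff_X_pow,
      Polynomial.coeff_X, Polynomial.coeff_C, Polynomial.coeff_zero, OfNat.ofNat_ne_zero,
      Nat.reduceEqDiff, if_true, if_false, mul_one, mul_zero, add_zero] using hc 3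
  · simpa only [Polynomial.coeff_add, Polynomial.coeff_C_mul, Polynomial.coeff_X_pow,
      Polynomial.coeff_X, Polynomial.coeff_C, Polynomial.coeff_zero, OfNat.ofNat_ne_zero,
      Nat.reduceEqDiff, if_true, if_false, mul_one, mul_zero, add_zero, zero_add] using hc 2
  · simpa only [Polynomial.coeff_add, Polynomial.coeff_C_mul, Polynomial.coeff_X_pow,
      Polynomial.coeff_X, Polynomial.coeff_C, Polynomial.coeff_zero, OfNat.one_ne_ofNat,
      one_ne_zero, if_true, if_false, mul_one, mul_zero, add_zero, zero_add] using hc 1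
  · simpa [Polynomial.coeff_X] using hc 0

theorem exists_generic : Nonempty Generic := by
  obtain ⟨x, hx, h3⟩ := ((Algebraic.countable ℤ ℝ).dense_compl ℝ).exists_gt 3
  have hx : Transcendental ℤ x := hx
  have h9 : 9 ≤ x ^ 2 := by nlinarith
  have h27 : 27 ≤ x ^ 3 := by nlinarith
  let p : Pt := ⟨x ^ 3, x ^ 2, x, 1⟩
  have hpos : ∀ L : Vec, L.Psd → (L.x : ℝ) + L.y ≤ L.ev p := by
    intro L hL
    have := hL.ev_nonneg (p := ⟨x ^ 3 - 1, x ^ 2 - 1, x, 1⟩) (by simp only; linarith)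
      (by simp only; linarith) (by simp only; nlinarith)
    simp only [Vec.ev, p] at this ⊢
    linarith
  have hfin := finite_sublevel hpos
  have hcast : ∀ {L M : Vec}, L.ev p ≤ M.ev p →
      {N : Vec | N.Psd ∧ N.ev p < L.ev p} ⊆ {N : Vec | N.Psd ∧ N.ev p < M.ev p} :=
    fun h N hN => ⟨hN.1, hN.2.trans_le h⟩
  refine ⟨⟨p, fun L => {N : Vec | N.Psd ∧ N.ev p < L.ev p}.ncard, ?_, ?_, ?_⟩⟩
  · intro L M h
    simp only [Vec.ev, p] at h
    obtain ⟨h1, h2, h3, h4⟩ := cubic_eq_zero hx (a := L.x - M.x) (b := L.y - M.y)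
      (c := L.z - M.z) (d := L.w - M.w) (by push_cast; linarith)
    ext <;> omega
  · intro L M hL
    constructor
    · intro h
      by_contra! h'
      exact absurd h (not_lt.2 (Set.ncard_le_ncard (hcast h') (hfin _)))
    · intro h
      refine Set.ncard_lt_ncard ((Set.ssubset_iff_of_subset (hcast h.le)).2 ⟨L, ⟨hL, h⟩, ?_⟩)
        (hfin _)
      exact fun h' => lt_irrefl _ h'.2
  · intro L hL
    have h1 : (0 : ℝ) ≤ L.x := by exact_mod_cast hL.1
    have h2 : (0 : ℝ) ≤ L.y := by exact_mod_cast hL.2.1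
    linarith [hpos L hL]

end BianchiHomology

namespace BianchiHomology

/-- A group whose elements are the matrices of determinant one over `ℤ[√-13]` up to sign. -/
structure Param (G : Type) [Group G] where
  /-- The element given by a matrix. -/
  gm : IMat → G
  gm_mul : ∀ {m n : IMat}, m.Unimod → n.Unimod → gm (m.mul n) = gm m * gm n
  gm_eq : ∀ {m n : IMat}, m.Unimod → n.Unimod → gm m = gm n → m = n ∨ m = n.neg
  gm_neg : ∀ {m : IMat}, m.Unimod → gm m.neg = gm m
  surj : ∀ g, ∃ m : IMat, m.Unimod ∧ gm m = g

namespace Param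

variable {G : Type} [Group G] (P : Param G)

/-- The action of the group on functionals. -/
noncomputable def sm (g : G) (L : Vec) : Vec := Vec.act (P.surj g).choose L

lemma gm_one : P.gm IMat.one = 1 := by
  have h := P.gm_mul IMat.unimod_one IMat.unimod_one
  rw [IMat.mul_one] at h
  exact left_eq_mul.1 h

lemma gm_adj {m : IMat} (hm : m.Unimod) : P.gm m.adj = (P.gm m)⁻¹ := by
  rw [eq_inv_iff_mul_eq_one, ← P.gm_mul hm.adj hm, IMat.adj_mul hm, gm_one]

lemma sm_gm {m : IMat} (hm : m.Unimod) (L : Vec) : P.sm (P.gm m) L = Vec.act m L := by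
  obtain ⟨h1, h2⟩ := (P.surj (P.gm m)).choose_spec
  rcases P.gm_eq h1 hm h2 with h | h
  · rw [sm, h]
  · rw [sm, h, Vec.act_neg]

lemma sm_mul (g h : G) (L : Vec) : P.sm (g * h) L = P.sm g (P.sm h L) := by
  obtain ⟨m, hm, rfl⟩ := P.surj g
  obtain ⟨n, hn, rfl⟩ := P.surj h
  rw [← P.gm_mul hm hn, P.sm_gm (hm.mul hn), P.sm_gm hm, P.sm_gm hn, Vec.act_mul]

lemma sm_one (L : Vec) : P.sm 1 L = L := by
  rw [← P.gm_one, P.sm_gm IMat.unimod_one, Vec.act_one]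

lemma sm_inv_sm (g : G) (L : Vec) : P.sm g⁻¹ (P.sm g L) = L := by
  rw [← sm_mul, inv_mul_cancel, sm_one]

lemma sm_injective (g : G) : Function.Injective (P.sm g) := fun L M h => by
  rw [← P.sm_inv_sm g L, h, P.sm_inv_sm]

lemma sm_eq_iff (g h : G) (L M : Vec) : P.sm g L = P.sm h M ↔ P.sm (h⁻¹ * g) L = M := by
  rw [sm_mul]
  constructor
  · intro e; rw [e, sm_inv_sm]
  · intro e; rw [← e, ← P.sm_mul h, mul_inv_cancel, sm_one]

lemma sm_psd (g : G) {L : Vec} (hL : L.Psd) : (P.sm g L).Psd := by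
  obtain ⟨m, hm, rfl⟩ := P.surj g
  rw [P.sm_gm hm]
  exact hL.act hm

/-- The stabiliser of a functional. -/
noncomputable def fix (L : Vec) : Subgroup G where
  carrier := {g | P.sm g L = L}
  mul_mem' {g h} hg hh := by
    rw [Set.mem_ofPred_eq] at *
    rw [sm_mul, hh, hg]
  one_mem' := P.sm_one L
  inv_mem' {g} hg := by
    rw [Set.mem_ofPred_eq] at *
    exact (congrArg (P.sm g⁻¹) hg).symm.trans (P.sm_inv_sm g L)

lemma mem_fix {L : Vec} {g : G} : g ∈ P.fix L ↔ P.sm g L = L := Iff.rfl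

/-- The vertex stabilisers. -/
noncomputable def H (i : Fin 8) : Subgroup G := P.fix (rep i)

/-- The functional at the end of an edge. -/
def edgeTip (o : Fin 19) : Vec := Vec.act (glue o) (rep (edgeEnds o).2)

/-- The edge stabilisers. -/
noncomputable def K (o : Fin 19) : Subgroup G := P.fix (rep (edgeEnds o).1) ⊓ P.fix (edgeTip o)

/-- The stabilisers of two-cells. -/
def J (_ : Param G) (_ : Fin 11) : Subgroup G := ⊥

lemma transport {i j : Fin 8} {g : G} (h : P.sm g (rep i) = rep j) :
    i = j ∧ ∃ n < (stab i).length, P.gm (stabAt i n) = g := by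
  obtain ⟨m, hm, rfl⟩ := P.surj g
  rw [P.sm_gm hm] at h
  obtain ⟨h1, s, hs, h2⟩ := transporter hm h
  obtain ⟨n, hn, rfl⟩ := mem_stab_iff i s hs
  refine ⟨h1, n, hn, ?_⟩
  rcases h2 with h2 | h2
  · rw [h2]
  · rw [← h2, P.gm_neg (stab_spec i _ hs).1]

lemma stabAt_unimod {i : Fin 8} {n : ℕ} (hn : n < (stab i).length) : (stabAt i n).Unimod :=
  (stab_spec i _ (stabAt_spec i n hn)).1

lemma mem_H {i : Fin 8} {g : G} :
    g ∈ P.H i ↔ ∃ n < (stab i).length, P.gm (stabAt i n) = g := by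
  constructor
  · exact fun h => (P.transport (P.mem_fix.1 h)).2
  · rintro ⟨n, hn, rfl⟩
    refine P.mem_fix.2 ?_
    rw [P.sm_gm (stabAt_unimod hn)]
    exact (stab_spec i _ (stabAt_spec i n hn)).2

/-- The functional of a vertex. -/
noncomputable def fn (v : Orb P.H) : Vec := P.sm v.2.out (rep v.1)

lemma out_mul {S : Subgroup G} (g : G) : ∃ h ∈ S, (g : G ⧸ S).out = g * h := by
  obtain ⟨h, e⟩ := QuotientGroup.mk_out_eq_mul S g
  exact ⟨h, h.2, e⟩

lemma fn_mk (i : Fin 8) (g : G) : P.fn ⟨i, (g : G ⧸ P.H i)⟩ = P.sm g (rep i) := by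
  obtain ⟨h, hh, e⟩ := out_mul (S := P.H i) g
  rw [fn, e, sm_mul]
  exact congrArg _ (P.mem_fix.1 hh)

lemma fn_injective : Function.Injective P.fn := by
  rintro ⟨i, g⟩ ⟨j, h⟩ e
  induction g using QuotientGroup.induction_on
  induction h using QuotientGroup.induction_on
  rw [fn_mk, fn_mk, sm_eq_iff] at e
  obtain ⟨rfl, -⟩ := P.transport e
  refine congrArg (Sigma.mk i) (QuotientGroup.eq.2 ?_).symm
  exact P.mem_fix.2 e

lemma fn_smul (g : G) (v : Orb P.H) : P.fn (g • v) = P.sm g (P.fn v) := by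
  obtain ⟨i, h⟩ := v
  induction h using QuotientGroup.induction_on
  rename_i h
  exact (P.fn_mk i (g * h)).trans (by rw [fn_mk, sm_mul])

lemma fn_psd (v : Orb P.H) : (P.fn v).Psd := P.sm_psd _ (rep_pos v.1).2.2

/-- The first end of an edge. -/
noncomputable def end₀ (e : Orb P.K) : Orb P.H := ⟨(edgeEnds e.1).1, (e.2.out : G)⟩

/-- The second end of an edge. -/
noncomputable def end₁ (e : Orb P.K) : Orb P.H :=
  ⟨(edgeEnds e.1).2, ((e.2.out * P.gm (glue e.1) : G) : G ⧸ _)⟩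

lemma fn_end₀ (o : Fin 19) (g : G) :
    P.fn (P.end₀ ⟨o, (g : G ⧸ P.K o)⟩) = P.sm g (rep (edgeEnds o).1) := by
  obtain ⟨h, hh, e⟩ := out_mul (S := P.K o) g
  rw [end₀, fn_mk]
  simp only
  rw [e, sm_mul, P.mem_fix.1 hh.1]

lemma fn_end₁ (o : Fin 19) (g : G) :
    P.fn (P.end₁ ⟨o, (g : G ⧸ P.K o)⟩) = P.sm g (edgeTip o) := by
  obtain ⟨h, hh, e⟩ := out_mul (S := P.K o) g
  rw [end₁, fn_mk]
  simp only
  rw [e, sm_mul, P.sm_gm (glue_unimod o)]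
  exact (P.sm_mul _ _ _).trans (congrArg _ (P.mem_fix.1 hh.2))

lemma end₀_smul (g : G) (e : Orb P.K) : P.end₀ (g • e) = g • P.end₀ e := by
  apply P.fn_injective
  obtain ⟨o, h⟩ := e
  induction h using QuotientGroup.induction_on
  rename_i h
  rw [fn_smul, fn_end₀]
  exact (P.fn_end₀ o (g * h)).trans (P.sm_mul _ _ _)

lemma end₁_smul (g : G) (e : Orb P.K) : P.end₁ (g • e) = g • P.end₁ e := by
  apply P.fn_injective
  obtain ⟨o, h⟩ := e
  induction h using QuotientGroup.induction_on
  rename_i h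
  rw [fn_smul, fn_end₁]
  exact (P.fn_end₁ o (g * h)).trans (P.sm_mul _ _ _)

lemma ends_ne (e : Orb P.K) : P.end₀ e ≠ P.end₁ e := by
  obtain ⟨o, h⟩ := e
  induction h using QuotientGroup.induction_on
  intro e
  have := congrArg P.fn e
  rw [fn_end₀, fn_end₁] at this
  exact BianchiHomology.ends_ne o (P.sm_injective _ this)

lemma edge_ext {e e' : Orb P.K} (h : (P.fn (P.end₀ e) = P.fn (P.end₀ e') ∧
    P.fn (P.end₁ e) = P.fn (P.end₁ e')) ∨ (P.fn (P.end₀ e) = P.fn (P.end₁ e') ∧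
    P.fn (P.end₁ e) = P.fn (P.end₀ e'))) : e = e' := by
  obtain ⟨o, g⟩ := e
  obtain ⟨o', g'⟩ := e'
  induction g using QuotientGroup.induction_on
  induction g' using QuotientGroup.induction_on
  rename_i g g'
  rw [fn_end₀, fn_end₁, fn_end₀, fn_end₁] at h
  rcases h with ⟨h1, h2⟩ | ⟨h1, h2⟩
  · rw [eq_comm, sm_eq_iff] at h1
    rw [eq_comm, sm_eq_iff] at h2
    obtain ⟨hi, n, hn, hs⟩ := P.transport h1
    have hu := stabAt_unimod hn
    rw [← hs, P.sm_gm hu] at h2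
    have hmem : stabAt (edgeEnds o').1 n ∈ stab (edgeEnds o).1 := by
      rw [← hi]; exact stabAt_spec _ n hn
    have ho : o = o' := (edge_unique o o' _ hmem).1 hi.symm (by
      rw [Vec.act_mul]; exact h2.symm)
    subst ho
    refine congrArg (Sigma.mk o) (QuotientGroup.eq.2 ?_).symm
    have h3 : (g'⁻¹ * g)⁻¹ = g⁻¹ * g' := by group
    rw [← inv_mem_iff, h3]
    refine ⟨h1, ?_⟩
    rw [← P.sm_gm hu, hs] at h2
    exact h2
  · exfalso
    have h1' : P.sm g (rep (edgeEnds o).1) = P.sm (g' * P.gm (glue o')) (rep (edgeEnds o').2) := by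
      rw [h1, sm_mul, P.sm_gm (glue_unimod o')]; rfl
    rw [eq_comm, sm_eq_iff] at h1'
    obtain ⟨hi, n, hn, hs⟩ := P.transport h1'
    have hu := stabAt_unimod hn
    have hmem : stabAt (edgeEnds o').2 n ∈ stab (edgeEnds o).1 := by
      rw [← hi]; exact stabAt_spec _ n hn
    refine (edge_unique o o' _ hmem).2 hi.symm ?_
    rw [← P.sm_gm (hu.mul (glue_unimod o').adj), P.gm_mul hu (glue_unimod o').adj, hs,
      P.gm_adj (glue_unimod o'), mul_assoc, mul_assoc, mul_inv_cancel, mul_one]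
    rw [eq_comm, sm_eq_iff] at h2
    exact h2.symm

/-- The group element of a two-cell. -/
noncomputable def pos (c : Orb P.J) : G := c.2.out

lemma pos_mk (t : Fin 11) (g : G) : P.pos ⟨t, (g : G ⧸ P.J t)⟩ = g := by
  obtain ⟨h, hh, e⟩ := out_mul (S := P.J t) g
  rw [pos, e, Subgroup.mem_bot.1 hh, mul_one]

lemma pos_smul (g : G) (c : Orb P.J) : P.pos (g • c) = g * P.pos c := by
  obtain ⟨i, h⟩ := c
  induction h using QuotientGroup.induction_on
  rename_i h
  exact (P.pos_mk i (g * h)).trans (by rw [pos_mk])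

lemma cell_ext {c c' : Orb P.J} (h1 : c.1 = c'.1) (h2 : P.pos c = P.pos c') : c = c' := by
  obtain ⟨t, g⟩ := c
  obtain ⟨t', g'⟩ := c'
  obtain rfl : t = t' := h1
  induction g using QuotientGroup.induction_on
  induction g' using QuotientGroup.induction_on
  rw [pos_mk, pos_mk] at h2
  rw [h2]

/-- A boundary edge of a two-cell. -/
noncomputable def side (c : Orb P.J) (k : ℕ) : Orb P.K :=
  ⟨(bdryAt c.1 k).1, ((P.pos c * P.gm (bdryAt c.1 k).2 : G) : G ⧸ _)⟩

/-- A corner of a two-cell. -/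
noncomputable def vert (c : Orb P.J) (k : ℕ) : Orb P.H :=
  ⟨(cornerAt c.1 k).1, ((P.pos c * P.gm (cornerAt c.1 k).2 : G) : G ⧸ _)⟩

lemma cornerAt_mod (t : Fin 11) (k : ℕ) : cornerAt t (k % size t) = cornerAt t k := by
  rw [cornerAt, cornerAt, Nat.mod_mod]

lemma cornerAt_unimod (t : Fin 11) (k : ℕ) : (cornerAt t k).2.Unimod := by
  rw [← cornerAt_mod]
  exact corner_unimod t _ (Nat.mod_lt _ (by have := (size_pos t).1; omega))

lemma cor_mod (t : Fin 11) (k : ℕ) : cor t (k % size t) = cor t k := by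
  rw [cor, cor, cornerAt_mod]

lemma fn_vert (c : Orb P.J) (k : ℕ) : P.fn (P.vert c k) = P.sm (P.pos c) (cor c.1 k) := by
  rw [vert, fn_mk, sm_mul, P.sm_gm (cornerAt_unimod c.1 k)]; rfl

lemma side_ends (c : Orb P.J) {k : ℕ} (hk : k < size c.1) :
    (P.end₀ (P.side c k) = P.vert c k ∧ P.end₁ (P.side c k) = P.vert c (k + 1)) ∨
    (P.end₀ (P.side c k) = P.vert c (k + 1) ∧ P.end₁ (P.side c k) = P.vert c k) := by
  have hu := bdry_unimod c.1 k hk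
  have e0 : P.fn (P.end₀ (P.side c k)) = P.sm (P.pos c)
      (Vec.act (bdryAt c.1 k).2 (rep (edgeEnds (bdryAt c.1 k).1).1)) := by
    rw [side, fn_end₀, sm_mul, P.sm_gm hu]
  have e1 : P.fn (P.end₁ (P.side c k)) = P.sm (P.pos c)
      (Vec.act ((bdryAt c.1 k).2.mul (glue (bdryAt c.1 k).1))
        (rep (edgeEnds (bdryAt c.1 k).1).2)) := by
    rw [side, fn_end₁, sm_mul, P.sm_gm hu, Vec.act_mul]; rfl
  rcases bdry_spec c.1 k hk with ⟨h0, h1⟩ | ⟨h0, h1⟩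
  · exact Or.inl ⟨P.fn_injective (by rw [e0, h0, fn_vert]), P.fn_injective (by rw [e1, h1, fn_vert])⟩
  · exact Or.inr ⟨P.fn_injective (by rw [e0, h0, fn_vert]), P.fn_injective (by rw [e1, h1, fn_vert])⟩

lemma side_smul (g : G) (c : Orb P.J) (k : ℕ) : P.side (g • c) k = g • P.side c k := by
  have h : (g • c).1 = c.1 := rfl
  rw [side, pos_smul, h, mul_assoc]
  rfl

/-- The boundary map from edges to vertices. -/
noncomputable def d₁ : C P.K ⟶ C P.H :=
  permHom (C P.H) (fun e => Finsupp.single (P.end₀ e) 1 + Finsupp.single (P.end₁ e) 1) (by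
    intro g e
    change _ = permRepresentation (ZMod 2) G (Orb P.H) g _
    rw [map_add, permRepresentation_single, permRepresentation_single, end₀_smul, end₁_smul])

/-- The boundary map from two-cells to edges. -/
noncomputable def d₂ : C P.J ⟶ C P.K :=
  permHom (C P.K) (fun c => ∑ k ∈ Finset.range (size c.1), Finsupp.single (P.side c k) 1) (by
    intro g c
    change _ = permRepresentation (ZMod 2) G (Orb P.K) g _
    rw [map_sum]
    refine Finset.sum_congr rfl fun k _ => ?_
    rw [permRepresentation_single, side_smul])

lemma d₁_single (e : Orb P.K) : P.d₁.hom (Finsupp.single e 1) =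
    Finsupp.single (P.end₀ e) 1 + Finsupp.single (P.end₁ e) 1 :=
  (permHom_single _ _ _ e 1).trans (one_smul _ _)

lemma d₂_single (c : Orb P.J) : P.d₂.hom (Finsupp.single c 1) =
    ∑ k ∈ Finset.range (size c.1), Finsupp.single (P.side c k) 1 :=
  (permHom_single _ _ _ c 1).trans (one_smul _ _)

lemma sum_consecutive {M : Type} [AddCommGroup M] (hM : ∀ x : M, x + x = 0) (f : ℕ → M) (n : ℕ) :
    ∑ k ∈ Finset.range n, (f k + f (k + 1)) = f 0 + f n := by
  induction n with
  | zero => rw [Finset.range_zero, Finset.sum_empty, hM]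
  | succ n ih =>
    rw [Finset.sum_range_succ, ih, add_assoc, ← add_assoc (f n), hM, zero_add]

lemma finsupp_add_self {X : Type} (x : X →₀ ZMod 2) : x + x = 0 := by
  ext a
  exact CharTwo.add_self_eq_zero (x a)

lemma d₁_d₂_single (c : Orb P.J) : P.d₁.hom (P.d₂.hom (Finsupp.single c 1)) = 0 := by
  rw [d₂_single]
  refine (map_sum P.d₁.hom _ _).trans ?_
  have h : ∀ k ∈ Finset.range (size c.1), P.d₁.hom (Finsupp.single (P.side c k) 1) =
      (Finsupp.single (P.vert c k) 1 + Finsupp.single (P.vert c (k + 1)) 1 :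
        Orb P.H →₀ ZMod 2) := by
    intro k hk
    rw [d₁_single]
    rcases P.side_ends c (Finset.mem_range.1 hk) with ⟨h0, h1⟩ | ⟨h0, h1⟩
    · rw [h0, h1]
    · rw [h0, h1, add_comm]
  rw [Finset.sum_congr rfl h]
  refine (sum_consecutive finsupp_add_self
    (fun k => (Finsupp.single (P.vert c k) 1 : Orb P.H →₀ ZMod 2)) (size c.1)).trans ?_
  have e : P.vert c (size c.1) = P.vert c 0 := P.fn_injective (by
    rw [fn_vert, fn_vert, ← cor_mod, Nat.mod_self])
  simp only [e]
  exact finsupp_add_self _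

end Param

end BianchiHomology

namespace BianchiHomology

namespace Param

variable {G : Type} [Group G] (P : Param G) (Γ : Generic)

/-- The value of a vertex at a generic form. -/
noncomputable def val (v : Orb P.H) : ℝ := (P.fn v).ev Γ.p

/-- The height of a vertex. -/
noncomputable def height (v : Orb P.H) : ℕ := Γ.ht (P.fn v)

lemma height_lt_iff {v w : Orb P.H} : P.height Γ v < P.height Γ w ↔ P.val Γ v < P.val Γ w :=
  Γ.ht_lt_iff _ _ (P.fn_psd v)

lemma val_injective : Function.Injective (P.val Γ) := fun _ _ h => P.fn_injective (Γ.inj _ _ h)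

/-- The functional of a neighbour of a vertex. -/
noncomputable def near (v : Orb P.H) (s : ℕ) : Vec := P.sm v.2.out (nb v.1 s)

/-- A neighbour lies below a vertex. -/
def Below (v : Orb P.H) (s : ℕ) : Prop := (P.near v s).ev Γ.p < P.val Γ v

/-- The edge from a vertex to its neighbour with a given position. -/
def IsEdge (e : Orb P.K) (v : Orb P.H) (s : ℕ) : Prop :=
  s < (nbs v.1).length ∧ ((P.fn (P.end₀ e) = P.fn v ∧ P.fn (P.end₁ e) = P.near v s) ∨
    (P.fn (P.end₀ e) = P.near v s ∧ P.fn (P.end₁ e) = P.fn v))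

lemma exists_ev (g : G) : ∃ q : Pt, ∀ L, (P.sm g L).ev Γ.p = L.ev q := by
  obtain ⟨m, hm, rfl⟩ := P.surj g
  exact ⟨Γ.p.back m, fun L => by rw [P.sm_gm hm, Vec.ev_act]⟩

lemma nb_mem {i : Fin 8} {u : Vec} (h : u ∈ nbs i) : ∃ s < (nbs i).length, nb i s = u := by
  obtain ⟨s, hs, rfl⟩ := List.getElem_of_mem h
  exact ⟨s, hs, List.getD_eq_getElem _ _ hs⟩

lemma nb_inj {i : Fin 8} {s s' : ℕ} (hs : s < (nbs i).length) (hs' : s' < (nbs i).length)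
    (h : nb i s = nb i s') : s = s' := by
  rw [nb, nb, List.getD_eq_getElem _ _ hs, List.getD_eq_getElem _ _ hs'] at h
  exact (nbs_nodup i).getElem_inj_iff.1 h

lemma isEdge_ext {e e' : Orb P.K} {v : Orb P.H} {s : ℕ} (h : P.IsEdge e v s)
    (h' : P.IsEdge e' v s) : e = e' := by
  apply P.edge_ext
  rcases h.2 with ⟨h1, h2⟩ | ⟨h1, h2⟩ <;> rcases h'.2 with ⟨h3, h4⟩ | ⟨h3, h4⟩ <;>
    rw [h1, h2, h3, h4]
  · exact Or.inl ⟨rfl, rfl⟩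
  · exact Or.inr ⟨rfl, rfl⟩
  · exact Or.inr ⟨rfl, rfl⟩
  · exact Or.inl ⟨rfl, rfl⟩

lemma isEdge_index {e : Orb P.K} {v : Orb P.H} {s s' : ℕ} (h : P.IsEdge e v s)
    (h' : P.IsEdge e v s') : s = s' := by
  have key : P.near v s = P.near v s' → s = s' := fun hn =>
    nb_inj h.1 h'.1 (P.sm_injective _ hn)
  rcases h.2 with ⟨h1, h2⟩ | ⟨h1, h2⟩ <;> rcases h'.2 with ⟨h3, h4⟩ | ⟨h3, h4⟩
  · exact key (h2.symm.trans h4)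
  · exact absurd (P.fn_injective (h1.trans h4.symm)) (P.ends_ne e)
  · exact absurd (P.fn_injective (h3.trans h2.symm)) (P.ends_ne e)
  · exact key (h1.symm.trans h3)

lemma exists_edge {v : Orb P.H} {s : ℕ} (hs : s < (nbs v.1).length) : ∃ e, P.IsEdge e v s := by
  have hs' : s < (star v.1).length := by rwa [nbs, List.length_map] at hs
  have hnb : nb v.1 s = starEnd v.1 (star v.1)[s] := by
    rw [nb, List.getD_eq_getElem _ _ hs]
    exact List.getElem_map _
  have hx := star_spec v.1 _ (List.getElem_mem hs')
  generalize (star v.1)[s] = x at hnb hx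
  obtain ⟨i, g⟩ := v
  obtain ⟨o, n, b⟩ := x
  obtain ⟨h1, h2⟩ := hx
  simp only at h1 h2 hnb
  have hfix : Vec.act (stabAt i n) (rep i) = rep i := (stab_spec i _ (stabAt_spec i n h1)).2
  have hu := stabAt_unimod h1
  have hv : P.fn ⟨i, g⟩ = P.sm g.out (rep i) := rfl
  have hn : P.near ⟨i, g⟩ s = P.sm g.out (nb i s) := rfl
  cases b with
  | false =>
    simp only [starEnd, starMat, Bool.false_eq_true, if_false] at hnb h2
    refine ⟨⟨o, ((g.out * P.gm (stabAt i n) : G) : G ⧸ _)⟩, hs, Or.inl ⟨?_, ?_⟩⟩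
    · rw [fn_end₀, h2, sm_mul, P.sm_gm hu, hfix, hv]
    · rw [fn_end₁, sm_mul, P.sm_gm hu, hn, hnb, Vec.act_mul]; rfl
  | true =>
    simp only [starEnd, starMat, if_true] at hnb h2
    have hu' := hu.mul (glue_unimod o).adj
    refine ⟨⟨o, ((g.out * P.gm ((stabAt i n).mul (glue o).adj) : G) : G ⧸ _)⟩, hs,
      Or.inr ⟨?_, ?_⟩⟩
    · rw [fn_end₀, sm_mul, P.sm_gm hu', hn, hnb]
    · rw [fn_end₁, sm_mul, P.sm_gm hu', hv, edgeTip, ← Vec.act_mul, IMat.mul_assoc,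
        IMat.adj_mul (glue_unimod o), IMat.mul_one, h2, hfix]

lemma edge_at_end₀ (e : Orb P.K) : ∃ s, P.IsEdge e (P.end₀ e) s := by
  obtain ⟨o, g⟩ := e
  induction g using QuotientGroup.induction_on
  rename_i g
  obtain ⟨h, hh, e⟩ := out_mul (S := P.H (edgeEnds o).1) (g : G ⧸ P.K o).out
  obtain ⟨h', hh', e'⟩ := out_mul (S := P.K o) g
  obtain ⟨n, hn, hs⟩ := P.mem_H.1 (inv_mem hh)
  obtain ⟨s, hs1, hs2⟩ := nb_mem ((star_complete o).1 _ (stabAt_spec _ n hn))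
  refine ⟨s, hs1, Or.inl ⟨rfl, ?_⟩⟩
  have hk : P.near (P.end₀ ⟨o, (g : G ⧸ P.K o)⟩) s =
      P.sm (((g : G ⧸ P.K o).out : G) : G ⧸ P.H (edgeEnds o).1).out (nb (edgeEnds o).1 s) := rfl
  rw [hk, hs2, e, Vec.act_mul, ← P.sm_gm (stabAt_unimod hn), hs, ← P.sm_mul, mul_inv_cancel_right,
    e', sm_mul, fn_end₁]
  exact congrArg _ (P.mem_fix.1 hh'.2).symm

lemma edge_at_end₁ (e : Orb P.K) : ∃ s, P.IsEdge e (P.end₁ e) s := by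
  obtain ⟨o, g⟩ := e
  induction g using QuotientGroup.induction_on
  rename_i g
  obtain ⟨h, hh, e⟩ := out_mul (S := P.H (edgeEnds o).2) ((g : G ⧸ P.K o).out * P.gm (glue o))
  obtain ⟨h', hh', e'⟩ := out_mul (S := P.K o) g
  obtain ⟨n, hn, hs⟩ := P.mem_H.1 (inv_mem hh)
  obtain ⟨s, hs1, hs2⟩ := nb_mem ((star_complete o).2 _ (stabAt_spec _ n hn))
  refine ⟨s, hs1, Or.inr ⟨?_, rfl⟩⟩
  have hk : P.near (P.end₁ ⟨o, (g : G ⧸ P.K o)⟩) s =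
      P.sm (((g : G ⧸ P.K o).out * P.gm (glue o) : G) : G ⧸ P.H (edgeEnds o).2).out
        (nb (edgeEnds o).2 s) := rfl
  rw [hk, hs2, e, Vec.act_mul, ← P.sm_gm (stabAt_unimod hn), hs, ← P.sm_mul, mul_inv_cancel_right,
    e', sm_mul, P.sm_gm (glue_unimod o), ← Vec.act_mul, IMat.mul_adj (glue_unimod o), Vec.act_one,
    fn_end₀, sm_mul]
  exact congrArg _ (P.mem_fix.1 hh'.1).symm

/-- The edge descends from a vertex along a given position. -/
def Down (e : Orb P.K) (v : Orb P.H) (s : ℕ) : Prop := P.IsEdge e v s ∧ P.Below Γ v s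

lemma exists_down (e : Orb P.K) : ∃ v s, P.Down Γ e v s := by
  rcases lt_trichotomy (P.val Γ (P.end₀ e)) (P.val Γ (P.end₁ e)) with h | h | h
  · obtain ⟨s, hs⟩ := P.edge_at_end₁ e
    refine ⟨_, s, hs, ?_⟩
    rcases hs.2 with ⟨h1, h2⟩ | ⟨h1, h2⟩
    · exact absurd (P.fn_injective h1) (P.ends_ne e)
    · rw [Below, ← h1]; exact h
  · exact absurd (P.val_injective Γ h) (P.ends_ne e)
  · obtain ⟨s, hs⟩ := P.edge_at_end₀ e
    refine ⟨_, s, hs, ?_⟩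
    rcases hs.2 with ⟨h1, h2⟩ | ⟨h1, h2⟩
    · rw [Below, ← h2]; exact h
    · exact absurd (P.fn_injective h2).symm (P.ends_ne e)

lemma Down.ends {e : Orb P.K} {v : Orb P.H} {s : ℕ} (h : P.Down Γ e v s) :
    (P.end₀ e = v ∧ P.val Γ (P.end₁ e) < P.val Γ v) ∨
    (P.end₁ e = v ∧ P.val Γ (P.end₀ e) < P.val Γ v) := by
  rcases h.1.2 with ⟨h1, h2⟩ | ⟨h1, h2⟩
  · exact Or.inl ⟨P.fn_injective h1, by rw [val, h2]; exact h.2⟩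
  · exact Or.inr ⟨P.fn_injective h2, by rw [val, h1]; exact h.2⟩

/-- The upper end of an edge. -/
noncomputable def top (e : Orb P.K) : Orb P.H := (P.exists_down Γ e).choose

/-- The position of an edge at its upper end. -/
noncomputable def idx (e : Orb P.K) : ℕ := (P.exists_down Γ e).choose_spec.choose

lemma down_top (e : Orb P.K) : P.Down Γ e (P.top Γ e) (P.idx Γ e) :=
  (P.exists_down Γ e).choose_spec.choose_spec

lemma Down.eq_top {e : Orb P.K} {v : Orb P.H} {s : ℕ} (h : P.Down Γ e v s) :
    P.top Γ e = v ∧ P.idx Γ e = s := by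
  have h' := P.down_top Γ e
  have e1 : P.top Γ e = v := by
    rcases h.ends with ⟨h1, h2⟩ | ⟨h1, h2⟩ <;> rcases h'.ends with ⟨h3, h4⟩ | ⟨h3, h4⟩
    · exact h3.symm.trans h1
    · rw [h3] at h2; rw [h1] at h4; exact absurd h2 h4.asymm
    · rw [h3] at h2; rw [h1] at h4; exact absurd h2 h4.asymm
    · exact h3.symm.trans h1
  rw [e1] at h'
  exact ⟨e1, P.isEdge_index h'.1 h.1⟩

lemma ev_comb {i : Fin 8} (q : Pt) (l : List (ℕ × ℕ)) :
    (comb i l).ev q = (l.map fun c => (c.2 : ℝ) * (diff i c.1).ev q).sum := by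
  induction l with
  | nil => simp [comb, Vec.ev]
  | cons a l ih =>
    have h : comb i (a :: l) = ((diff i a.1).smul a.2).add (comb i l) := rfl
    rw [h, Vec.ev_add, Vec.ev_smul, ih, List.map_cons, List.sum_cons]
    simp

lemma exists_order_at (v : Orb P.H) : ∃ l : List ℕ,
    (∀ s, s ∈ l ↔ s < (nbs v.1).length ∧ P.Below Γ v s) ∧ l.Nodup ∧
      goodOrder (links v.1) l = true := by
  obtain ⟨q, hq⟩ := P.exists_ev Γ v.2.out
  have hB : ∀ s, P.Below Γ v s ↔ (diff v.1 s).ev q < 0 := by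
    intro s
    rw [Below, near, val, fn, hq, hq, diff, Vec.ev_sub, sub_neg]
  refine exists_order v.1 fun g hg c hc hbad => ?_
  obtain ⟨h1, h2, h3⟩ := (clauses_spec v.1).2 g hg c hc
  have hnn : 0 ≤ ((comb v.1 c.1).sub (comb v.1 c.2)).ev q := by
    rw [← hq]; exact Γ.psd _ (P.sm_psd _ h3)
  rw [Vec.ev_sub, ev_comb, ev_comb] at hnn
  have hneg : (c.1.map fun c => (c.2 : ℝ) * (diff v.1 c.1).ev q).sum < 0 := by
    obtain ⟨a, l, e⟩ := List.exists_cons_of_ne_nil h1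
    rw [e] at h2 hbad ⊢
    rw [List.map_cons, List.sum_cons]
    have ha : ((a.2 : ℝ)) * (diff v.1 a.1).ev q < 0 :=
      mul_neg_of_pos_of_neg (by exact_mod_cast h2 a List.mem_cons_self)
        ((hB _).1 (hbad.1 a List.mem_cons_self))
    have hl : (l.map fun c => (c.2 : ℝ) * (diff v.1 c.1).ev q).sum ≤ 0 := by
      refine (List.sum_le_card_nsmul _ 0 fun y hy => ?_).trans_eq (smul_zero _)
      obtain ⟨b, hb, rfl⟩ := List.mem_map.1 hy
      exact mul_nonpos_of_nonneg_of_nonpos (Nat.cast_nonneg _)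
        ((hB _).1 (hbad.1 b (List.mem_cons_of_mem _ hb))).le
    linarith
  have hpos : 0 ≤ (c.2.map fun c => (c.2 : ℝ) * (diff v.1 c.1).ev q).sum := by
    refine List.sum_nonneg fun y hy => ?_
    obtain ⟨b, hb, rfl⟩ := List.mem_map.1 hy
    exact mul_nonneg (Nat.cast_nonneg _) (not_lt.1 fun h => hbad.2 b hb ((hB _).2 h))
  linarith

/-- The descending positions at a vertex, ordered. -/
noncomputable def order (v : Orb P.H) : List ℕ := (P.exists_order_at Γ v).choose

lemma mem_order {v : Orb P.H} {s : ℕ} :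
    s ∈ P.order Γ v ↔ s < (nbs v.1).length ∧ P.Below Γ v s :=
  (P.exists_order_at Γ v).choose_spec.1 s

lemma order_nodup (v : Orb P.H) : (P.order Γ v).Nodup := (P.exists_order_at Γ v).choose_spec.2.1

lemma nbs_length : ∀ i, (nbs i).length ≤ 99 := by decide +kernel

lemma depth_order_lt {v : Orb P.H} {s : ℕ} (hs : s ∈ P.order Γ v) :
    depth (P.order Γ v) s < 100 := by
  refine (depth_lt hs).trans_le ?_
  have h : P.order Γ v ⊆ List.range (nbs v.1).length := fun s hs =>
    List.mem_range.2 ((P.mem_order Γ).1 hs).1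
  have := ((P.order_nodup Γ v).subperm h).length_le
  rw [List.length_range] at this
  have := nbs_length v.1
  omega

lemma order_root {v : Orb P.H} (hne : P.order Γ v ≠ []) : ∃ ρ ∈ P.order Γ v,
    (∀ s ∈ P.order Γ v, depth (P.order Γ v) ρ ≤ depth (P.order Γ v) s) ∧
    ∀ s ∈ P.order Γ v, s ≠ ρ → ∃ x ∈ links v.1,
      (∃ s' ∈ P.order Γ v, depth (P.order Γ v) s' < depth (P.order Γ v) s ∧ Joins x s s') ∧
      ∀ y ∈ links v.1, (∃ s' ∈ P.order Γ v, depth (P.order Γ v) s' < depth (P.order Γ v) s ∧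
        Joins y s s') → y = x := by
  obtain ⟨ρ, hρ, h⟩ := goodOrder_spec (P.exists_order_at Γ v).choose_spec.2.2
    (P.order_nodup Γ v) hne
  refine ⟨ρ, hρ, ?_, h⟩
  obtain ⟨m, hm, hmin⟩ := Finset.exists_min_image (P.order Γ v).toFinset (depth (P.order Γ v))
    ⟨ρ, List.mem_toFinset.2 hρ⟩
  have : m = ρ := by
    by_contra hne
    obtain ⟨x, -, ⟨s', hs', hlt, -⟩, -⟩ := h m (List.mem_toFinset.1 hm) hne
    exact absurd hlt (hmin s' (List.mem_toFinset.2 hs')).not_gt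
  rw [← this]
  exact fun s hs => hmin s (List.mem_toFinset.2 hs)

/-- The order on edges: first by the height of the upper end, then by the position there. -/
noncomputable def rank (e : Orb P.K) : ℕ :=
  P.height Γ (P.top Γ e) * 100 + depth (P.order Γ (P.top Γ e)) (P.idx Γ e)

lemma idx_mem (e : Orb P.K) : P.idx Γ e ∈ P.order Γ (P.top Γ e) :=
  (P.mem_order Γ).2 ⟨(P.down_top Γ e).1.1, (P.down_top Γ e).2⟩

lemma rank_lt_of_top {e e' : Orb P.K} (h : P.val Γ (P.top Γ e) < P.val Γ (P.top Γ e')) :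
    P.rank Γ e < P.rank Γ e' := by
  have h1 := (P.height_lt_iff Γ).2 h
  have h2 := P.depth_order_lt Γ (P.idx_mem Γ e)
  rw [rank, rank]
  omega

lemma minimal_of_not_below {v : Orb P.H} (h : P.order Γ v = []) (w : Orb P.H) :
    P.val Γ v ≤ P.val Γ w := by
  obtain ⟨m, hm, hv⟩ := P.surj v.2.out
  obtain ⟨n, hn, hw⟩ := P.surj w.2.out
  have key := rep_minimal v.1 (p := Γ.p.back m) (fun s hs => ?_) w.1 (m := m.adj.mul n)
    (hm.adj.mul hn)
  · rw [← Vec.ev_act, ← Vec.ev_act, ← Vec.act_mul, ← IMat.mul_assoc, IMat.mul_adj hm] at key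
    rw [val, val, fn, fn, ← hv, ← hw, P.sm_gm hm, P.sm_gm hn]
    refine key.trans_eq ?_
    rw [Vec.act_mul, Vec.act_one]
  · rw [diff, Vec.ev_sub, sub_nonneg, ← Vec.ev_act, ← Vec.ev_act, ← P.sm_gm hm, ← P.sm_gm hm, hv]
    by_contra hlt
    have hmem : s ∈ P.order Γ v := (P.mem_order Γ).2 ⟨hs, not_le.1 hlt⟩
    rw [h] at hmem
    exact List.not_mem_nil hmem

end Param

end BianchiHomology

namespace BianchiHomology

namespace Param

variable {G : Type} [Group G] (P : Param G) (Γ : Generic)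

/-- The two-cell with a given corner at a vertex. -/
def IsCell (c : Orb P.J) (v : Orb P.H) (x : ℕ × ℕ × Fin 11 × ℕ × ℕ) : Prop :=
  x ∈ links v.1 ∧ c.1 = x.2.2.1 ∧ P.pos c =
    v.2.out * P.gm (stabAt v.1 x.2.2.2.2) * (P.gm (cornerAt x.2.2.1 x.2.2.2.1).2)⁻¹

lemma exists_cell {v : Orb P.H} {x : ℕ × ℕ × Fin 11 × ℕ × ℕ} (hx : x ∈ links v.1) :
    ∃ c, P.IsCell c v x :=
  ⟨⟨x.2.2.1, ((v.2.out * P.gm (stabAt v.1 x.2.2.2.2) *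
    (P.gm (cornerAt x.2.2.1 x.2.2.2.1).2)⁻¹ : G) : G ⧸ _)⟩, hx, rfl, P.pos_mk _ _⟩

lemma isCell_ext {c c' : Orb P.J} {v : Orb P.H} {x : ℕ × ℕ × Fin 11 × ℕ × ℕ}
    (h : P.IsCell c v x) (h' : P.IsCell c' v x) : c = c' :=
  P.cell_ext (h.2.1.trans h'.2.1.symm) (h.2.2.trans h'.2.2.symm)

lemma sm_pos {c : Orb P.J} {v : Orb P.H} {x : ℕ × ℕ × Fin 11 × ℕ × ℕ} (h : P.IsCell c v x)
    (L : Vec) : P.sm (P.pos c) L = P.sm v.2.out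
      (Vec.act ((stabAt v.1 x.2.2.2.2).mul (cornerAt x.2.2.1 x.2.2.2.1).2.adj) L) := by
  have hl := links_spec v.1 x h.1
  have hu := stabAt_unimod hl.2.2.2.2.1
  have hy := cornerAt_unimod x.2.2.1 x.2.2.2.1
  rw [h.2.2, mul_assoc, ← P.gm_adj hy, ← P.gm_mul hu hy.adj, sm_mul, P.sm_gm (hu.mul hy.adj)]

lemma vert_cell {c : Orb P.J} {v : Orb P.H} {x : ℕ × ℕ × Fin 11 × ℕ × ℕ} (h : P.IsCell c v x) :
    P.vert c x.2.2.2.1 = v := by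
  have hl := links_spec v.1 x h.1
  have hy := cornerAt_unimod x.2.2.1 x.2.2.2.1
  apply P.fn_injective
  rw [fn_vert, h.2.1, P.sm_pos h, cor, ← Vec.act_mul, IMat.mul_assoc, IMat.adj_mul hy,
    IMat.mul_one, hl.2.2.2.2.2.1, (stab_spec _ _ (stabAt_spec v.1 _ hl.2.2.2.2.1)).2]
  rfl

lemma vert_prev {c : Orb P.J} {v : Orb P.H} {x : ℕ × ℕ × Fin 11 × ℕ × ℕ} (h : P.IsCell c v x) :
    P.fn (P.vert c (x.2.2.2.1 + size c.1 - 1)) = P.near v x.1 := by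
  rw [fn_vert, h.2.1, P.sm_pos h, near, (links_spec v.1 x h.1).2.2.2.2.2.2.1]

lemma vert_next {c : Orb P.J} {v : Orb P.H} {x : ℕ × ℕ × Fin 11 × ℕ × ℕ} (h : P.IsCell c v x) :
    P.fn (P.vert c (x.2.2.2.1 + 1)) = P.near v x.2.1 := by
  rw [fn_vert, h.2.1, P.sm_pos h, near, (links_spec v.1 x h.1).2.2.2.2.2.2.2]

lemma exists_corner (c : Orb P.J) {k : ℕ} (hk : k < size c.1) :
    ∃ x, P.IsCell c (P.vert c k) x ∧ x.2.2.2.1 = k := by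
  obtain ⟨h, hh, e⟩ := out_mul (S := P.H (cornerAt c.1 k).1)
    (P.pos c * P.gm (cornerAt c.1 k).2)
  obtain ⟨n, hn, hs⟩ := P.mem_H.1 (inv_mem hh)
  obtain ⟨x, hx, hx'⟩ := links_complete c.1 k hk n hn
  refine ⟨x, ⟨hx, by rw [hx'], ?_⟩, by rw [hx']⟩
  rw [hx']
  change P.pos c = ((P.pos c * P.gm (cornerAt c.1 k).2 : G) : G ⧸ P.H (cornerAt c.1 k).1).out *
    P.gm (stabAt (cornerAt c.1 k).1 n) * (P.gm (cornerAt c.1 k).2)⁻¹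
  rw [hs, e, mul_inv_cancel_right, mul_inv_cancel_right]

lemma vert_mod (c : Orb P.J) (k : ℕ) : P.vert c (k % size c.1) = P.vert c k :=
  P.fn_injective (by rw [fn_vert, fn_vert, cor_mod])

lemma vert_inj (c : Orb P.J) {k k' : ℕ} (hk : k < size c.1) (hk' : k' < size c.1)
    (h : P.vert c k = P.vert c k') : k = k' := by
  by_contra hne
  have := congrArg P.fn h
  rw [fn_vert, fn_vert] at this
  exact cor_ne c.1 k hk k' hk' hne (P.sm_injective _ this)

/-- A vertex is the top corner of a two-cell. -/
def Top (c : Orb P.J) (v : Orb P.H) (x : ℕ × ℕ × Fin 11 × ℕ × ℕ) : Prop :=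
  P.IsCell c v x ∧ P.Below Γ v x.1 ∧ P.Below Γ v x.2.1

lemma Top.lt {c : Orb P.J} {v : Orb P.H} {x : ℕ × ℕ × Fin 11 × ℕ × ℕ} (h : P.Top Γ c v x) {k : ℕ}
    (hk : k < size c.1) (hne : k ≠ x.2.2.2.1) : P.val Γ (P.vert c k) < P.val Γ v := by
  have hl := links_spec v.1 x h.1.1
  have hkx : x.2.2.2.1 < size c.1 := by rw [h.1.2.1]; exact hl.2.2.2.1
  obtain ⟨f, g, h1, h2, h3, h4⟩ := cor_convex c.1 x.2.2.2.1 hkx k hk hne.symm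
  obtain ⟨q, hq⟩ := P.exists_ev Γ (P.pos c)
  have hval : ∀ j, P.val Γ (P.vert c j) = (cor c.1 j).ev q := fun j => by
    rw [val, fn_vert, hq]
  have hv : P.val Γ v = (cor c.1 x.2.2.2.1).ev q := by rw [← hval, P.vert_cell h.1]
  have hp : (cor c.1 (x.2.2.2.1 + size c.1 - 1)).ev q < (cor c.1 x.2.2.2.1).ev q := by
    rw [← hv, ← hval, val, P.vert_prev h.1]; exact h.2.1
  have hn : (cor c.1 (x.2.2.2.1 + 1)).ev q < (cor c.1 x.2.2.2.1).ev q := by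
    rw [← hv, ← hval, val, P.vert_next h.1]; exact h.2.2
  refine lt_of_le_of_ne ?_ fun e => hne (P.vert_inj c hk hkx
    ((P.val_injective Γ e).trans (P.vert_cell h.1).symm))
  rw [hval, hv]
  have h5 := congrArg (fun L => Vec.ev L q) h4
  simp only [Vec.ev_add, Vec.ev_smul, Vec.ev_sub] at h5
  revert h1 h2 h3 h5
  generalize Vec.minor f g _ _ = M
  generalize Vec.minor f g _ _ = A
  generalize Vec.minor f g _ _ = B
  intro h1 h2 h3 h5
  have h1' : (0 : ℝ) < M := by exact_mod_cast h1
  have h2' : (0 : ℝ) ≤ A := by exact_mod_cast h2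
  have h3' : (0 : ℝ) ≤ B := by exact_mod_cast h3
  by_contra hlt
  have := mul_pos h1' (sub_pos.2 (not_le.1 hlt))
  have := mul_nonneg h2' (sub_nonneg.2 hn.le)
  have := mul_nonneg h3' (sub_nonneg.2 hp.le)
  nlinarith

lemma exists_top (c : Orb P.J) : ∃ v x, P.Top Γ c v x := by
  have hs := (size_pos c.1).1
  obtain ⟨k, hk, hmax⟩ := Finset.exists_max_image (Finset.range (size c.1))
    (fun k => P.val Γ (P.vert c k)) ⟨0, Finset.mem_range.2 (by omega)⟩
  have hk' := Finset.mem_range.1 hk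
  obtain ⟨x, hx, hxk⟩ := P.exists_corner c hk'
  have key : ∀ j, j % size c.1 ≠ k → P.val Γ (P.vert c j) < P.val Γ (P.vert c k) := by
    intro j hj
    have hj' : j % size c.1 < size c.1 := Nat.mod_lt _ (by omega)
    have h := hmax _ (Finset.mem_range.2 hj')
    rw [P.vert_mod] at h
    refine lt_of_le_of_ne h fun e => hj (P.vert_inj c hj' hk' ?_)
    rw [P.vert_mod]
    exact P.val_injective Γ e
  refine ⟨_, x, hx, ?_, ?_⟩
  · rw [Below, ← P.vert_prev hx, hxk]
    refine key _ fun e => ?_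
    rcases Nat.eq_zero_or_pos k with h0 | h0
    · rw [h0, zero_add, Nat.mod_eq_of_lt (by omega)] at e
      omega
    · have h1 : k + size c.1 - 1 = (k - 1) + size c.1 := by omega
      rw [h1, Nat.add_mod_right, Nat.mod_eq_of_lt (by omega)] at e
      omega
  · rw [Below, ← P.vert_next hx, hxk]
    refine key _ fun e => ?_
    rcases Nat.lt_or_ge (k + 1) (size c.1) with h0 | h0
    · rw [Nat.mod_eq_of_lt h0] at e
      omega
    · have h1 : k + 1 = size c.1 := by omega
      rw [h1, Nat.mod_self] at e
      omega

/-- The leading edge in the boundary of a two-cell. -/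
def Lead (c : Orb P.J) (e : Orb P.K) : Prop :=
  ∃ w : Orb P.K →₀ ZMod 2, (∀ y ∈ w.support, P.rank Γ y < P.rank Γ e) ∧
    P.d₂.hom (Finsupp.single c 1) = (Finsupp.single e 1 + w : Orb P.K →₀ ZMod 2)

lemma lead_unique {c : Orb P.J} {e e' : Orb P.K} (h : P.Lead Γ c e) (h' : P.Lead Γ c e') :
    e = e' := by
  obtain ⟨w, hw, he⟩ := h
  obtain ⟨w', hw', he'⟩ := h'
  have heq : (Finsupp.single e 1 + w : Orb P.K →₀ ZMod 2) = Finsupp.single e' 1 + w' :=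
    he.symm.trans he'
  have key : ∀ (e e' : Orb P.K) (w w' : Orb P.K →₀ ZMod 2),
      (∀ y ∈ w.support, P.rank Γ y < P.rank Γ e) → (∀ y ∈ w'.support, P.rank Γ y < P.rank Γ e') →
      Finsupp.single e 1 + w = Finsupp.single e' 1 + w' → P.rank Γ e' ≤ P.rank Γ e → e = e' := by
    intro e e' w w' hw hw' heq hle
    by_contra hne
    have h1 := DFunLike.congr_fun heq e
    rw [Finsupp.add_apply, Finsupp.add_apply, Finsupp.single_eq_same,
      Finsupp.single_eq_of_ne hne, Finsupp.notMem_support_iff.1 (fun h => (hw e h).false),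
      Finsupp.notMem_support_iff.1 (fun h => ((hw' e h).trans_le hle).false)] at h1
    simp at h1
  rcases le_total (P.rank Γ e') (P.rank Γ e) with h | h
  · exact key e e' w w' hw hw' heq h
  · exact (key e' e w' w hw' hw heq.symm h).symm

lemma isEdge_of_ends {e : Orb P.K} {v u : Orb P.H} {s : ℕ} (hs : s < (nbs v.1).length)
    (hu : P.fn u = P.near v s)
    (h : (P.end₀ e = v ∧ P.end₁ e = u) ∨ (P.end₀ e = u ∧ P.end₁ e = v)) : P.IsEdge e v s := by
  refine ⟨hs, ?_⟩
  rcases h with ⟨h1, h2⟩ | ⟨h1, h2⟩ <;> rw [h1, h2, hu]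
  · exact Or.inl ⟨rfl, rfl⟩
  · exact Or.inr ⟨rfl, rfl⟩

lemma Top.lead {c : Orb P.J} {v : Orb P.H} {x : ℕ × ℕ × Fin 11 × ℕ × ℕ} (h : P.Top Γ c v x) :
    ∃ s ∈ P.order Γ v, ∃ s' ∈ P.order Γ v, depth (P.order Γ v) s' < depth (P.order Γ v) s ∧
      Joins x s s' ∧ ∃ e, P.Down Γ e v s ∧ P.Lead Γ c e := by
  have hl := links_spec v.1 x h.1.1
  have hs := (size_pos c.1).1
  set k := x.2.2.2.1 with hkdef
  have hk : k < size c.1 := by rw [h.1.2.1]; exact hl.2.2.2.1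
  obtain ⟨k', hk', hkk, hmod⟩ : ∃ k' < size c.1, k' ≠ k ∧ (k' + 1) % size c.1 = k ∧
      k' = (k + size c.1 - 1) % size c.1 := by
    rcases Nat.eq_zero_or_pos k with h0 | h0
    · refine ⟨size c.1 - 1, by omega, by omega, ?_, ?_⟩
      · rw [Nat.sub_add_cancel (by omega), Nat.mod_self, h0]
      · rw [h0, zero_add, Nat.mod_eq_of_lt (by omega)]
    · refine ⟨k - 1, by omega, by omega, ?_, ?_⟩
      · rw [Nat.sub_add_cancel (by omega), Nat.mod_eq_of_lt hk]
      · have h1 : k + size c.1 - 1 = (k - 1) + size c.1 := by omega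
        rw [h1, Nat.add_mod_right, Nat.mod_eq_of_lt (by omega)]
  have hvk : P.vert c k = v := P.vert_cell h.1
  have hvk' : P.vert c (k' + 1) = v := by rw [← P.vert_mod, hmod.1, hvk]
  have hprev : P.fn (P.vert c k') = P.near v x.1 := by
    rw [← P.vert_prev h.1, ← P.vert_mod c (_ - 1), hmod.2]
  have e1 : P.Down Γ (P.side c k) v x.2.1 := by
    refine ⟨P.isEdge_of_ends hl.2.1 (P.vert_next h.1) ?_, h.2.2⟩
    rw [← hvk]
    exact P.side_ends c hk
  have e2 : P.Down Γ (P.side c k') v x.1 := by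
    refine ⟨P.isEdge_of_ends hl.1 hprev ?_, h.2.1⟩
    have := (P.side_ends c hk').symm
    rwa [hvk'] at this
  have m1 : x.2.1 ∈ P.order Γ v := (P.mem_order Γ).2 ⟨hl.2.1, h.2.2⟩
  have m2 : x.1 ∈ P.order Γ v := (P.mem_order Γ).2 ⟨hl.1, h.2.1⟩
  set w : Orb P.K →₀ ZMod 2 := ∑ j ∈ (Finset.range (size c.1)).filter (fun j => j ≠ k ∧ j ≠ k'),
    Finsupp.single (P.side c j) 1 with hw
  have hsum : P.d₂.hom (Finsupp.single c 1) =
      (Finsupp.single (P.side c k) 1 + Finsupp.single (P.side c k') 1 + w :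
        Orb P.K →₀ ZMod 2) := by
    rw [d₂_single, ← Finset.sum_filter_add_sum_filter_not (Finset.range (size c.1))
      (fun j => j ≠ k ∧ j ≠ k'), add_comm]
    congr 1
    have hpair : (Finset.range (size c.1)).filter (fun j => ¬ (j ≠ k ∧ j ≠ k')) = {k, k'} := by
      ext j
      simp only [Finset.mem_filter, Finset.mem_range, Finset.mem_insert, Finset.mem_singleton]
      omega
    rw [hpair, Finset.sum_pair hkk.symm]
  have hlow : ∀ y ∈ w.support, P.val Γ (P.top Γ y) < P.val Γ v := by
    classical
    intro y hy
    obtain ⟨j, hj, hy⟩ := Finset.mem_biUnion.1 (Finsupp.support_finsetSum hy)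
    rw [Finset.mem_filter, Finset.mem_range] at hj
    obtain rfl := Finset.mem_singleton.1 (Finsupp.support_single_subset hy)
    have h1 : P.val Γ (P.vert c j) < P.val Γ v := Top.lt P Γ h hj.1 hj.2.1
    have h2 : P.val Γ (P.vert c (j + 1)) < P.val Γ v := by
      rw [← P.vert_mod]
      refine Top.lt P Γ h (Nat.mod_lt _ (by omega)) fun e => hj.2.2 ?_
      rcases Nat.lt_or_ge (j + 1) (size c.1) with h0 | h0
      · rw [Nat.mod_eq_of_lt h0] at e
        rcases Nat.lt_or_ge (k' + 1) (size c.1) with h3 | h3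
        · have := hmod.1; rw [Nat.mod_eq_of_lt h3] at this; omega
        · have h4 : k' + 1 = size c.1 := by omega
          have := hmod.1; rw [h4, Nat.mod_self] at this; omega
      · have h4 : j + 1 = size c.1 := by omega
        rw [h4, Nat.mod_self] at e
        rcases Nat.lt_or_ge (k' + 1) (size c.1) with h3 | h3
        · have := hmod.1; rw [Nat.mod_eq_of_lt h3] at this; omega
        · omega
    have h3 := P.down_top Γ (P.side c j)
    rcases P.side_ends c hj.1 with ⟨a, b⟩ | ⟨a, b⟩ <;> rcases h3.ends with ⟨d, -⟩ | ⟨d, -⟩ <;>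
      rw [← d] <;> first | rwa [a] | rwa [b]
  have hrank : ∀ {e : Orb P.K} {s : ℕ}, P.Down Γ e v s →
      P.rank Γ e = P.height Γ v * 100 + depth (P.order Γ v) s := by
    intro e s hd
    rw [rank, hd.eq_top.1, hd.eq_top.2]
  have hlow' : ∀ {e : Orb P.K} {s : ℕ}, P.Down Γ e v s → ∀ y ∈ w.support,
      P.rank Γ y < P.rank Γ e := by
    intro e s hd y hy
    refine P.rank_lt_of_top Γ ?_
    rw [hd.eq_top.1]
    exact hlow y hy
  have hsupp : ∀ {e e' : Orb P.K}, P.rank Γ e' < P.rank Γ e →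
      (∀ y ∈ w.support, P.rank Γ y < P.rank Γ e) →
      ∀ y ∈ (Finsupp.single e' 1 + w : Orb P.K →₀ ZMod 2).support, P.rank Γ y < P.rank Γ e := by
    classical
    intro e e' h1 h2 y hy
    rcases Finset.mem_union.1 (Finsupp.support_add hy) with h | h
    · rwa [Finset.mem_singleton.1 (Finsupp.support_single_subset h)]
    · exact h2 y h
  rcases lt_trichotomy (depth (P.order Γ v) x.1) (depth (P.order Γ v) x.2.1) with hd | hd | hd
  · refine ⟨_, m1, _, m2, hd, Or.inr ⟨rfl, rfl⟩, _, e1, Finsupp.single (P.side c k') 1 + w,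
      hsupp ?_ (hlow' e1), ?_⟩
    · rw [hrank e1, hrank e2]; omega
    · rw [hsum, add_assoc]
  · exact absurd (depth_inj m2 m1 hd) hl.2.2.1
  · refine ⟨_, m2, _, m1, hd, Or.inl ⟨rfl, rfl⟩, _, e2, Finsupp.single (P.side c k) 1 + w,
      hsupp ?_ (hlow' e2), ?_⟩
    · rw [hrank e1, hrank e2]; omega
    · rw [hsum, add_comm (Finsupp.single (P.side c k) 1), add_assoc]

end Param

end BianchiHomology

namespace BianchiHomology

namespace Param

variable {G : Type} [Group G] (P : Param G) (Γ : Generic)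

lemma lead_injective {c c' : Orb P.J} {e : Orb P.K} (h : P.Lead Γ c e) (h' : P.Lead Γ c' e) :
    c = c' := by
  obtain ⟨v, x, hx⟩ := P.exists_top Γ c
  obtain ⟨v', x', hx'⟩ := P.exists_top Γ c'
  obtain ⟨s, hs, u, hu, hlt, hj, e₁, hd, hle⟩ := hx.lead
  obtain ⟨s', hs', u', hu', hlt', hj', e₂, hd', hle'⟩ := hx'.lead
  obtain rfl := P.lead_unique Γ h hle
  obtain rfl := P.lead_unique Γ h' hle'
  obtain rfl := hd.eq_top.1.symm.trans hd'.eq_top.1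
  obtain rfl := hd.eq_top.2.symm.trans hd'.eq_top.2
  obtain ⟨ρ, hρ, hmin, huniq⟩ := P.order_root Γ (List.ne_nil_of_mem hs)
  obtain ⟨y, hy, -, hy'⟩ := huniq s hs (fun e => absurd (hmin u hu) (by rw [← e]; omega))
  have e1 := hy' x hx.1.1 ⟨u, hu, hlt, hj⟩
  have e2 := hy' x' hx'.1.1 ⟨u', hu', hlt', hj'⟩
  subst e1
  subst e2
  exact P.isCell_ext hx.1 hx'.1

lemma exists_lead (c : Orb P.J) : ∃ e, P.Lead Γ c e := by
  obtain ⟨v, x, hx⟩ := P.exists_top Γ c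
  obtain ⟨-, -, -, -, -, -, e, -, h⟩ := hx.lead
  exact ⟨e, h⟩

/-- The leading edge of a two-cell. -/
noncomputable def lead (c : Orb P.J) : Orb P.K := (P.exists_lead Γ c).choose

lemma lead_spec (c : Orb P.J) : P.Lead Γ c (P.lead Γ c) := (P.exists_lead Γ c).choose_spec

lemma exists_lowest : ∃ v₀ : Orb P.H, (∀ v, ¬ P.height Γ v < P.height Γ v₀) ∧
    ∀ v, v ≠ v₀ → P.order Γ v ≠ [] := by
  have : Nonempty (Orb P.H) := ⟨⟨0, ((1 : G) : G ⧸ P.H 0)⟩⟩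
  refine ⟨Function.argmin (P.height Γ), fun v => Function.not_lt_argmin _ v, fun v hv h => hv (P.val_injective Γ ?_)⟩
  refine le_antisymm (P.minimal_of_not_below Γ h _) (not_lt.1 fun hlt => ?_)
  exact Function.not_lt_argmin (P.height Γ) v ((P.height_lt_iff Γ).2 hlt)

lemma exists_root (v : Orb P.H) (hv : P.order Γ v ≠ []) : ∃ e s, P.Down Γ e v s ∧
    ∀ e', P.top Γ e' = v → e' = e ∨ ∃ c, P.lead Γ c = e' := by
  obtain ⟨ρ, hρ, hmin, huniq⟩ := P.order_root Γ hv
  obtain ⟨h1, h2⟩ := (P.mem_order Γ).1 hρ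
  obtain ⟨e, he⟩ := P.exists_edge h1
  refine ⟨e, ρ, ⟨he, h2⟩, fun e' he' => ?_⟩
  subst he'
  by_cases hi : P.idx Γ e' = ρ
  · exact Or.inl (P.isEdge_ext (hi ▸ (P.down_top Γ e').1) he)
  · right
    obtain ⟨x, hx, ⟨u, hu, hlt, hj⟩, hy⟩ := huniq _ (P.idx_mem Γ e') hi
    obtain ⟨c, hc⟩ := P.exists_cell hx
    have hb := ((P.mem_order Γ).1 hu).2
    have hb' := (P.down_top Γ e').2
    have hT : P.Top Γ c (P.top Γ e') x := by
      refine ⟨hc, ?_⟩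
      rcases hj with ⟨h3, h4⟩ | ⟨h3, h4⟩ <;> rw [h3, h4]
      · exact ⟨hb', hb⟩
      · exact ⟨hb, hb'⟩
    obtain ⟨s, hs, u', hu', hlt', hj', e₁, hd, hle⟩ := hT.lead
    have hsi : s = P.idx Γ e' := by
      rcases hj with ⟨h3, h4⟩ | ⟨h3, h4⟩ <;> rcases hj' with ⟨h5, h6⟩ | ⟨h5, h6⟩
      · omega
      · rw [← h5, ← h6, h3, h4] at hlt'; omega
      · rw [← h5, ← h6, h3, h4] at hlt'; omega
      · omega
    subst hsi
    refine ⟨c, ?_⟩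
    rw [P.lead_unique Γ (P.lead_spec Γ c) hle]
    exact P.isEdge_ext hd.1 (P.down_top Γ e').1

lemma Down.boundary {e : Orb P.K} {v : Orb P.H} {s : ℕ} (h : P.Down Γ e v s) :
    ∃ u, P.height Γ u < P.height Γ v ∧ P.d₁.hom (Finsupp.single e 1) =
      (Finsupp.single v 1 + Finsupp.single u 1 : Orb P.H →₀ ZMod 2) := by
  rcases h.ends with ⟨h1, h2⟩ | ⟨h1, h2⟩
  · exact ⟨_, (P.height_lt_iff Γ).2 h2, by rw [d₁_single, h1]⟩
  · exact ⟨_, (P.height_lt_iff Γ).2 h2, by rw [d₁_single, h1, add_comm]⟩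

lemma eq_zero_of_single {X : Type} {M : Type} [AddCommGroup M] [Module (ZMod 2) M]
    (f : (X →₀ ZMod 2) →ₗ[ZMod 2] M) (h : ∀ x, f (Finsupp.single x 1) = 0) (c : X →₀ ZMod 2) :
    f c = 0 := by
  have : f = 0 := Finsupp.lhom_ext' fun x => LinearMap.ext_ring (h x)
  rw [this, LinearMap.zero_apply]

/-- The boundary map from edges to vertices as a linear map. -/
noncomputable def l₁ : (Orb P.K →₀ ZMod 2) →ₗ[ZMod 2] (Orb P.H →₀ ZMod 2) :=
  P.d₁.hom.toLinearMap

/-- The boundary map from two-cells to edges as a linear map. -/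
noncomputable def l₂ : (Orb P.J →₀ ZMod 2) →ₗ[ZMod 2] (Orb P.K →₀ ZMod 2) :=
  P.d₂.hom.toLinearMap

lemma l₂_injective : Function.Injective P.l₂ := by
  obtain ⟨Γ⟩ := exists_generic
  refine injective_of_leading (μ := P.lead Γ) (r := P.rank Γ) (fun c c' h => ?_) (P.lead_spec Γ)
  have := P.lead_spec Γ c'
  rw [← h] at this
  exact P.lead_injective Γ (P.lead_spec Γ c) this

lemma l₂_l₁_exact : Function.Exact P.l₂ P.l₁ := by
  obtain ⟨Γ⟩ := exists_generic
  obtain ⟨v₀, hmin, hv₀⟩ := P.exists_lowest Γ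
  choose ν s hν hcov using fun v : {v // v ≠ v₀} => P.exists_root Γ v (hv₀ v v.2)
  refine exact_of_leading (μ := P.lead Γ) (rE := P.rank Γ) (rV := P.height Γ)
    (j := (Subtype.val : {v // v ≠ v₀} → Orb P.H)) Subtype.val_injective (ν := ν) ?_
    (P.lead_spec Γ) ?_ ?_
  · exact eq_zero_of_single (P.l₁ ∘ₗ P.l₂) P.d₁_d₂_single
  · intro v
    obtain ⟨u, hu, h⟩ := (hν v).boundary
    refine ⟨Finsupp.single u 1, fun y hy => ?_, h⟩
    rwa [Finset.mem_singleton.1 (Finsupp.support_single_subset hy)]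
  · intro e
    have hne : P.top Γ e ≠ v₀ := by
      intro h
      obtain ⟨u, hu, -⟩ := (P.down_top Γ e).boundary
      exact hmin u (h ▸ hu)
    rcases hcov ⟨_, hne⟩ e rfl with h | h
    · exact Or.inr ⟨_, h.symm⟩
    · exact Or.inl h

lemma l₁_exact : Function.Exact P.l₁
    (Finsupp.linearCombination (ZMod 2) (fun _ : Orb P.H => (1 : ZMod 2))) := by
  obtain ⟨Γ⟩ := exists_generic
  obtain ⟨v₀, -, hv₀⟩ := P.exists_lowest Γ
  refine exact_augmentation (rV := P.height Γ) v₀ ?_ ?_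
  · refine eq_zero_of_single ((Finsupp.linearCombination (ZMod 2)
      (fun _ : Orb P.H => (1 : ZMod 2))) ∘ₗ P.l₁) fun e => ?_
    have h : P.l₁ (Finsupp.single e 1) =
      Finsupp.single (P.end₀ e) 1 + Finsupp.single (P.end₁ e) 1 := P.d₁_single e
    rw [LinearMap.comp_apply, h, map_add, Finsupp.linearCombination_single,
      Finsupp.linearCombination_single]
    decide
  · intro v hv
    obtain ⟨e, s, hd, -⟩ := P.exists_root Γ v (hv₀ v hv)
    obtain ⟨u, hu, h⟩ := hd.boundary
    exact ⟨e, u, hu, h⟩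

end Param

end BianchiHomology

namespace BianchiHomology

namespace IMat

/-- The first character modulo the prime above two. -/
def chi₁ (m : IMat) : ZMod 2 :=
  let A : ZMod 2 := m.a + m.a'
  let B : ZMod 2 := m.b + m.b'
  let C : ZMod 2 := m.c + m.c'
  let D : ZMod 2 := m.d + m.d'
  B + C + B * C * (1 + A) * (1 + D)

/-- The second character, through the square of the prime above two. -/
def chi₂ (m : IMat) : ZMod 2 :=
  let A : ZMod 2 := m.a + m.a'
  let B : ZMod 2 := m.b + m.b'
  let C : ZMod 2 := m.c + m.c'
  let D : ZMod 2 := m.d + m.d'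
  (D * m.a' + B * m.c') + (D * m.b' + B * m.d') + (C * m.a' + A * m.c')

lemma chi₁_mul_aux : ∀ A B C D : ZMod 2, A * D + B * C = 1 → ∀ E F G H : ZMod 2,
    E * H + F * G = 1 →
    (A * F + B * H) + (C * E + D * G) + (A * F + B * H) * (C * E + D * G) *
      (1 + (A * E + B * G)) * (1 + (C * F + D * H)) =
    (B + C + B * C * (1 + A) * (1 + D)) + (F + G + F * G * (1 + E) * (1 + H)) := by
  decide +kernel

lemma chi₂_mul_aux : ∀ A B C D : ZMod 2, A * D + B * C = 1 → ∀ a b c d : ZMod 2,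
    D * a + A * d + C * b + B * c = 0 → ∀ E F G H : ZMod 2, E * H + F * G = 1 →
    ∀ e f g h : ZMod 2, H * e + E * h + G * f + F * g = 0 →
    ((C * F + D * H) * (A * e + a * E + B * g + b * G) +
      (A * F + B * H) * (C * e + c * E + D * g + d * G)) +
    ((C * F + D * H) * (A * f + a * F + B * h + b * H) +
      (A * F + B * H) * (C * f + c * F + D * h + d * H)) +
    ((C * E + D * G) * (A * e + a * E + B * g + b * G) +
      (A * E + B * G) * (C * e + c * E + D * g + d * G)) =
    ((D * a + B * c) + (D * b + B * d) + (C * a + A * c)) +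
      ((H * e + F * g) + (H * f + F * h) + (G * e + E * g)) := by
  decide +kernel

lemma two_eq_zero : (2 : ZMod 2) = 0 := by decide

lemma Unimod.mod_two {m : IMat} (hm : m.Unimod) :
    ((m.a + m.a') * (m.d + m.d') + (m.b + m.b') * (m.c + m.c') : ZMod 2) = 1 ∧
    ((m.d + m.d') * m.a' + (m.a + m.a') * m.d' + (m.c + m.c') * m.b' + (m.b + m.b') * m.c' :
      ZMod 2) = 0 := by
  have h1 := congrArg (Int.cast : ℤ → ZMod 2) hm.1
  have h2 := congrArg (Int.cast : ℤ → ZMod 2) hm.2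
  push_cast at h1 h2
  constructor
  · linear_combination h1 + h2 + (7 * m.a' * m.d' + m.b * m.c + m.b * m.c' + m.b' * m.c
      - 6 * m.b' * m.c' : ZMod 2) * two_eq_zero
  · linear_combination h2 + (m.a' * m.d' + m.b * m.c' + m.b' * m.c + m.b' * m.c' : ZMod 2) *
      two_eq_zero

/-- The reduction of an integral row times an integral column. -/
lemma dot_mod_two (a a' e e' b b' g g' : ℤ) :
    (((a * e - 13 * (a' * e') + (b * g - 13 * (b' * g')) : ℤ) : ZMod 2) +
      ((a * e' + a' * e + (b * g' + b' * g) : ℤ) : ZMod 2) =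
      (a + a') * (e + e') + (b + b') * (g + g')) ∧
    ((a * e' + a' * e + (b * g' + b' * g) : ℤ) : ZMod 2) =
      (a + a') * e' + a' * (e + e') + (b + b') * g' + b' * (g + g') := by
  push_cast
  constructor
  · linear_combination (-7 * (a' * e' + b' * g') : ZMod 2) * two_eq_zero
  · linear_combination (-(a' * e' + b' * g') : ZMod 2) * two_eq_zero

lemma chi₁_mul {m n : IMat} (hm : m.Unimod) (hn : n.Unimod) :
    (m.mul n).chi₁ = m.chi₁ + n.chi₁ := by
  simp only [chi₁, mul]
  rw [(dot_mod_two _ _ _ _ _ _ _ _).1, (dot_mod_two _ _ _ _ _ _ _ _).1,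
    (dot_mod_two _ _ _ _ _ _ _ _).1, (dot_mod_two _ _ _ _ _ _ _ _).1]
  exact chi₁_mul_aux _ _ _ _ hm.mod_two.1 _ _ _ _ hn.mod_two.1

lemma chi₂_mul {m n : IMat} (hm : m.Unimod) (hn : n.Unimod) :
    (m.mul n).chi₂ = m.chi₂ + n.chi₂ := by
  simp only [chi₂, mul]
  rw [(dot_mod_two _ _ _ _ _ _ _ _).1, (dot_mod_two _ _ _ _ _ _ _ _).1,
    (dot_mod_two _ _ _ _ _ _ _ _).1, (dot_mod_two _ _ _ _ _ _ _ _).1,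
    (dot_mod_two _ _ _ _ _ _ _ _).2, (dot_mod_two _ _ _ _ _ _ _ _).2,
    (dot_mod_two _ _ _ _ _ _ _ _).2, (dot_mod_two _ _ _ _ _ _ _ _).2]
  exact chi₂_mul_aux _ _ _ _ hm.mod_two.1 _ _ _ _ hm.mod_two.2 _ _ _ _ hn.mod_two.1 _ _ _ _
    hn.mod_two.2

lemma chi₁_neg (m : IMat) : m.neg.chi₁ = m.chi₁ := by
  simp only [chi₁, neg, Int.cast_neg, ZModModule.neg_eq_self]

lemma chi₂_neg (m : IMat) : m.neg.chi₂ = m.chi₂ := by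
  simp only [chi₂, neg, Int.cast_neg, ZModModule.neg_eq_self]

/-- Equality up to sign. -/
def Same (m n : IMat) : Prop := m = n ∨ m = n.neg

instance (m n : IMat) : Decidable (m.Same n) := by unfold Same; infer_instance

end IMat

namespace Param

variable {G : Type} [Group G] (P : Param G)

lemma gm_same {m n : IMat} (hn : n.Unimod) (h : m.Same n) : P.gm m = P.gm n := by
  rcases h with rfl | rfl
  · rfl
  · exact P.gm_neg hn

/-- The character of the group given by a character of matrices. -/
noncomputable def charHom (f : IMat → ZMod 2)
    (hf : ∀ {m n : IMat}, m.Unimod → n.Unimod → f (m.mul n) = f m + f n) (hn : ∀ m, f m.neg = f m) :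
    G →* Multiplicative (ZMod 2) :=
  MonoidHom.mk' (fun g => Multiplicative.ofAdd (f (P.surj g).choose)) (by
    intro g h
    obtain ⟨h1, h2⟩ := (P.surj g).choose_spec
    obtain ⟨h3, h4⟩ := (P.surj h).choose_spec
    obtain ⟨h5, h6⟩ := (P.surj (g * h)).choose_spec
    rw [← ofAdd_add, ← hf h1 h3]
    refine congrArg _ ?_
    rcases P.gm_eq h5 (h1.mul h3) (by rw [P.gm_mul h1 h3, h2, h4, h6]) with e | e
    · rw [e]
    · exact (congrArg f e).trans (hn _))

lemma charHom_gm {f : IMat → ZMod 2}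
    (hf : ∀ {m n : IMat}, m.Unimod → n.Unimod → f (m.mul n) = f m + f n) (hn : ∀ m, f m.neg = f m)
    {m : IMat} (hm : m.Unimod) : P.charHom f hf hn (P.gm m) = Multiplicative.ofAdd (f m) := by
  obtain ⟨h1, h2⟩ := (P.surj (P.gm m)).choose_spec
  refine congrArg Multiplicative.ofAdd ?_
  rcases P.gm_eq h1 hm h2 with e | e
  · rw [e]
  · exact (congrArg f e).trans (hn _)

/-- The first character. -/
noncomputable def χ₁ : G →* Multiplicative (ZMod 2) :=
  P.charHom IMat.chi₁ IMat.chi₁_mul IMat.chi₁_neg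

/-- The second character. -/
noncomputable def χ₂ : G →* Multiplicative (ZMod 2) :=
  P.charHom IMat.chi₂ IMat.chi₂_mul IMat.chi₂_neg

lemma χ₁_gm {m : IMat} (hm : m.Unimod) : P.χ₁ (P.gm m) = Multiplicative.ofAdd m.chi₁ :=
  P.charHom_gm _ _ hm

lemma χ₂_gm {m : IMat} (hm : m.Unimod) : P.χ₂ (P.gm m) = Multiplicative.ofAdd m.chi₂ :=
  P.charHom_gm _ _ hm

/-- A rotation and a reflection in each of the dihedral vertex stabilisers. -/
def dihedralGen : List (Fin 8 × ℕ × ℕ) := [(0, 4, 1), (1, 1, 3), (4, 4, 1), (5, 1, 3)]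

lemma dihedral_table : ∀ x ∈ dihedralGen,
    x.2.1 < (stab x.1).length ∧ x.2.2 < (stab x.1).length ∧
    ((stabAt x.1 x.2.1).mul ((stabAt x.1 x.2.1).mul (stabAt x.1 x.2.1))).Same IMat.one ∧
    ((stabAt x.1 x.2.2).mul (stabAt x.1 x.2.2)).Same IMat.one ∧
    ((stabAt x.1 x.2.2).mul (stabAt x.1 x.2.1)).Same
      (((stabAt x.1 x.2.1).mul (stabAt x.1 x.2.1)).mul (stabAt x.1 x.2.2)) ∧
    (stabAt x.1 x.2.2).chi₁ = 1 ∧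
    ∀ n < (stab x.1).length, (stabAt x.1 n).Same IMat.one ∨
      (stabAt x.1 n).Same (stabAt x.1 x.2.1) ∨
      (stabAt x.1 n).Same ((stabAt x.1 x.2.1).mul (stabAt x.1 x.2.1)) ∨
      (stabAt x.1 n).Same (stabAt x.1 x.2.2) ∨
      (stabAt x.1 n).Same ((stabAt x.1 x.2.1).mul (stabAt x.1 x.2.2)) ∨
      (stabAt x.1 n).Same (((stabAt x.1 x.2.1).mul (stabAt x.1 x.2.1)).mul (stabAt x.1 x.2.2)) := by
  decide +kernel

lemma hasDim_H_dihedral {i : Fin 8} {j k : ℕ} (h : (i, j, k) ∈ dihedralGen) (n : ℕ) :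
    HasDim (HC (P.H i) n) 1 := by
  obtain ⟨hj, hk, h3, h2, hc, hχ, hl⟩ := dihedral_table _ h
  dsimp only at hj hk h3 h2 hc hχ hl
  have uj := stabAt_unimod hj
  have uk := stabAt_unimod hk
  have ujj := uj.mul uj
  have e3 := P.gm_same IMat.unimod_one h3
  have e2 := P.gm_same IMat.unimod_one h2
  have ec := P.gm_same (ujj.mul uk) hc
  rw [P.gm_mul uj ujj, P.gm_mul uj uj, P.gm_one] at e3
  rw [P.gm_mul uk uk, P.gm_one] at e2
  rw [P.gm_mul uk uj, P.gm_mul ujj uk, P.gm_mul uj uj, ← sq] at ec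
  refine hasDim_dihedral (χ := P.χ₁) (r := P.gm (stabAt i j)) (σ := P.gm (stabAt i k))
    (P.mem_H.2 ⟨j, hj, rfl⟩) (P.mem_H.2 ⟨k, hk, rfl⟩) ?_ e2 ec ?_ ?_ n
  · rw [pow_succ', sq, e3]
  · intro g hg
    obtain ⟨l, hll, rfl⟩ := P.mem_H.1 hg
    rcases hl l hll with e | e | e | e | e | e
    · exact ⟨0, Or.inl (by rw [P.gm_same IMat.unimod_one e, P.gm_one, pow_zero])⟩
    · exact ⟨1, Or.inl (by rw [P.gm_same uj e, pow_one])⟩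
    · exact ⟨2, Or.inl (by rw [P.gm_same ujj e, P.gm_mul uj uj, sq])⟩
    · exact ⟨0, Or.inr (by rw [P.gm_same uk e, pow_zero, one_mul])⟩
    · exact ⟨1, Or.inr (by rw [P.gm_same (uj.mul uk) e, P.gm_mul uj uk, pow_one])⟩
    · exact ⟨2, Or.inr (by rw [P.gm_same (ujj.mul uk) e, P.gm_mul ujj uk, P.gm_mul uj uj, sq])⟩
  · rw [P.χ₁_gm uk, hχ]

/-- Generators of each of the vertex stabilisers that are Klein four-groups. -/
def kleinGen : List (Fin 8 × ℕ × ℕ) := [(2, 1, 2), (6, 2, 1)]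

lemma klein_table : ∀ x ∈ kleinGen,
    x.2.1 < (stab x.1).length ∧ x.2.2 < (stab x.1).length ∧
    ((stabAt x.1 x.2.1).mul (stabAt x.1 x.2.1)).Same IMat.one ∧
    (stabAt x.1 x.2.1).chi₁ = 0 ∧ (stabAt x.1 x.2.2).chi₁ = 1 ∧ (stabAt x.1 x.2.1).chi₂ = 1 ∧
    ∀ n < (stab x.1).length, (stabAt x.1 n).Same IMat.one ∨
      (stabAt x.1 n).Same (stabAt x.1 x.2.1) ∨ (stabAt x.1 n).Same (stabAt x.1 x.2.2) ∨
      (stabAt x.1 n).Same ((stabAt x.1 x.2.1).mul (stabAt x.1 x.2.2)) := by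
  decide +kernel

lemma hasDim_H_klein {i : Fin 8} {j k : ℕ} (h : (i, j, k) ∈ kleinGen) (n : ℕ) :
    HasDim (HC (P.H i) n) (n + 1) := by
  obtain ⟨hj, hk, h2, h10, h11, h21, hl⟩ := klein_table _ h
  dsimp only at hj hk h2 h10 h11 h21 hl
  have uj := stabAt_unimod hj
  have uk := stabAt_unimod hk
  have e2 := P.gm_same IMat.unimod_one h2
  rw [P.gm_mul uj uj, P.gm_one] at e2
  refine hasDim_klein (χ := P.χ₁) (χ' := P.χ₂) (σ := P.gm (stabAt i j)) (τ := P.gm (stabAt i k))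
    (P.mem_H.2 ⟨j, hj, rfl⟩) (P.mem_H.2 ⟨k, hk, rfl⟩) e2 ?_ ?_ ?_ ?_ n
  · intro g hg
    obtain ⟨l, hll, rfl⟩ := P.mem_H.1 hg
    rcases hl l hll with e | e | e | e
    · exact Or.inl ((P.gm_same IMat.unimod_one e).trans P.gm_one)
    · exact Or.inr (Or.inl (P.gm_same uj e))
    · exact Or.inr (Or.inr (Or.inl (P.gm_same uk e)))
    · exact Or.inr (Or.inr (Or.inr ((P.gm_same (uj.mul uk) e).trans (P.gm_mul uj uk))))
  · rw [P.χ₁_gm uj, h10, ofAdd_zero]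
  · rw [P.χ₁_gm uk, h11]
  · rw [P.χ₂_gm uj, h21]

lemma trivial_table : ∀ i ∈ ([3, 7] : List (Fin 8)),
    ∀ n < (stab i).length, (stabAt i n).Same IMat.one := by
  decide +kernel

lemma hasDim_H_trivial {i : Fin 8} (h : i ∈ ([3, 7] : List (Fin 8))) (n : ℕ) :
    HasDim (HC (P.H i) (n + 1)) 0 := by
  have hb : P.H i = ⊥ := by
    refine (Subgroup.eq_bot_iff_forall _).2 fun g hg => ?_
    obtain ⟨l, hl, rfl⟩ := P.mem_H.1 hg
    exact (P.gm_same IMat.unimod_one (trivial_table i h l hl)).trans P.gm_one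
  have : Subsingleton (HC (P.H i) (n + 1)) := subsingleton_of_bot hb n
  exact HasDim.of_subsingleton

lemma hasDim_H (n : ℕ) (i : Fin 8) :
    HasDim (HC (P.H i) (n + 1)) ((![1, 1, n + 2, 0, 1, 1, n + 2, 0] : Fin 8 → ℕ) i) := by
  fin_cases i
  · exact P.hasDim_H_dihedral (i := 0) (j := 4) (k := 1) (by decide) _
  · exact P.hasDim_H_dihedral (i := 1) (j := 1) (k := 3) (by decide) _
  · exact P.hasDim_H_klein (i := 2) (j := 1) (k := 2) (by decide) _
  · exact P.hasDim_H_trivial (i := 3) (by decide) _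
  · exact P.hasDim_H_dihedral (i := 4) (j := 4) (k := 1) (by decide) _
  · exact P.hasDim_H_dihedral (i := 5) (j := 1) (k := 3) (by decide) _
  · exact P.hasDim_H_klein (i := 6) (j := 2) (k := 1) (by decide) _
  · exact P.hasDim_H_trivial (i := 7) (by decide) _

/-- The position of a generator of the stabiliser of an edge among the elements fixing its
origin. -/
def edgeGen : Fin 19 → ℕ := ![0, 0, 4, 0, 1, 0, 1, 0, 0, 0, 0, 0, 0, 2, 2, 5, 5, 3, 1]

/-- A generator of the stabiliser of an edge. -/
def edgeRot (o : Fin 19) : IMat := stabAt (edgeEnds o).1 (edgeGen o)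

lemma edge_table (o : Fin 19) : edgeGen o < (stab (edgeEnds o).1).length ∧
    Vec.act (edgeRot o) (edgeTip o) = edgeTip o ∧
    (edgeValue o = 0 → ((edgeRot o).mul ((edgeRot o).mul (edgeRot o))).Same IMat.one) ∧
    (edgeValue o ≠ 0 → (edgeRot o).chi₁ = (edgeValue o).1 ∧ (edgeRot o).chi₂ = (edgeValue o).2) ∧
    ∀ n < (stab (edgeEnds o).1).length,
      Vec.act (stabAt (edgeEnds o).1 n) (edgeTip o) = edgeTip o →
      (stabAt (edgeEnds o).1 n).Same IMat.one ∨ (stabAt (edgeEnds o).1 n).Same (edgeRot o) ∨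
      (edgeValue o = 0 ∧ (stabAt (edgeEnds o).1 n).Same ((edgeRot o).mul (edgeRot o))) := by
  revert o
  decide +kernel

lemma edge_stabiliser (o : Fin 19) :
    (edgeValue o = 0 ∧ ∀ n, Subsingleton (HC (P.K o) (n + 1))) ∨
    (edgeValue o ≠ 0 ∧ ∃ σ ∈ P.K o, (∀ g ∈ P.K o, g = 1 ∨ g = σ) ∧
      P.χ₁ σ = Multiplicative.ofAdd (edgeValue o).1 ∧
      P.χ₂ σ = Multiplicative.ofAdd (edgeValue o).2) := by
  obtain ⟨hj, ht, h3, hχ, hl⟩ := edge_table o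
  have uj : (edgeRot o).Unimod := stabAt_unimod hj
  have hr : P.gm (edgeRot o) ∈ P.K o :=
    Subgroup.mem_inf.2 ⟨P.mem_H.2 ⟨_, hj, rfl⟩, P.mem_fix.2 ((P.sm_gm uj _).trans ht)⟩
  have key : ∀ g ∈ P.K o, g = 1 ∨ g = P.gm (edgeRot o) ∨
      (edgeValue o = 0 ∧ g = P.gm (edgeRot o) * P.gm (edgeRot o)) := by
    intro g hg
    obtain ⟨hg1, hg2⟩ := Subgroup.mem_inf.1 hg
    obtain ⟨l, hll, rfl⟩ := P.mem_H.1 hg1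
    rcases hl l hll ((P.sm_gm (stabAt_unimod hll) _).symm.trans (P.mem_fix.1 hg2)) with
      e | e | ⟨h0, e⟩
    · exact Or.inl ((P.gm_same IMat.unimod_one e).trans P.gm_one)
    · exact Or.inr (Or.inl (P.gm_same uj e))
    · exact Or.inr (Or.inr ⟨h0, (P.gm_same (uj.mul uj) e).trans (P.gm_mul uj uj)⟩)
  by_cases h0 : edgeValue o = 0
  · refine Or.inl ⟨h0, fun n => subsingleton_of_order_three hr ?_ ?_ n⟩
    · have e3 := P.gm_same IMat.unimod_one (h3 h0)
      rw [P.gm_mul uj (uj.mul uj), P.gm_mul uj uj, P.gm_one] at e3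
      rw [pow_succ', sq, e3]
    · intro g hg
      rcases key g hg with e | e | ⟨-, e⟩
      · exact ⟨0, by rw [e, pow_zero]⟩
      · exact ⟨1, by rw [e, pow_one]⟩
      · exact ⟨2, by rw [e, sq]⟩
  · refine Or.inr ⟨h0, _, hr, fun g hg => ?_, ?_, ?_⟩
    · rcases key g hg with e | e | ⟨e, -⟩
      · exact Or.inl e
      · exact Or.inr e
      · exact absurd e h0
    · rw [P.χ₁_gm uj, (hχ h0).1]
    · rw [P.χ₂_gm uj, (hχ h0).2]

lemma exists_involution {i : Fin 8} {n : ℕ} (hn : n < (stab i).length)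
    (h2 : ((stabAt i n).mul (stabAt i n)).Same IMat.one) :
    ∃ σ ∈ P.H i, σ * σ = 1 ∧ P.χ₁ σ = Multiplicative.ofAdd (stabAt i n).chi₁ ∧
      P.χ₂ σ = Multiplicative.ofAdd (stabAt i n).chi₂ := by
  have u := stabAt_unimod hn
  refine ⟨_, P.mem_H.2 ⟨n, hn, rfl⟩, ?_, P.χ₁_gm u, P.χ₂_gm u⟩
  rw [← P.gm_mul u u, P.gm_same IMat.unimod_one h2, P.gm_one]

lemma orbCoord_d₁ (o : Fin 19) :
    orbCoord P.H (P.d₁.hom (Finsupp.single ⟨o, ((1 : G) : G ⧸ P.K o)⟩ 1)) = edgeMatrix o := by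
  rw [d₁_single]
  refine (map_add (orbCoord P.H) _ _).trans ?_
  rw [orbCoord_single, orbCoord_single]
  funext i
  rw [Pi.add_apply, Pi.single_apply, Pi.single_apply]
  rfl

lemma sum_side_table : ∀ (t : Fin 11) (o : Fin 19),
    ∑ k ∈ Finset.range (size t), (if o = (bdryAt t k).1 then (1 : ZMod 2) else 0) =
      cellMatrix t o := by
  decide +kernel

lemma orbCoord_d₂ (t : Fin 11) :
    orbCoord P.K (P.d₂.hom (Finsupp.single ⟨t, ((1 : G) : G ⧸ P.J t)⟩ 1)) = cellMatrix t := by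
  rw [d₂_single]
  refine (map_sum (orbCoord P.K) _ _).trans ?_
  funext o
  rw [Finset.sum_apply, ← sum_side_table]
  refine Finset.sum_congr rfl fun k _ => ?_
  rw [orbCoord_single, Pi.single_apply]
  rfl

/-- The cell structure attached to a parametrisation of the group by integral matrices. -/
noncomputable def cellData : CellData G where
  χ₁ := P.χ₁
  χ₂ := P.χ₂
  H := P.H
  K := P.K
  J := P.J
  hJ _ := rfl
  d₂ := P.d₂
  d₁ := P.d₁
  inj := P.l₂_injective
  exact₁ := P.l₂_l₁_exact
  exact₀ := P.l₁_exact
  hN₁ := P.orbCoord_d₁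
  hN₂ := P.orbCoord_d₂
  hE := P.edge_stabiliser
  hV := P.hasDim_H
  hσ₀ := by
    obtain ⟨σ, h, h2, e1, e2⟩ := P.exists_involution (i := 0) (n := 1) (by decide +kernel)
      (by decide +kernel)
    have t1 : (stabAt 0 1).chi₁ = 1 := by decide +kernel
    have t2 : (stabAt 0 1).chi₂ = 0 := by decide +kernel
    exact ⟨σ, h, h2, by rw [e1, t1], by rw [e2, t2, ofAdd_zero]⟩
  hσ₁ := by
    obtain ⟨σ, h, h2, -, e2⟩ := P.exists_involution (i := 1) (n := 3) (by decide +kernel)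
      (by decide +kernel)
    have t2 : (stabAt 1 3).chi₂ = 1 := by decide +kernel
    exact ⟨σ, h, h2, by rw [e2, t2]⟩

end Param

end BianchiHomology

namespace BianchiHomology

section RingOfIntegers

variable {K : Type} [Field K] [NumberField K] {α : K}

lemma sq_ne_neg_thirteen (q : ℚ) : q ^ 2 ≠ -13 := by
  nlinarith [sq_nonneg q]

lemma exists_rat_coords (hdeg : Module.finrank ℚ K = 2) (hα : α ^ 2 = -13) (x : K) :
    ∃ p q : ℚ, x = p + q * α := by
  have hli : LinearIndependent ℚ ![(1 : K), α] := by
    rw [LinearIndependent.pair_iff' one_ne_zero]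
    intro a ha
    apply sq_ne_neg_thirteen a
    rw [Rat.smul_def, mul_one] at ha
    rw [← ha] at hα
    exact_mod_cast hα
  have hs := hli.span_eq_top_of_card_eq_finrank' (by rw [hdeg, Fintype.card_fin])
  have hx : x ∈ Submodule.span ℚ (Set.range ![(1 : K), α]) := hs ▸ Submodule.mem_top
  rw [Matrix.range_cons, Matrix.range_cons, Matrix.range_empty, Set.union_empty,
    Set.singleton_union, Submodule.mem_span_pair] at hx
  obtain ⟨p, q, h⟩ := hx
  exact ⟨p, q, by rw [← h, Rat.smul_def, Rat.smul_def, mul_one]⟩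

lemma exists_int_of_integral {p q : ℚ} (h1 : ∃ t : ℤ, 2 * p = t)
    (h2 : ∃ n : ℤ, p ^ 2 + 13 * q ^ 2 = n) : ∃ a b : ℤ, p = a ∧ q = b := by
  obtain ⟨t, ht⟩ := h1
  obtain ⟨n, hn⟩ := h2
  have hsq : (26 * q) ^ 2 = ((13 * (4 * n - t ^ 2) : ℤ) : ℚ) := by
    push_cast
    rw [← ht, ← hn]
    ring
  obtain ⟨m, hm⟩ := IsIntegrallyClosed.exists_algebraMap_eq_of_isIntegral_pow (R := ℤ) (K := ℚ)
    (x := 26 * q) two_pos (by rw [hsq]; exact isIntegral_algebraMap)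
  rw [eq_intCast] at hm
  rw [← hm] at hsq
  have hm2 : m ^ 2 = 13 * (4 * n - t ^ 2) := by exact_mod_cast hsq
  obtain ⟨s, rfl⟩ : (13 : ℤ) ∣ m :=
    (Int.prime_ofNat_iff.2 (by norm_num : Nat.Prime 13)).dvd_of_dvd_pow (hm2 ▸ dvd_mul_right _ _)
  have hs : 13 * s ^ 2 + t ^ 2 = 4 * n := by linarith
  have hq : (2 : ℚ) * q = s := by push_cast at hm; linarith
  rcases Int.even_or_odd' s with ⟨b, rfl | rfl⟩ <;> rcases Int.even_or_odd' t with ⟨a, rfl | rfl⟩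
  · exact ⟨a, b, by push_cast at ht; linarith, by push_cast at hq; linarith⟩
  all_goals ring_nf at hs; omega

lemma exists_int_coords (hdeg : Module.finrank ℚ K = 2) (hα : α ^ 2 = -13) {x : K}
    (hx : IsIntegral ℤ x) : ∃ a b : ℤ, x = a + b * α := by
  obtain ⟨p, q, h⟩ := exists_rat_coords hdeg hα x
  by_cases hq : q = 0
  · rw [hq, Rat.cast_zero, zero_mul, add_zero] at h
    have hp : IsIntegral ℤ p := by
      rw [h] at hx
      exact (isIntegral_algebraMap_iff (algebraMap ℚ K).injective).1 hx
    obtain ⟨a, ha⟩ := IsIntegrallyClosed.isIntegral_iff.1 hp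
    rw [eq_intCast] at ha
    exact ⟨a, 0, by rw [h, ← ha]; push_cast; ring⟩
  have hmin : minpoly ℚ x = Polynomial.X ^ 2 + (Polynomial.C (-(2 * p)) * Polynomial.X +
      Polynomial.C (p ^ 2 + 13 * q ^ 2)) := by
    have hdegree : (Polynomial.C (-(2 * p)) * Polynomial.X +
        Polynomial.C (p ^ 2 + 13 * q ^ 2) : Polynomial ℚ).degree < 2 :=
      lt_of_le_of_lt Polynomial.degree_linear_le (by norm_num)
    refine (Polynomial.eq_of_monic_of_dvd_of_natDegree_le (minpoly.monic hx.tower_top)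
      (Polynomial.monic_X_pow_add hdegree) (minpoly.dvd _ _ ?_) ?_).symm
    · simp only [map_add, map_pow, map_mul, Polynomial.aeval_X, Polynomial.aeval_C,
        eq_ratCast, h]
      push_cast
      linear_combination (q : K) ^ 2 * hα
    · refine le_trans (Polynomial.natDegree_le_of_degree_le (n := 2) ?_)
        ((minpoly.two_le_natDegree_iff hx.tower_top).2 ?_)
      · exact (Polynomial.degree_add_le _ _).trans
          (max_le (Polynomial.degree_X_pow_le 2) hdegree.le)
      rintro ⟨y, hy⟩
      apply sq_ne_neg_thirteen ((y - p) / q)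
      rw [eq_ratCast, h] at hy
      have hqK : (q : K) ≠ 0 := by exact_mod_cast hq
      have e : (((y - p) / q : ℚ) : K) = α := by
        push_cast
        rw [hy]
        field_simp
        ring
      rw [← e] at hα
      exact_mod_cast hα
  have hZ := minpoly.isIntegrallyClosed_eq_field_fractions' ℚ hx
  rw [hmin] at hZ
  have c0 := congrArg (fun f => Polynomial.coeff f 0) hZ
  have c1 := congrArg (fun f => Polynomial.coeff f 1) hZ
  simp only [Polynomial.coeff_add, Polynomial.coeff_X_pow, Polynomial.coeff_C_mul,
    Polynomial.coeff_X, Polynomial.coeff_C, Polynomial.coeff_map, eq_intCast] at c0 c1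
  norm_num at c0 c1
  obtain ⟨a, b, ha, hb⟩ := exists_int_of_integral (p := p) (q := q)
    ⟨-(minpoly ℤ x).coeff 1, by push_cast; linarith⟩ ⟨(minpoly ℤ x).coeff 0, c0⟩
  exact ⟨a, b, by rw [h, ha, hb]; norm_cast⟩

end RingOfIntegers

section Matrices

variable {R : Type} [CommRing R] (β : R)

/-- The matrix over the ring with the given integral coordinates. -/
def toMat (m : IMat) : Matrix (Fin 2) (Fin 2) R :=
  !![m.a + m.a' * β, m.b + m.b' * β; m.c + m.c' * β, m.d + m.d' * β]

variable {β}

lemma fin_two_congr {R : Type} {a b c d a' b' c' d' : R} (ha : a = a') (hb : b = b') (hc : c = c')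
    (hd : d = d') : !![a, b; c, d] = !![a', b'; c', d'] := by
  rw [ha, hb, hc, hd]

lemma toMat_mul (hβ : β ^ 2 = -13) (m n : IMat) : toMat β (m.mul n) = toMat β m * toMat β n := by
  simp only [toMat, IMat.mul, Matrix.mul_fin_two]
  push_cast
  refine fin_two_congr ?_ ?_ ?_ ?_
  · linear_combination -(m.a' * n.a' + m.b' * n.c' : R) * hβ
  · linear_combination -(m.a' * n.b' + m.b' * n.d' : R) * hβ
  · linear_combination -(m.c' * n.a' + m.d' * n.c' : R) * hβ
  · linear_combination -(m.c' * n.b' + m.d' * n.d' : R) * hβ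

lemma toMat_neg (m : IMat) : toMat β m.neg = -toMat β m := by
  ext i j
  fin_cases i <;> fin_cases j <;> simp [toMat, IMat.neg] <;> ring

lemma toMat_det (hβ : β ^ 2 = -13) (m : IMat) : (toMat β m).det =
    ((m.a * m.d - 13 * (m.a' * m.d') - (m.b * m.c - 13 * (m.b' * m.c')) : ℤ) : R) +
      ((m.a * m.d' + m.a' * m.d - (m.b * m.c' + m.b' * m.c) : ℤ) : R) * β := by
  rw [toMat, Matrix.det_fin_two_of]
  push_cast
  linear_combination (m.a' * m.d' - m.b' * m.c' : R) * hβ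

/-- Uniqueness of integral coordinates. -/
def UniqueCoords (β : R) : Prop := ∀ a a' b b' : ℤ, (a + a' * β : R) = b + b' * β → a = b ∧ a' = b'

lemma toMat_injective (hu : UniqueCoords β) : Function.Injective (toMat β) := by
  intro m n h
  have h00 := hu _ _ _ _ (congrFun (congrFun h 0) 0)
  have h01 := hu _ _ _ _ (congrFun (congrFun h 0) 1)
  have h10 := hu _ _ _ _ (congrFun (congrFun h 1) 0)
  have h11 := hu _ _ _ _ (congrFun (congrFun h 1) 1)
  exact IMat.ext h00.1 h00.2 h01.1 h01.2 h10.1 h10.2 h11.1 h11.2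

lemma toMat_det_of_unimod (hβ : β ^ 2 = -13) {m : IMat} (hm : m.Unimod) : (toMat β m).det = 1 := by
  rw [toMat_det hβ, hm.1, hm.2, Int.cast_one, Int.cast_zero, zero_mul, add_zero]

lemma unimod_of_det (hβ : β ^ 2 = -13) (hu : UniqueCoords β) {m : IMat}
    (h : (toMat β m).det = 1) : m.Unimod := by
  rw [toMat_det hβ] at h
  exact hu _ _ 1 0 (by rw [h]; push_cast; ring)

/-- The element of the special linear group with the given integral coordinates. -/
def toSL (hβ : β ^ 2 = -13) {m : IMat} (h : m.Unimod) : Matrix.SpecialLinearGroup (Fin 2) R :=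
  ⟨toMat β m, toMat_det_of_unimod hβ h⟩

/-- The class of a matrix in the projective special linear group. -/
noncomputable def toPSL (hβ : β ^ 2 = -13) (m : IMat) : PSL2 R :=
  if h : m.Unimod then
    QuotientGroup.mk (toSL hβ h)
  else 1

lemma toPSL_of_unimod (hβ : β ^ 2 = -13) {m : IMat} (h : m.Unimod) : toPSL hβ m =
    QuotientGroup.mk (toSL hβ h) :=
  dif_pos h

variable [IsDomain R]

lemma mem_center_iff_eq_one_or_neg_one (A : Matrix.SpecialLinearGroup (Fin 2) R) :
    A ∈ Subgroup.center (Matrix.SpecialLinearGroup (Fin 2) R) ↔ A = 1 ∨ A = -1 := by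
  rw [Matrix.SpecialLinearGroup.mem_center_iff]
  constructor
  · rintro ⟨r, hr, h⟩
    rw [Fintype.card_fin, sq, mul_self_eq_one_iff] at hr
    rcases hr with rfl | rfl
    · exact Or.inl (Subtype.ext (by rw [← h, map_one]; rfl))
    · exact Or.inr (Subtype.ext (by rw [← h, map_neg, map_one]; rfl))
  · rintro (rfl | rfl)
    · exact ⟨1, by simp, by simp⟩
    · refine ⟨-1, by simp, ?_⟩
      rw [map_neg, map_one]
      rfl

lemma mk_eq_mk_iff (A B : Matrix.SpecialLinearGroup (Fin 2) R) :
    (QuotientGroup.mk A : PSL2 R) = QuotientGroup.mk B ↔ A = B ∨ A = -B := by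
  rw [eq_comm, QuotientGroup.eq, mem_center_iff_eq_one_or_neg_one, inv_mul_eq_one,
    inv_mul_eq_iff_eq_mul, mul_neg, mul_one, @eq_comm _ B A]

/-- The projective special linear group as a group of integral matrices up to sign. -/
noncomputable def param (hβ : β ^ 2 = -13) (hu : UniqueCoords β)
    (hs : ∀ x : R, ∃ a b : ℤ, x = a + b * β) : Param (PSL2 R) where
  gm := toPSL hβ
  gm_mul {m n} hm hn := by
    rw [toPSL_of_unimod hβ hm, toPSL_of_unimod hβ hn, toPSL_of_unimod hβ (hm.mul hn),
      ← QuotientGroup.mk_mul]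
    exact congrArg _ (Subtype.ext (toMat_mul hβ m n))
  gm_eq {m n} hm hn h := by
    rw [toPSL_of_unimod hβ hm, toPSL_of_unimod hβ hn, mk_eq_mk_iff] at h
    rcases h with h | h
    · exact Or.inl (toMat_injective hu (congrArg Subtype.val h))
    · exact Or.inr (toMat_injective hu ((congrArg Subtype.val h).trans (toMat_neg n).symm))
  gm_neg {m} hm := by
    rw [toPSL_of_unimod hβ hm, toPSL_of_unimod hβ hm.neg, mk_eq_mk_iff]
    exact Or.inr (Subtype.ext (toMat_neg m))
  surj g := by
    obtain ⟨A, rfl⟩ := QuotientGroup.mk_surjective g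
    obtain ⟨a, a', ha⟩ := hs (A 0 0)
    obtain ⟨b, b', hb⟩ := hs (A 0 1)
    obtain ⟨c, c', hc⟩ := hs (A 1 0)
    obtain ⟨d, d', hd⟩ := hs (A 1 1)
    have e : toMat β ⟨a, a', b, b', c, c', d, d'⟩ = A.1 := by
      rw [Matrix.eta_fin_two A.1, toMat]
      exact (by rw [← ha, ← hb, ← hc, ← hd])
    have hm := unimod_of_det hβ hu (e ▸ A.2)
    exact ⟨_, hm, (toPSL_of_unimod hβ hm).trans (congrArg _ (Subtype.ext e))⟩

end Matrices

lemma uniqueCoords_of_sq {R : Type} [CommRing R] [IsDomain R] [CharZero R] {β : R}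
    (hβ : β ^ 2 = -13) : UniqueCoords β := by
  intro a a' b b' h
  have e : (((a - b) ^ 2 + 13 * (a' - b') ^ 2 : ℤ) : R) = 0 := by
    push_cast
    linear_combination ((a : R) - b - (a' - b') * β) * h + ((a' : R) - b') ^ 2 * hβ
  rw [Int.cast_eq_zero] at e
  have h1 : (a - b) ^ 2 = 0 := by nlinarith [sq_nonneg (a - b), sq_nonneg (a' - b')]
  have h2 : (a' - b') ^ 2 = 0 := by nlinarith [sq_nonneg (a - b), sq_nonneg (a' - b')]
  exact ⟨sub_eq_zero.1 (pow_eq_zero_iff two_ne_zero |>.1 h1),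
    sub_eq_zero.1 (pow_eq_zero_iff two_ne_zero |>.1 h2)⟩

lemma nonempty_param (K : Type) [Field K] [NumberField K] (hdeg : Module.finrank ℚ K = 2)
    (hK : ∃ α : K, α ^ 2 = -13) : Nonempty (Param (PSL2 (NumberField.RingOfIntegers K))) := by
  obtain ⟨α, hα⟩ := hK
  have hi : IsIntegral ℤ α := IsIntegral.of_pow two_pos (by
    rw [hα]
    exact_mod_cast (isIntegral_algebraMap (R := ℤ) (A := K) (x := -13)))
  have hβ : (⟨α, hi⟩ : NumberField.RingOfIntegers K) ^ 2 = -13 := by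
    exact NumberField.RingOfIntegers.ext hα
  refine ⟨param hβ (uniqueCoords_of_sq hβ) fun x => ?_⟩
  obtain ⟨a, b, h⟩ := exists_int_coords hdeg hα x.2
  refine ⟨a, b, NumberField.RingOfIntegers.ext ?_⟩
  push_cast
  exact h

end BianchiHomology

/-- The `𝔽₂`-dimensions of the homology of `PSL₂(𝒪₋₁₃)` with trivial `ℤ/2`-coefficients. -/
theorem f2_homology_PSL2_O13 (K : Type) [Field K] [NumberField K]
    (hdeg : Module.finrank ℚ K = 2) (hK : ∃ α : K, α ^ 2 = -13) :
    Module.finrank (ZMod 2) (GroupHomology (ZMod 2) (PSL2 (NumberField.RingOfIntegers K)) (ZMod 2) (1)) = 5 ∧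
    Module.finrank (ZMod 2) (GroupHomology (ZMod 2) (PSL2 (NumberField.RingOfIntegers K)) (ZMod 2) (2)) = 6 ∧
    (∀ q : ℕ, 3 ≤ q → Module.finrank (ZMod 2) (GroupHomology (ZMod 2) (PSL2 (NumberField.RingOfIntegers K)) (ZMod 2) (q)) = 2 * q - 1) := by
  obtain ⟨P⟩ := BianchiHomology.nonempty_param K hdeg hK
  obtain ⟨h1, h2, h3⟩ := P.cellData.finrank_homology
  refine ⟨(BianchiHomology.finrank_homology_trivial 0).trans h1,
    (BianchiHomology.finrank_homology_trivial 1).trans h2,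
    fun q hq => ?_⟩
  obtain ⟨n, rfl⟩ := Nat.exists_eq_add_of_le' hq
  rw [show 2 * (n + 3) - 1 = 2 * n + 5 by omega]
  exact (BianchiHomology.finrank_homology_trivial (n + 2)).trans (h3 n)
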